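/- Let Q be a finite acyclic quiver, 𝒬• = (Q¹,…,Q^ℓ) an admissible, ordered, Dynkin subquiver partition, β₁,…,β_r a Reineke order on Φ₊(𝒬•) with chosen vertices i(u) satisfying β_u(i(u)) = 1, let γ be a dimension vector, and let m = (m₁,…,m_r) be a 𝒬•-partition of γ. Then the ℚ-linear map μ_m : 𝒜_{β₁,m₁} ⊗ ⋯ ⊗ 𝒜_{β_r,m_r} → ℋ_γ induced by (f₁,…,f_r) ↦ f₁ * ⋯ * f_r (left-to-right CoHA product) is injective. -/

import Mathlib

open MvPolynomial
open scoped Classical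

/-- A finite quiver with vertex set `Fin n`: a finite type of arrows together with
head and tail maps. -/
structure FinQuiver (n : ℕ) where
  Arr : Type
  [fintypeArr : Fintype Arr]
  hd : Arr → Fin n
  tl : Arr → Fin n

attribute [instance] FinQuiver.fintypeArr

variable {n : ℕ}

/-- `Q` is acyclic: there is no oriented cycle, i.e. no path
`a₁, …, a_{k+1}` (with `hd aₘ = tl aₘ₊₁`) whose final head equals its initial tail. -/
def FinQuiver.Acyclic (Q : FinQuiver n) : Prop :=
  ∀ (k : ℕ) (c : Fin (k + 1) → Q.Arr),
    (∀ m : Fin k, Q.hd (c m.castSucc) = Q.tl (c m.succ)) →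
    Q.hd (c (Fin.last k)) ≠ Q.tl (c 0)

/-- The Euler form `χ_Q` of the quiver `Q`. -/
def FinQuiver.euler (Q : FinQuiver n) (α β : Fin n → ℕ) : ℤ :=
  ∑ i : Fin n, (α i : ℤ) * β i - ∑ a : Q.Arr, (α (Q.tl a) : ℤ) * β (Q.hd a)

/-- The opposite antisymmetrization `⟨α,β⟩ = χ_Q(β,α) − χ_Q(α,β)`. -/
def FinQuiver.lam (Q : FinQuiver n) (α β : Fin n → ℕ) : ℤ :=
  Q.euler β α - Q.euler α β

/-- The polynomial ring in the variables `ω_{i,j}`, `i ∈ Q₀`, `j ∈ ℕ` (0-indexed). -/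
abbrev PolyQ (n : ℕ) := MvPolynomial (Fin n × ℕ) ℚ

/-- The permutation of the variables at vertex `i` induced by a permutation of `ℕ`. -/
def vertexPerm (i : Fin n) (σ : Equiv.Perm ℕ) : Fin n × ℕ → Fin n × ℕ :=
  fun p => if p.1 = i then (i, σ p.2) else p

/-- `f` is, for each vertex `i`, symmetric in the variables `ω_{i,0},…,ω_{i,γ i − 1}`. -/
def SymmIn (γ : Fin n → ℕ) (f : PolyQ n) : Prop :=
  ∀ (i : Fin n) (σ : Equiv.Perm ℕ),
    (∀ j : ℕ, σ j ≠ j → j < γ i) → rename (vertexPerm i σ) f = f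

lemma vars_smul_subset (c : ℚ) (f : PolyQ n) : (c • f).vars ⊆ f.vars := by
  rw [MvPolynomial.smul_eq_C_mul]
  refine (MvPolynomial.vars_mul _ _).trans ?_
  simp [MvPolynomial.vars_C]

/-- `ℋ_γ`: polynomials using only the variables `ω_{i,j}`, `j < γ i`, which are
symmetric at each vertex.  A `ℚ`-submodule of `PolyQ n`. -/
noncomputable def Hspace (γ : Fin n → ℕ) : Submodule ℚ (PolyQ n) where
  carrier := {f | (∀ p ∈ f.vars, p.2 < γ p.1) ∧ SymmIn γ f}
  add_mem' := by
    rintro f g ⟨hf1, hf2⟩ ⟨hg1, hg2⟩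
    refine ⟨fun p hp => ?_, fun i σ hσ => ?_⟩
    · rcases Finset.mem_union.mp (MvPolynomial.vars_add_subset f g hp) with h | h
      exacts [hf1 p h, hg1 p h]
    · rw [map_add, hf2 i σ hσ, hg2 i σ hσ]
  zero_mem' := by
    refine ⟨fun p hp => ?_, fun i σ hσ => map_zero _⟩
    simp [MvPolynomial.vars_0] at hp
  smul_mem' := by
    rintro c f ⟨hf1, hf2⟩
    refine ⟨fun p hp => hf1 p (vars_smul_subset c f hp), fun i σ hσ => ?_⟩
    rw [map_smul, hf2 i σ hσ]

/-- Polynomials all of whose variables sit at vertex `i`. -/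
noncomputable def onlyVertex (i : Fin n) : Submodule ℚ (PolyQ n) where
  carrier := {f | ∀ p ∈ f.vars, p.1 = i}
  add_mem' := by
    intro f g hf hg p hp
    rcases Finset.mem_union.mp (MvPolynomial.vars_add_subset f g hp) with h | h
    exacts [hf p h, hg p h]
  zero_mem' := by
    intro p hp
    simp [MvPolynomial.vars_0] at hp
  smul_mem' := by
    intro c f hf p hp
    exact hf p (vars_smul_subset c f hp)

/-- `𝒜_{β,m}`: the subspace of `ℋ_{m·β}` of polynomials depending only on the
variables `ω_{i,0},…,ω_{i,m−1}` at the distinguished vertex `i`. -/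
noncomputable def Aspace (β : Fin n → ℕ) (i : Fin n) (m : ℕ) : Submodule ℚ (PolyQ n) :=
  Hspace (fun v => m * β v) ⊓ onlyVertex i

/-- Substitute for the `j`-th variable at vertex `i` the variable `ω_{i,s}` where `s`
is the `j`-th element of `T i` in increasing order. -/
noncomputable def substAlong (T : Fin n → Finset ℕ) : PolyQ n →ₐ[ℚ] PolyQ n :=
  aeval fun p : Fin n × ℕ => X (p.1, ((T p.1).sort (· ≤ ·)).getD p.2 0)

/-- The index set of the Kontsevich–Soibelman localization sum:
for each vertex, a `γ₁ i`-element subset of `{0,…,γ₁ i + γ₂ i − 1}`. -/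
def shuffles (γ₁ γ₂ : Fin n → ℕ) : Finset (Fin n → Finset ℕ) :=
  Fintype.piFinset fun i => (Finset.range (γ₁ i + γ₂ i)).powerset.filter fun s => s.card = γ₁ i

def shuffleCompl (γ₁ γ₂ : Fin n → ℕ) (S : Fin n → Finset ℕ) : Fin n → Finset ℕ :=
  fun i => Finset.range (γ₁ i + γ₂ i) \ S i

/-- The numerator factor attached to the arrow `a`:
`∏_{j' ∈ S̄_{h a}} ∏_{j ∈ S_{t a}} (ω_{h a, j'} − ω_{t a, j})`. -/
noncomputable def arrowFactor (Q : FinQuiver n) (γ₁ γ₂ : Fin n → ℕ)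
    (S : Fin n → Finset ℕ) (a : Q.Arr) : PolyQ n :=
  ∏ j' ∈ shuffleCompl γ₁ γ₂ S (Q.hd a), ∏ j ∈ S (Q.tl a),
    (X (Q.hd a, j') - X (Q.tl a, j))

noncomputable def interactionNum (Q : FinQuiver n) (γ₁ γ₂ : Fin n → ℕ)
    (S : Fin n → Finset ℕ) : PolyQ n :=
  ∏ a : Q.Arr, arrowFactor Q γ₁ γ₂ S a

noncomputable def interactionDen (γ₁ γ₂ : Fin n → ℕ) (S : Fin n → Finset ℕ) : PolyQ n :=
  ∏ i : Fin n, ∏ j' ∈ shuffleCompl γ₁ γ₂ S i, ∏ j ∈ S i, (X (i, j') - X (i, j))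

/-- The Kontsevich–Soibelman localization sum, an element of the field of rational
functions (the fraction field of `PolyQ n`). -/
noncomputable def cohaMulRat (Q : FinQuiver n) (γ₁ γ₂ : Fin n → ℕ) (f₁ f₂ : PolyQ n) :
    FractionRing (PolyQ n) :=
  ∑ S ∈ shuffles γ₁ γ₂,
    algebraMap (PolyQ n) (FractionRing (PolyQ n))
        (substAlong S f₁ * substAlong (shuffleCompl γ₁ γ₂ S) f₂ * interactionNum Q γ₁ γ₂ S) /
      algebraMap (PolyQ n) (FractionRing (PolyQ n)) (interactionDen γ₁ γ₂ S)

/-- The CoHA product `f₁ * f₂`: the unique polynomial representing the localization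
sum (and `0` if the sum were not a polynomial, which never happens). -/
noncomputable def cohaMul (Q : FinQuiver n) (γ₁ γ₂ : Fin n → ℕ) (f₁ f₂ : PolyQ n) : PolyQ n :=
  if h : ∃ P : PolyQ n,
      algebraMap (PolyQ n) (FractionRing (PolyQ n)) P = cohaMulRat Q γ₁ γ₂ f₁ f₂ then
    h.choose
  else 0

/-- Iterated, left-to-right, CoHA product of a list of dimension-vector/polynomial pairs.
Returns the total dimension vector together with the product. -/
noncomputable def cohaProd (Q : FinQuiver n) :
    List ((Fin n → ℕ) × PolyQ n) → (Fin n → ℕ) × PolyQ n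
  | [] => (fun _ => 0, 1)
  | x :: xs => xs.foldl (fun acc y => (acc.1 + y.1, cohaMul Q acc.1 y.1 acc.2 y.2)) x

/-- Left-to-right CoHA product `f 0 * f 1 * ⋯ * f (r−1)` with `f u ∈ ℋ_{γ u}`. -/
noncomputable def cohaProdFin (Q : FinQuiver n) {r : ℕ} (γ : Fin r → Fin n → ℕ)
    (f : Fin r → PolyQ n) : PolyQ n :=
  (cohaProd Q (List.ofFn fun u => (γ u, f u))).2

/-- The quiver with one vertex and no arrows. -/
def A1 : FinQuiver 1 := { Arr := Empty, hd := Empty.elim, tl := Empty.elim }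

/-- `ψ_p = x₁ ^ p ∈ ℋ₁(A₁)`. -/
noncomputable def psi (p : ℕ) : PolyQ 1 := X ((0 : Fin 1), 0) ^ p

def oneDim : Fin 1 → ℕ := fun _ => 1

/-- The simple dimension vector `e_i`. -/
def simpleDim (i : Fin n) : Fin n → ℕ := fun v => if v = i then 1 else 0

/-- A subquiver of `Q`. -/
structure Subquiver (Q : FinQuiver n) where
  verts : Finset (Fin n)
  arrows : Finset Q.Arr
  hd_mem : ∀ a ∈ arrows, Q.hd a ∈ verts
  tl_mem : ∀ a ∈ arrows, Q.tl a ∈ verts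

def Subquiver.Full {Q : FinQuiver n} (Q' : Subquiver Q) : Prop :=
  ∀ a : Q.Arr, Q.hd a ∈ Q'.verts → Q.tl a ∈ Q'.verts → a ∈ Q'.arrows

/-- Adjacency in the underlying undirected graph of a subquiver. -/
def Subquiver.Adj {Q : FinQuiver n} (Q' : Subquiver Q) (x y : Fin n) : Prop :=
  ∃ a ∈ Q'.arrows, (Q.hd a = x ∧ Q.tl a = y) ∨ (Q.hd a = y ∧ Q.tl a = x)

def Subquiver.Connected {Q : FinQuiver n} (Q' : Subquiver Q) : Prop :=
  ∀ x ∈ Q'.verts, ∀ y ∈ Q'.verts, Relation.ReflTransGen Q'.Adj x y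

/-- The Euler form of the subquiver `Q'` (on `ℤ`-valued vectors). -/
def Subquiver.eulerZ {Q : FinQuiver n} (Q' : Subquiver Q) (α β : Fin n → ℤ) : ℤ :=
  ∑ i ∈ Q'.verts, α i * β i - ∑ a ∈ Q'.arrows, α (Q.tl a) * β (Q.hd a)

/-- Positive definiteness of the Tits form of `Q'` on vectors supported on `Q'`. -/
def Subquiver.PosDefTits {Q : FinQuiver n} (Q' : Subquiver Q) : Prop :=
  ∀ β : Fin n → ℤ, (∀ i, i ∉ Q'.verts → β i = 0) → β ≠ 0 → 0 < Q'.eulerZ β β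

/-- A connected full subquiver with positive definite Tits form. -/
def Subquiver.IsDynkin {Q : FinQuiver n} (Q' : Subquiver Q) : Prop :=
  Q'.Connected ∧ Q'.Full ∧ Q'.PosDefTits

/-- A positive root of `Q'`: a nonzero dimension vector supported on `Q'` with
Tits form equal to `1`. -/
def Subquiver.IsPosRoot {Q : FinQuiver n} (Q' : Subquiver Q) (β : Fin n → ℕ) : Prop :=
  (∀ i, i ∉ Q'.verts → β i = 0) ∧ β ≠ 0 ∧
    Q'.eulerZ (fun i => (β i : ℤ)) (fun i => (β i : ℤ)) = 1

/-- A subquiver regarded as a quiver in its own right (on the ambient vertex set). -/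
def Subquiver.toQuiver {Q : FinQuiver n} (Q' : Subquiver Q) : FinQuiver n :=
  { Arr := {a : Q.Arr // a ∈ Q'.arrows}, hd := fun a => Q.hd a.1, tl := fun a => Q.tl a.1 }

/-- An (ordered list) subquiver partition `𝒬• = (Q¹,…,Q^ℓ)`: nonempty connected
subquivers whose vertex sets partition `Q₀`. -/
structure SubqPartition (Q : FinQuiver n) (ℓ : ℕ) where
  part : Fin ℓ → Subquiver Q
  nonempty' : ∀ j, (part j).verts.Nonempty
  connected' : ∀ j, (part j).Connected
  cover : ∀ i : Fin n, ∃! j, i ∈ (part j).verts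

/-- The set `𝒬•₁` of arrows belonging to one of the parts. -/
noncomputable def SubqPartition.arrs {Q : FinQuiver n} {ℓ : ℕ} (P : SubqPartition Q ℓ) : Finset Q.Arr :=
  Finset.univ.biUnion fun j => (P.part j).arrows

/-- The partition is admissible and ordered: every arrow not inside a part goes from a
later part to an earlier part (head before tail). -/
def SubqPartition.Ordered {Q : FinQuiver n} {ℓ : ℕ} (P : SubqPartition Q ℓ) : Prop :=
  ∀ a : Q.Arr, a ∉ P.arrs → ∀ i j : Fin ℓ,
    Q.hd a ∈ (P.part i).verts → Q.tl a ∈ (P.part j).verts → i < j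

/-- Every part is a Dynkin subquiver. -/
def SubqPartition.Dynkin {Q : FinQuiver n} {ℓ : ℕ} (P : SubqPartition Q ℓ) : Prop :=
  ∀ j, (P.part j).IsDynkin

/-- `β : Fin r → (Fin n → ℕ)` is a Reineke-ordered enumeration of `Φ₊(𝒬•)`, with
`blk u` the part to which `β u` belongs: block-monotone, enumerating all positive roots
without repetition, and within each block `u < v → ⟨β u, β v⟩ ≥ 0`. -/
def IsReinekeOrder {Q : FinQuiver n} {ℓ : ℕ} (P : SubqPartition Q ℓ) {r : ℕ}
    (β : Fin r → Fin n → ℕ) (blk : Fin r → Fin ℓ) : Prop :=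
  Monotone blk ∧
  (∀ u, (P.part (blk u)).IsPosRoot (β u)) ∧
  Function.Injective β ∧
  (∀ j (b : Fin n → ℕ), (P.part j).IsPosRoot b → ∃ u, β u = b) ∧
  (∀ u v : Fin r, u < v → blk u = blk v → 0 ≤ Q.lam (β u) (β v))

open scoped TensorProduct

open MvPolynomial
open scoped Classical TensorProduct

namespace MuInj
open Equiv (Perm)

/-- products of differences of variables -/
noncomputable def PP {N : ℕ} (e : Fin N → Fin N → ℕ) : MvPolynomial (Fin N) ℚ :=
  ∏ x, ∏ y, (X y - X x) ^ (e x y)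

section PartA
variable {N : ℕ}

lemma PP_add (e e' : Fin N → Fin N → ℕ) : PP (fun x y => e x y + e' x y) = PP e * PP e' := by
  simp only [PP, ← Finset.prod_mul_distrib, pow_add]

lemma PP_dvd {e e' : Fin N → Fin N → ℕ} (h : ∀ x y, e x y ≤ e' x y) : PP e ∣ PP e' := by
  refine ⟨PP (fun x y => e' x y - e x y), ?_⟩
  rw [← PP_add]
  congr 1
  funext x y
  have := h x y
  omega

lemma rename_PP (σ : Perm (Fin N)) (e : Fin N → Fin N → ℕ) :
    rename σ (PP e) = PP (fun x y => e (σ.symm x) (σ.symm y)) := by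
  simp only [PP, map_prod, map_pow, map_sub, rename_X]
  rw [← Equiv.prod_comp σ (fun x => ∏ y, (X y - X x : MvPolynomial (Fin N) ℚ) ^ (e (σ.symm x) (σ.symm y)))]
  refine Finset.prod_congr rfl fun x _ => ?_
  rw [← Equiv.prod_comp σ (fun y => (X y - X (σ x) : MvPolynomial (Fin N) ℚ) ^ (e (σ.symm (σ x)) (σ.symm y)))]
  simp

lemma eval_PP (z : Fin N → ℚ) (e : Fin N → Fin N → ℕ) :
    eval z (PP e) = ∏ x, ∏ y, (z y - z x) ^ (e x y) := by
  simp [PP]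

lemma eval_PP_ne_zero (z : Fin N → ℚ) (e : Fin N → Fin N → ℕ)
    (h : ∀ x y, z x = z y → e x y = 0) : eval z (PP e) ≠ 0 := by
  rw [eval_PP]
  refine Finset.prod_ne_zero_iff.2 fun x _ => Finset.prod_ne_zero_iff.2 fun y _ => ?_
  by_cases hxy : z x = z y
  · rw [h x y hxy]; simp
  · exact pow_ne_zero _ (sub_ne_zero.2 (fun hh => hxy hh.symm))

lemma PP_ne_zero (e : Fin N → Fin N → ℕ) (h : ∀ x, e x x = 0) : PP e ≠ 0 := by
  intro h0
  have := eval_PP_ne_zero (fun x : Fin N => (x.val : ℚ)) e (fun x y hxy => by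
    have : x = y := by
      apply Fin.ext
      exact_mod_cast hxy
    subst this; exact h x)
  rw [h0] at this
  simp at this

lemma aeval_PP {S : Type*} [CommRing S] [Algebra ℚ S] (z : Fin N → S) (e : Fin N → Fin N → ℕ) :
    aeval z (PP e) = ∏ x, ∏ y, (z y - z x) ^ (e x y) := by
  simp [PP]

/-- sign as a polynomial -/
noncomputable def sg (σ : Perm (Fin N)) : MvPolynomial (Fin N) ℚ :=
  ((Equiv.Perm.sign σ : ℤ) : MvPolynomial (Fin N) ℚ)

lemma sg_mul (σ τ : Perm (Fin N)) : sg (σ * τ) = sg σ * sg τ := by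
  simp [sg]

lemma sg_sq (σ : Perm (Fin N)) : sg σ * sg σ = 1 := by
  rw [sg]
  norm_cast
  simp

lemma sg_eq (σ : Perm (Fin N)) : sg σ = 1 ∨ sg σ = -1 := by
  rcases Int.units_eq_one_or (Equiv.Perm.sign σ) with h | h <;> simp [sg, h]

lemma sg_inv (σ : Perm (Fin N)) : sg σ⁻¹ = sg σ := by simp [sg]

@[simp] lemma sg_one : sg (1 : Perm (Fin N)) = 1 := by simp [sg]

@[simp] lemma rename_sg (σ τ : Perm (Fin N)) : rename σ (sg τ) = sg τ := by
  simp [sg]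

/-- Young subgroup -/
noncomputable def W (s : Setoid (Fin N)) : Finset (Perm (Fin N)) :=
  Finset.univ.filter fun σ => ∀ x, s x (σ x)

lemma mem_W {s : Setoid (Fin N)} {σ : Perm (Fin N)} : σ ∈ W s ↔ ∀ x, s x (σ x) := by
  simp [W]

lemma one_mem_W (s : Setoid (Fin N)) : (1 : Perm (Fin N)) ∈ W s := mem_W.2 fun x => s.refl x

lemma mul_mem_W {s : Setoid (Fin N)} {σ τ : Perm (Fin N)} (h : σ ∈ W s) (h' : τ ∈ W s) :
    σ * τ ∈ W s := by
  rw [mem_W] at *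
  intro x
  exact s.trans (h' x) (h (τ x))

lemma inv_mem_W {s : Setoid (Fin N)} {σ : Perm (Fin N)} (h : σ ∈ W s) : σ⁻¹ ∈ W s := by
  rw [mem_W] at *
  intro x
  have := h (σ⁻¹ x)
  rw [Equiv.Perm.inv_def, Equiv.apply_symm_apply] at this
  exact s.symm this

lemma W_mono {s s' : Setoid (Fin N)} (h : s' ≤ s) {σ : Perm (Fin N)} (hσ : σ ∈ W s') : σ ∈ W s := by
  rw [mem_W] at *
  intro x
  exact h (hσ x)

lemma card_W_ne_zero (s : Setoid (Fin N)) : ((W s).card : MvPolynomial (Fin N) ℚ) ≠ 0 := by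
  have : (W s).card ≠ 0 := Finset.card_ne_zero_of_mem (one_mem_W s)
  exact_mod_cast this

lemma W_sum_mul_left {M : Type*} [AddCommMonoid M] {s : Setoid (Fin N)} {τ : Perm (Fin N)} (h : τ ∈ W s)
    (F : Perm (Fin N) → M) : ∑ σ ∈ W s, F (τ * σ) = ∑ σ ∈ W s, F σ := by
  refine Finset.sum_bij' (fun σ _ => τ * σ) (fun σ _ => τ⁻¹ * σ) ?_ ?_ ?_ ?_ ?_
  · intro a ha; exact mul_mem_W h ha
  · intro a ha; exact mul_mem_W (inv_mem_W h) ha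
  · intros; simp
  · intros; simp
  · intros; rfl

lemma W_sum_mul_right {M : Type*} [AddCommMonoid M] {s : Setoid (Fin N)} {τ : Perm (Fin N)} (h : τ ∈ W s)
    (F : Perm (Fin N) → M) : ∑ σ ∈ W s, F (σ * τ) = ∑ σ ∈ W s, F σ := by
  refine Finset.sum_bij' (fun σ _ => σ * τ) (fun σ _ => σ * τ⁻¹) ?_ ?_ ?_ ?_ ?_
  · intro a ha; exact mul_mem_W ha h
  · intro a ha; exact mul_mem_W ha (inv_mem_W h)
  · intros; simp
  · intros; simp
  · intros; rfl

/-- antisymmetrisation -/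
noncomputable def Alt (s : Setoid (Fin N)) : MvPolynomial (Fin N) ℚ →ₗ[ℚ] MvPolynomial (Fin N) ℚ :=
  ∑ σ ∈ W s, (LinearMap.mulLeft ℚ (sg σ)).comp (rename σ).toLinearMap

lemma Alt_apply (s : Setoid (Fin N)) (h : MvPolynomial (Fin N) ℚ) :
    Alt s h = ∑ σ ∈ W s, sg σ * rename σ h := by
  simp [Alt, LinearMap.sum_apply]

lemma rename_mul_perm (σ τ : Perm (Fin N)) (h : MvPolynomial (Fin N) ℚ) :
    rename (σ * τ) h = rename σ (rename τ h) := by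
  rw [rename_rename]; rfl

lemma rename_Alt {s : Setoid (Fin N)} {τ : Perm (Fin N)} (hτ : τ ∈ W s) (h : MvPolynomial (Fin N) ℚ) :
    rename τ (Alt s h) = sg τ * Alt s h := by
  rw [Alt_apply, map_sum, ← W_sum_mul_left hτ (fun σ => sg σ * rename σ h), Finset.mul_sum]
  refine Finset.sum_congr rfl fun σ _ => ?_
  rw [map_mul, rename_sg, rename_mul_perm, sg_mul]
  linear_combination (-sg σ * rename τ (rename σ h)) * sg_sq τ

lemma Alt_rename {s : Setoid (Fin N)} {τ : Perm (Fin N)} (hτ : τ ∈ W s) (h : MvPolynomial (Fin N) ℚ) :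
    Alt s (rename τ h) = sg τ * Alt s h := by
  rw [Alt_apply, Alt_apply, ← W_sum_mul_right hτ (fun σ => sg σ * rename σ h), Finset.mul_sum]
  refine Finset.sum_congr rfl fun σ _ => ?_
  rw [rename_mul_perm, sg_mul]
  linear_combination (-sg σ * rename σ (rename τ h)) * sg_sq τ

def Inv (s : Setoid (Fin N)) (g : MvPolynomial (Fin N) ℚ) : Prop := ∀ σ ∈ W s, rename σ g = g

def Anti (s : Setoid (Fin N)) (g : MvPolynomial (Fin N) ℚ) : Prop := ∀ σ ∈ W s, rename σ g = sg σ * g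

lemma Inv.mul {s : Setoid (Fin N)} {g h : MvPolynomial (Fin N) ℚ} (hg : Inv s g) (hh : Inv s h) :
    Inv s (g * h) := fun σ hσ => by rw [map_mul, hg σ hσ, hh σ hσ]

lemma Inv.anti {s : Setoid (Fin N)} {g h : MvPolynomial (Fin N) ℚ} (hg : Inv s g) (hh : Anti s h) :
    Anti s (g * h) := fun σ hσ => by rw [map_mul, hg σ hσ, hh σ hσ]; ring

lemma Inv.mono {s s' : Setoid (Fin N)} (h : s' ≤ s) {g : MvPolynomial (Fin N) ℚ} (hg : Inv s g) :
    Inv s' g := fun σ hσ => hg σ (W_mono h hσ)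

lemma Anti.mono {s s' : Setoid (Fin N)} (h : s' ≤ s) {g : MvPolynomial (Fin N) ℚ} (hg : Anti s g) :
    Anti s' g := fun σ hσ => hg σ (W_mono h hσ)

lemma anti_Alt (s : Setoid (Fin N)) (h : MvPolynomial (Fin N) ℚ) : Anti s (Alt s h) :=
  fun _ hσ => rename_Alt hσ h

lemma Alt_inv_mul {s : Setoid (Fin N)} {g : MvPolynomial (Fin N) ℚ} (hg : Inv s g)
    (h : MvPolynomial (Fin N) ℚ) : Alt s (g * h) = g * Alt s h := by
  rw [Alt_apply, Alt_apply, Finset.mul_sum]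
  refine Finset.sum_congr rfl fun σ hσ => ?_
  rw [map_mul, hg σ hσ]; ring

lemma Alt_Alt {s s' : Setoid (Fin N)} (hs : s' ≤ s) {g : MvPolynomial (Fin N) ℚ} (hg : Inv s' g)
    (h : MvPolynomial (Fin N) ℚ) : Alt s (g * Alt s' h) = (W s').card * Alt s (g * h) := by
  rw [← Alt_inv_mul hg, Alt_apply s', map_sum]
  have : ∀ σ ∈ W s', Alt s (sg σ * rename σ (g * h)) = Alt s (g * h) := by
    intro σ hσ
    rw [Alt_inv_mul, Alt_rename (W_mono hs hσ)]
    · linear_combination Alt s (g * h) * sg_sq σ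
    · intro τ _; simp
  rw [Finset.sum_congr rfl this]
  simp

lemma Alt_of_anti {s : Setoid (Fin N)} {h : MvPolynomial (Fin N) ℚ} (hh : Anti s h) :
    Alt s h = (W s).card * h := by
  rw [Alt_apply]
  have : ∀ σ ∈ W s, sg σ * rename σ h = h := by
    intro σ hσ
    rw [hh σ hσ]
    linear_combination h * sg_sq σ
  rw [Finset.sum_congr rfl this]
  simp

/-- Vandermonde product of a setoid -/
noncomputable def Van (s : Setoid (Fin N)) : MvPolynomial (Fin N) ℚ :=
  PP fun x y => if x < y ∧ s x y then 1 else 0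

lemma Van_ne_zero (s : Setoid (Fin N)) : Van s ≠ 0 := PP_ne_zero _ (by simp)

lemma PP_swap (e : Fin N → Fin N → ℕ) : ∃ ε : MvPolynomial (Fin N) ℚ,
    (∃ k : ℕ, ε = (-1) ^ k) ∧ PP e = ε * PP (fun x y => e y x) := by
  refine ⟨(-1) ^ (∑ x, ∑ y, e x y), ⟨_, rfl⟩, ?_⟩
  rw [PP, PP, Finset.prod_comm (γ := Fin N), ← Finset.prod_pow_eq_pow_sum]
  rw [Finset.prod_comm]
  simp_rw [← Finset.prod_pow_eq_pow_sum]
  rw [Finset.prod_comm (f := fun x y => (X y - X x : MvPolynomial (Fin N) ℚ) ^ (e y x)), ← Finset.prod_mul_distrib]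
  refine Finset.prod_congr rfl fun x _ => ?_
  rw [← Finset.prod_mul_distrib]
  refine Finset.prod_congr rfl fun y _ => ?_
  rw [← mul_pow]; congr 1; ring

lemma PP_full_sign (σ : Perm (Fin N)) :
    rename σ (PP fun x y => if x < y then 1 else 0) = sg σ * PP fun x y => if x < y then 1 else 0 := by
  have key : (PP fun x y : Fin N => if x < y then 1 else 0) =
      ∏ x, ∏ y ∈ Finset.Ioi x, (X y - X x) := by
    rw [PP]
    refine Finset.prod_congr rfl fun x _ => ?_
    rw [← Finset.prod_subset (Finset.subset_univ (Finset.Ioi x))]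
    · refine Finset.prod_congr rfl fun y hy => ?_
      rw [Finset.mem_Ioi] at hy
      simp [hy]
    · intro y _ hy
      rw [Finset.mem_Ioi] at hy
      simp [hy]
  rw [key]
  simp only [map_prod, map_sub, rename_X]
  rw [Equiv.Perm.prod_Ioi_comp_eq_sign_mul_prod (f := fun x y => (X y - X x : MvPolynomial (Fin N) ℚ))]
  · rfl
  · intros; ring

lemma Van_anti (s : Setoid (Fin N)) : Anti s (Van s) := by
  intro σ hσ
  have hσ' := mem_W.1 hσ
  have hs : ∀ x y, s (σ.symm x) (σ.symm y) ↔ s x y := by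
    intro x y
    have h1 := hσ' (σ.symm x)
    have h2 := hσ' (σ.symm y)
    simp only [Equiv.apply_symm_apply] at h1 h2
    exact ⟨fun h => s.trans (s.symm h1) (s.trans h h2), fun h => s.trans h1 (s.trans h (s.symm h2))⟩
  have hsq : (rename σ (Van s)) ^ 2 = (Van s) ^ 2 := by
    obtain ⟨ε, ⟨k, hk⟩, h⟩ := PP_swap (fun x y : Fin N => if x < y ∧ s x y then 1 else 0)
    have h2 : Van s ^ 2 = ε * PP (fun x y : Fin N => if x ≠ y ∧ s x y then 1 else 0) := by
      rw [sq]
      nth_rw 2 [Van]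
      rw [h, Van, mul_left_comm, ← PP_add]
      congr 2
      funext x y
      have : s x y ↔ s y x := ⟨fun h => s.symm h, fun h => s.symm h⟩
      rcases lt_trichotomy x y with h | h | h
      · simp [h, h.ne, h.not_gt]
      · simp [h]
      · simp [h, h.ne', h.not_gt, this]
    rw [← map_pow, h2, map_mul, rename_PP, hk]
    simp [hs]
  rcases sq_eq_sq_iff_eq_or_eq_neg.1 hsq with h | h
  all_goals
    have hfull := PP_full_sign σ
    have hdec : (PP fun x y : Fin N => if x < y then 1 else 0) =
        Van s * PP (fun x y => if x < y ∧ ¬ s x y then 1 else 0) := by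
      rw [Van, ← PP_add]
      congr 1; funext x y
      by_cases h1 : x < y <;> by_cases h2 : s x y <;> simp [h1, h2]
    rw [hdec, map_mul, h] at hfull
    rw [h]
    have hfull2 := congrArg (eval (fun x : Fin N => ((Quotient.mk s x).out.val : ℚ))) (
      mul_left_cancel₀ (Van_ne_zero s) (show Van s * rename σ _ = Van s * (_ : MvPolynomial (Fin N) ℚ) from by
        first
        | exact hfull.trans (mul_left_comm _ _ _)
        | exact ((neg_eq_iff_eq_neg.1 ((neg_mul _ _).symm.trans (hfull.trans (mul_left_comm _ _ _))))).trans (mul_neg _ _).symm))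
    have he : (fun x : Fin N => ((Quotient.mk s x).out.val : ℚ)) ∘ σ =
        (fun x : Fin N => ((Quotient.mk s x).out.val : ℚ)) := by
      funext x
      simp only [Function.comp]
      rw [Quotient.sound (s.symm (hσ' x))]
    rw [eval_rename, he] at hfull2
    have hne := eval_PP_ne_zero (fun x : Fin N => ((Quotient.mk s x).out.val : ℚ))
      (fun x y => if x < y ∧ ¬ s x y then 1 else 0) (fun x y hxy => by
        have h1 : (Quotient.mk s x).out = (Quotient.mk s y).out := Fin.ext (by exact_mod_cast hxy)
        have h2 : Quotient.mk s x = Quotient.mk s y := by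
          rw [← Quotient.out_eq (Quotient.mk s x), h1, Quotient.out_eq]
        have h3 : s x y := Quotient.exact h2
        simp [h3])
    rcases sg_eq σ with hsg | hsg
    all_goals
      rw [hsg] at hfull2 ⊢
      simp only [map_neg, one_mul, neg_mul, neg_neg] at hfull2 ⊢
      first
      | done
      | (exfalso; apply hne; linarith)


lemma sub_dvd_of_subst {x y : Fin N} {g : MvPolynomial (Fin N) ℚ}
    (hg : aeval (fun w => if w = y then X x else X w : Fin N → MvPolynomial (Fin N) ℚ) g = 0) :
    (X y - X x : MvPolynomial (Fin N) ℚ) ∣ g := by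
  rw [← Ideal.mem_span_singleton, ← Ideal.Quotient.eq_zero_iff_mem]
  have : (Ideal.Quotient.mkₐ ℚ (Ideal.span {(X y - X x : MvPolynomial (Fin N) ℚ)})).comp
      (aeval (fun w => if w = y then X x else X w : Fin N → MvPolynomial (Fin N) ℚ)) =
      Ideal.Quotient.mkₐ ℚ (Ideal.span {(X y - X x : MvPolynomial (Fin N) ℚ)}) := by
    apply MvPolynomial.algHom_ext
    intro w
    simp only [AlgHom.comp_apply, aeval_X, Ideal.Quotient.mkₐ_eq_mk]
    by_cases hw : w = y
    · subst hw
      simp only [if_true]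
      rw [eq_comm, Ideal.Quotient.eq]
      exact Ideal.mem_span_singleton_self _
    · simp [hw]
  have h2 := DFunLike.congr_fun this g
  simp only [AlgHom.comp_apply, hg, map_zero, Ideal.Quotient.mkₐ_eq_mk] at h2
  exact h2.symm

lemma sub_dvd_of_anti {x y : Fin N} (hxy : x ≠ y) {g : MvPolynomial (Fin N) ℚ}
    (hg : rename (Equiv.swap x y) g = - g) :
    (X y - X x : MvPolynomial (Fin N) ℚ) ∣ g := by
  apply sub_dvd_of_subst
  set φ := aeval (R := ℚ) (fun w => if w = y then X x else X w : Fin N → MvPolynomial (Fin N) ℚ)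
  have : φ (rename (Equiv.swap x y) g) = φ g := by
    rw [aeval_rename]
    congr 2
    funext w
    simp only [Function.comp]
    by_cases h1 : w = y
    · subst h1; simp [hxy]
    · by_cases h2 : w = x
      · subst h2; simp [hxy]
      · rw [Equiv.swap_apply_of_ne_of_ne h2 h1]
  rw [hg, map_neg] at this
  have h2 : (2 : MvPolynomial (Fin N) ℚ) * φ g = 0 := by linear_combination -this
  simpa using h2

lemma prime_sub {x y : Fin N} (hxy : x ≠ y) : Prime (X y - X x : MvPolynomial (Fin N) ℚ) := by
  let f : MvPolynomial (Fin N) ℚ →ₐ[ℚ] MvPolynomial (Fin N) ℚ :=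
    aeval (fun w => if w = y then X y + X x else X w)
  let g : MvPolynomial (Fin N) ℚ →ₐ[ℚ] MvPolynomial (Fin N) ℚ :=
    aeval (fun w => if w = y then X y - X x else X w)
  have hfg : f.comp g = AlgHom.id ℚ _ := by
    apply MvPolynomial.algHom_ext
    intro w
    by_cases hw : w = y
    · simp [f, g, hw, hxy]
    · simp [f, g, hw]
  have hgf : g.comp f = AlgHom.id ℚ _ := by
    apply MvPolynomial.algHom_ext
    intro w
    by_cases hw : w = y
    · simp [f, g, hw, hxy]
    · simp [f, g, hw]
  let E := AlgEquiv.ofAlgHom f g hfg hgf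
  rw [← MulEquiv.prime_iff E]
  have : E (X y - X x) = X y := by
    change f (X y - X x) = X y
    simp [f, hxy]
  rw [this]
  exact X_prime

lemma not_sub_dvd {x y x' y' : Fin N} (hxy : x < y) (hxy' : x' < y') (hne : (x, y) ≠ (x', y')) :
    ¬ (X y - X x : MvPolynomial (Fin N) ℚ) ∣ (X y' - X x') := by
  rintro ⟨q, hq⟩
  have h := congrArg (eval (fun w : Fin N => if w = y then (x.val : ℚ) else w.val)) hq
  simp only [map_mul, map_sub, eval_X, if_true, hxy.ne, if_false, sub_self, zero_mul] at h
  have h' := congrArg (eval (fun w : Fin N => if w = y then (0 : ℚ) else if w = x then 0 else 1)) hq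
  have h'' := congrArg (eval (fun w : Fin N => if w = y then (x.val : ℚ) else w.val)) hq
  have : x' ≠ y' := hxy'.ne
  by_cases h1 : x' = y
  · have h2 : ¬ y' = y := by omega
    simp only [h1, if_true, h2, if_false] at h
    have h3 : y'.val = x.val := by
      have : (y'.val : ℚ) = x.val := by linarith
      exact_mod_cast this
    omega
  · by_cases h2 : y' = y
    · simp only [h1, h2, if_true, if_false] at h
      have h3 : x'.val = x.val := by
        have : (x'.val : ℚ) = x.val := by linarith
        exact_mod_cast this
      exact hne (by ext <;> simp [h2, h3])
    · simp only [h1, h2, if_false] at h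
      have h3 : y'.val = x'.val := by
        have : (y'.val : ℚ) = x'.val := by linarith
        exact_mod_cast this
      omega

lemma Van_dvd {s : Setoid (Fin N)} {g : MvPolynomial (Fin N) ℚ} (hg : Anti s g) : Van s ∣ g := by
  have hV : Van s = ∏ p ∈ (Finset.univ : Finset (Fin N × Fin N)).filter (fun p => p.1 < p.2 ∧ s p.1 p.2),
      (X p.2 - X p.1) := by
    rw [Finset.prod_filter, Fintype.prod_prod_type]
    rw [Van, PP]
    refine Finset.prod_congr rfl fun x _ => Finset.prod_congr rfl fun y _ => ?_
    split_ifs <;> simp_all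
  rw [hV]
  apply Finset.prod_dvd_of_isRelPrime
  · rintro ⟨x, y⟩ h ⟨x', y'⟩ h' hne
    simp only [Finset.coe_filter, Finset.mem_univ, true_and, Set.mem_ofPred_eq] at h h'
    exact ((prime_sub h.1.ne).irreducible.isRelPrime_iff_not_dvd).2 (not_sub_dvd h.1 h'.1 hne)
  · rintro ⟨x, y⟩ h
    simp only [Finset.mem_filter, Finset.mem_univ, true_and] at h
    apply sub_dvd_of_anti h.1.ne
    rw [hg (Equiv.swap x y)]
    · simp [sg, Equiv.Perm.sign_swap h.1.ne]
    · rw [mem_W]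
      intro w
      by_cases h1 : w = x
      · subst h1; simpa using h.2
      · by_cases h2 : w = y
        · subst h2; simpa using s.symm h.2
        · rw [Equiv.swap_apply_of_ne_of_ne h1 h2]

lemma Alt_dvd (s : Setoid (Fin N)) (h : MvPolynomial (Fin N) ℚ) : ∃ q, Alt s h = Van s * q :=
  Van_dvd (anti_Alt s h)

end PartA
end MuInj

open MvPolynomial
open scoped Classical TensorProduct

namespace MuInj
open Equiv (Perm)
section PartB
variable {N n : ℕ}

/-- the setoid with classes the fibers of `f` on `A`, singletons outside -/
def Sd {K : Type*} (A : Finset (Fin N)) (f : Fin N → K) : Setoid (Fin N) where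
  r x y := x = y ∨ (x ∈ A ∧ y ∈ A ∧ f x = f y)
  iseqv := by
    refine ⟨fun x => Or.inl rfl, ?_, ?_⟩
    · rintro x y (h | ⟨h1, h2, h3⟩)
      · exact Or.inl h.symm
      · exact Or.inr ⟨h2, h1, h3.symm⟩
    · rintro x y z (h | ⟨h1, h2, h3⟩) (h' | ⟨h1', h2', h3'⟩)
      · exact Or.inl (h.trans h')
      · subst h; exact Or.inr ⟨h1', h2', h3'⟩
      · subst h'; exact Or.inr ⟨h1, h2, h3⟩
      · exact Or.inr ⟨h1, h2', h3.trans h3'⟩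

lemma Sd_iff {K : Type*} {A : Finset (Fin N)} {f : Fin N → K} {x y : Fin N} :
    Sd A f x y ↔ x = y ∨ (x ∈ A ∧ y ∈ A ∧ f x = f y) := Iff.rfl

lemma Sd_le {K L : Type*} {A B : Finset (Fin N)} {f : Fin N → K} {g : Fin N → L} (hAB : A ⊆ B)
    (h : ∀ x ∈ A, ∀ y ∈ A, f x = f y → g x = g y) : Sd A f ≤ Sd B g := by
  rintro x y (h1 | ⟨h1, h2, h3⟩)
  · exact Or.inl h1
  · exact Or.inr ⟨hAB h1, hAB h2, h x h1 y h2 h3⟩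

lemma W_Sd {K : Type*} {A : Finset (Fin N)} {f : Fin N → K} {σ : Perm (Fin N)} (hσ : σ ∈ W (Sd A f)) :
    (∀ x, σ x ∈ A ↔ x ∈ A) ∧ (∀ x, f (σ x) = f x) ∧ (∀ x, x ∉ A → σ x = x) := by
  rw [mem_W] at hσ
  refine ⟨fun x => ?_, fun x => ?_, fun x hx => ?_⟩
  · rcases hσ x with h | ⟨h1, h2, h3⟩
    · rw [← h]
    · simp [h1, h2]
  · rcases hσ x with h | ⟨h1, h2, h3⟩
    · rw [← h]
    · exact h3.symm
  · rcases hσ x with h | ⟨h1, h2, h3⟩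
    · exact h.symm
    · exact absurd h1 hx

lemma W_Sd_symm {K : Type*} {A : Finset (Fin N)} {f : Fin N → K} {σ : Perm (Fin N)} (hσ : σ ∈ W (Sd A f)) :
    (∀ x, σ.symm x ∈ A ↔ x ∈ A) ∧ (∀ x, f (σ.symm x) = f x) ∧ (∀ x, x ∉ A → σ.symm x = x) :=
  W_Sd (inv_mem_W hσ)

/-- degree of `PP e` -/
def dg (e : Fin N → Fin N → ℕ) : ℕ := ∑ x, ∑ y, e x y

/-- exponents of the Vandermonde product -/
noncomputable def ve (s : Setoid (Fin N)) : Fin N → Fin N → ℕ := fun x y => if x < y ∧ s x y then 1 else 0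

lemma Van_eq (s : Setoid (Fin N)) : Van s = PP (ve s) := rfl

lemma dg_perm (σ : Perm (Fin N)) (e : Fin N → Fin N → ℕ) :
    dg (fun x y => e (σ.symm x) (σ.symm y)) = dg e := by
  unfold dg
  rw [← Equiv.sum_comp σ.symm (fun x => ∑ y, e x y)]
  refine Finset.sum_congr rfl fun x _ => ?_
  rw [← Equiv.sum_comp σ.symm (fun y => e (σ.symm x) y)]

lemma Van_le {s s' : Setoid (Fin N)} (h : s' ≤ s) :
    Van s = Van s' * PP (fun x y => if x < y ∧ s x y ∧ ¬ s' x y then 1 else 0) := by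
  rw [Van, Van, ← PP_add]
  congr 1; funext x y
  by_cases h1 : x < y <;> by_cases h2 : s x y <;> by_cases h3 : s' x y <;> simp [h1, h2, h3]
  exact h2 (h h3)

/-- vanishing condition -/
def Null (v : Fin N → Fin n) (A : Finset (Fin N)) (g : MvPolynomial (Fin N) ℚ) : Prop :=
  ∀ h q, Alt (Sd A v) (h * g) = Van (Sd A v) * q →
    ∀ e : Fin N → ℚ, (∀ x ∈ A, ∀ y ∈ A, e x = e y) → eval e q = 0

lemma Null.mul {v : Fin N → Fin n} {A : Finset (Fin N)} {g : MvPolynomial (Fin N) ℚ} (hg : Null v A g)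
    (k : MvPolynomial (Fin N) ℚ) : Null v A (k * g) := by
  intro h q hq
  exact hg (h * k) q (by rw [mul_assoc, hq])

lemma Null.dvd {v : Fin N → Fin n} {A : Finset (Fin N)} {g g' : MvPolynomial (Fin N) ℚ} (hg : Null v A g)
    (h : g ∣ g') : Null v A g' := by
  obtain ⟨k, rfl⟩ := h
  rw [mul_comm]; exact hg.mul k

lemma psi_PP (A : Finset (Fin N)) (e : Fin N → ℚ) (he : ∀ x ∈ A, ∀ y ∈ A, e x = e y)
    (b : Fin N → Fin N → ℕ) (hb : ∀ x y, b x y ≠ 0 → x ∈ A ∧ y ∈ A) :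
    aeval (fun x : Fin N => (Polynomial.C (e x) + Polynomial.C (x.val : ℚ) * Polynomial.X : Polynomial ℚ)) (PP b)
    = Polynomial.C (eval (fun x : Fin N => (x.val : ℚ)) (PP b)) * Polynomial.X ^ dg b := by
  rw [aeval_PP, eval_PP, dg, map_prod, ← Finset.prod_pow_eq_pow_sum, ← Finset.prod_mul_distrib]
  refine Finset.prod_congr rfl fun x _ => ?_
  rw [map_prod, ← Finset.prod_pow_eq_pow_sum, ← Finset.prod_mul_distrib]
  refine Finset.prod_congr rfl fun y _ => ?_
  by_cases h : b x y = 0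
  · simp [h]
  · obtain ⟨h1, h2⟩ := hb x y h
    rw [he y h2 x h1, Polynomial.C_pow, ← mul_pow, Polynomial.C_sub]
    congr 1; ring

lemma deg_null (v : Fin N → Fin n) (A : Finset (Fin N)) (s' : Setoid (Fin N)) (hs : s' ≤ Sd A v)
    (b : Fin N → Fin N → ℕ) (hb : ∀ x y, b x y ≠ 0 → x ∈ A ∧ y ∈ A) (hinv : Inv s' (PP b))
    (hlt : dg (ve (Sd A v)) < dg (ve s') + dg b) : Null v A (PP b) := by
  intro h q hq e he
  obtain ⟨q', hq'⟩ := Alt_dvd s' h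
  have h1 := Alt_Alt hs hinv h
  rw [mul_comm (PP b) h, hq, hq'] at h1
  have hve : ∀ s'' : Setoid (Fin N), s'' ≤ Sd A v → ∀ x y, ve s'' x y ≠ 0 → x ∈ A ∧ y ∈ A := by
    intro s'' hs'' x y hxy
    by_cases hh : x < y ∧ s'' x y
    · rcases hs'' hh.2 with h | h
      · exact absurd h hh.1.ne
      · exact ⟨h.1, h.2.1⟩
    · exact absurd (if_neg hh) hxy
  set ψ := aeval (R := ℚ) (fun x : Fin N => (Polynomial.C (e x) + Polynomial.C (x.val : ℚ) * Polynomial.X : Polynomial ℚ))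
    with hψ
  have h2 : (Polynomial.X : Polynomial ℚ) ^ (dg (ve s') + dg b) ∣ ψ (Alt (Sd A v) (PP b * (Van s' * q'))) := by
    rw [Alt_apply, map_sum]
    refine Finset.dvd_sum fun σ hσ => ?_
    have hA := (W_Sd_symm hσ).1
    rw [map_mul, map_mul, map_mul, map_mul, map_mul, Van_eq, rename_PP, rename_PP, hψ, psi_PP A e he, psi_PP A e he,
      dg_perm, dg_perm]
    · rw [pow_add]
      refine Dvd.dvd.mul_left ?_ _
      rw [← mul_assoc, mul_comm (Polynomial.X ^ _)]
      refine Dvd.dvd.mul_right ?_ _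
      exact mul_dvd_mul (Dvd.dvd.mul_left dvd_rfl _) (Dvd.dvd.mul_left dvd_rfl _)
    · intro x y hxy
      have := hve s' hs _ _ hxy
      simpa [hA] using this
    · intro x y hxy
      have := hb _ _ hxy
      simpa [hA] using this
  rw [h1, map_mul, map_mul, Van_eq, hψ, psi_PP A e he _ (hve _ le_rfl), ← hψ] at h2
  have hc : eval (fun x : Fin N => (x.val : ℚ)) (PP (ve (Sd A v))) ≠ 0 := by
    apply eval_PP_ne_zero
    intro x y hxy
    have : x = y := Fin.ext (by exact_mod_cast hxy)
    subst this; simp [ve]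
  set c := eval (fun x : Fin N => (x.val : ℚ)) (PP (ve (Sd A v)))
  have h3 : (Polynomial.X : Polynomial ℚ) ^ (dg (ve (Sd A v)) + 1) ∣
      Polynomial.X ^ (dg (ve (Sd A v))) * (Polynomial.C ((W s').card * c) * ψ q) := by
    refine (pow_dvd_pow _ hlt).trans (h2.trans (dvd_of_eq ?_))
    simp only [map_natCast, Polynomial.C_mul]
    ring
  rw [pow_succ, mul_dvd_mul_iff_left (pow_ne_zero _ Polynomial.X_ne_zero), Polynomial.X_dvd_iff,
    Polynomial.coeff_C_mul, mul_eq_zero] at h3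
  rcases h3 with h3 | h3
  · exfalso
    rcases mul_eq_zero.1 h3 with h4 | h4
    · have := Finset.card_ne_zero_of_mem (one_mem_W s')
      exact this (by exact_mod_cast h4)
    · exact hc h4
  · rw [Polynomial.coeff_zero_eq_eval_zero] at h3
    rw [← h3]
    have : (Polynomial.aeval (0:ℚ)).comp ψ = aeval e := by
      apply MvPolynomial.algHom_ext
      intro x
      simp [hψ]
    have h5 := DFunLike.congr_fun this q
    simp only [AlgHom.comp_apply, Polynomial.aeval_def, Polynomial.eval₂_eq_eval_map] at h5
    simpa [aeval_eq_eval] using h5.symm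

lemma trans_null (v : Fin N → Fin n) (A B : Finset (Fin N)) (hB : B ⊆ A) (g k : MvPolynomial (Fin N) ℚ)
    (hg : Inv (Sd B v) g) (c : ℚ) (hc : c ≠ 0) (hk : Alt (Sd B v) k = C c * Van (Sd B v))
    (hN : Null v A (g * k)) : Null v A g := by
  intro h q hq e he
  have hs : Sd B v ≤ Sd A v := Sd_le hB (fun _ _ _ _ h => h)
  obtain ⟨q', hq'⟩ := Alt_dvd (Sd B v) h
  have hinv : Inv (Sd B v) q' := by
    intro σ hσ
    have h1 := anti_Alt (Sd B v) h σ hσ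
    rw [hq', map_mul, Van_anti _ σ hσ, mul_assoc] at h1
    have h2 : sg σ ≠ 0 := by
      intro h0; have := sg_sq σ; rw [h0] at this; simp at this
    exact mul_left_cancel₀ (Van_ne_zero _) (mul_left_cancel₀ h2 h1)
  refine hN (C c⁻¹ * q') q ?_ e he
  have h1 := Alt_Alt hs hg h
  have h2 := Alt_Alt hs (hg.mul hinv) k
  have h3 : g * Alt (Sd B v) h = C c⁻¹ * (g * q' * Alt (Sd B v) k) := by
    rw [hk, hq']
    have : C (σ := Fin N) c⁻¹ * C c = 1 := by rw [← C_mul, inv_mul_cancel₀ hc, C_1]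
    linear_combination (- g * Van (Sd B v) * q') * this
  have hC : ∀ d : ℚ, ∀ f : MvPolynomial (Fin N) ℚ, Alt (Sd A v) (C d * f) = C d * Alt (Sd A v) f := by
    intro d f
    rw [← smul_eq_C_mul, map_smul, smul_eq_C_mul]
  rw [h3, hC, h2, mul_comm g h, hq] at h1
  apply mul_left_cancel₀ (card_W_ne_zero (Sd B v))
  rw [← h1, mul_assoc (C c⁻¹), hC]
  rw [show q' * (g * k) = g * q' * k by ring]
  ring

/-- numerator -/
noncomputable def ne (a : Fin n → Fin n → ℕ) (v : Fin N → Fin n) (p : Fin N → ℕ) (A : Finset (Fin N)) :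
    Fin N → Fin N → ℕ :=
  fun x y => if x ∈ A ∧ y ∈ A ∧ p x < p y then a (v x) (v y) else 0

noncomputable def Num (a : Fin n → Fin n → ℕ) (v : Fin N → Fin n) (p : Fin N → ℕ) (A : Finset (Fin N)) :
    MvPolynomial (Fin N) ℚ := PP (ne a v p A)

lemma rename_Num (a : Fin n → Fin n → ℕ) (v : Fin N → Fin n) (p : Fin N → ℕ) (A : Finset (Fin N))
    {w : Perm (Fin N)} (hw : w ∈ W (Sd A v)) :
    rename w (Num a v p A) = Num a v (fun x => p (w.symm x)) A := by
  obtain ⟨h1, h2, -⟩ := W_Sd_symm hw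
  rw [Num, rename_PP, Num]
  congr 1; funext x y
  simp only [ne, h1, h2]

lemma Num_inv (a : Fin n → Fin n → ℕ) (v : Fin N → Fin n) (p : Fin N → ℕ) (A : Finset (Fin N)) :
    Inv (Sd A (fun x => (v x, p x))) (Num a v p A) := by
  intro w hw
  obtain ⟨h1, h2, -⟩ := W_Sd_symm hw
  rw [rename_Num]
  · congr 1; funext x
    exact congrArg Prod.snd (h2 x)
  · exact W_mono (Sd_le subset_rfl (fun x _ y _ h => congrArg Prod.fst h)) hw

lemma Num_mono_dvd (a : Fin n → Fin n → ℕ) (v : Fin N → Fin n) (p : Fin N → ℕ) {A B : Finset (Fin N)}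
    (h : B ⊆ A) : Num a v p B ∣ Num a v p A := by
  apply PP_dvd
  intro x y
  unfold ne
  by_cases h1 : x ∈ B ∧ y ∈ B ∧ p x < p y
  · rw [if_pos h1, if_pos ⟨h h1.1, h h1.2.1, h1.2.2⟩]
  · rw [if_neg h1]; exact Nat.zero_le _

lemma Alt_anti_mul {s : Setoid (Fin N)} {g : MvPolynomial (Fin N) ℚ} (hg : Anti s g)
    (h : MvPolynomial (Fin N) ℚ) : Alt s (g * h) = g * ∑ σ ∈ W s, rename σ h := by
  rw [Alt_apply, Finset.mul_sum]
  refine Finset.sum_congr rfl fun σ hσ => ?_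
  rw [map_mul, hg σ hσ]
  linear_combination (g * rename σ h) * sg_sq σ

lemma T1 {Cl : Type*} [DecidableEq Cl] (a : Fin n → Fin n → ℕ) (v : Fin N → Fin n) (A : Finset (Fin N)) (cl : Fin N → Cl) (c : Cl)
    (p : Fin N → ℕ) (hN : Null v (A.filter (fun x => cl x = c)) (Num a v p (A.filter (fun x => cl x = c))))
    (z : Fin N → ℚ) (hz : ∀ x ∈ A, ∀ y ∈ A, cl x = cl y → z x = z y) (h : MvPolynomial (Fin N) ℚ) :
    ∃ q, Alt (Sd A (fun x => (v x, cl x))) (h * Num a v p (A.filter (fun x => cl x = c))) =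
      Van (Sd A (fun x => (v x, cl x))) * q ∧ eval z q = 0 := by
  set Ac := A.filter (fun x => cl x = c) with hAc
  set Ao := A.filter (fun x => cl x ≠ c) with hAo
  set so := Sd Ao (fun x => (v x, cl x)) with hso
  set sc := Sd Ac v with hsc
  set s := Sd A (fun x => (v x, cl x)) with hs
  have hle1 : so ≤ s := Sd_le (Finset.filter_subset _ _) (fun _ _ _ _ h => h)
  have hle2 : sc ≤ s := Sd_le (Finset.filter_subset _ _) (fun x hx y hy h => by
    rw [(Finset.mem_filter.1 hx).2, (Finset.mem_filter.1 hy).2, h])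
  have hg : Inv so (Num a v p Ac) := by
    intro w hw
    obtain ⟨h1, h2, h3⟩ := W_Sd_symm hw
    have h4 : ∀ x, x ∈ Ac → w.symm x = x := fun x hx => h3 x (by
      simp only [hAo, hAc, Finset.mem_filter] at hx ⊢; tauto)
    have h5 : ∀ x, w.symm x ∈ Ac → w.symm x = x := fun x hx =>
      w.symm.injective (h4 _ hx)
    rw [Num, rename_PP]
    congr 1; funext x y
    unfold ne
    by_cases hx : w.symm x = x
    · by_cases hy : w.symm y = y
      · rw [hx, hy]
      · rw [if_neg (fun h => hy (h5 _ h.2.1)), if_neg (fun h => hy (h4 _ h.2.1))]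
    · rw [if_neg (fun h => hx (h5 _ h.1)), if_neg (fun h => hx (h4 _ h.1))]
  obtain ⟨q1, hq1⟩ := Alt_dvd so h
  have e1 := Alt_Alt hle1 hg h
  have e2 := Alt_Alt hle2 (g := 1) (fun σ _ => by simp) (Num a v p Ac * (Van so * q1))
  have hVo : Inv sc (Van so) := by
    intro w hw
    obtain ⟨h1, h2, h3⟩ := W_Sd_symm hw
    have h4 : ∀ x, x ∈ Ao → w.symm x = x := fun x hx => h3 x (by
      simp only [hAo, hAc, Finset.mem_filter] at hx ⊢; tauto)
    have h5 : ∀ x, w.symm x ∈ Ao → w.symm x = x := fun x hx =>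
      w.symm.injective (h4 _ hx)
    have h6 : ∀ x y, x < y ∧ so x y ↔ x < y ∧ x ∈ Ao ∧ y ∈ Ao ∧ v x = v y ∧ cl x = cl y := by
      intro x y
      rw [hso, Sd_iff]
      constructor
      · rintro ⟨h, h' | h'⟩
        · exact absurd h' h.ne
        · simpa [h] using h'
      · rintro ⟨h, h'⟩
        exact ⟨h, Or.inr (by simpa using h')⟩
    rw [Van, rename_PP]
    congr 1; funext x y
    simp only [h6]
    by_cases hx : w.symm x = x
    · by_cases hy : w.symm y = y
      · rw [hx, hy]
      · rw [if_neg (fun h => hy (h5 _ h.2.2.1)), if_neg (fun h => hy (h4 _ h.2.2.1))]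
    · rw [if_neg (fun h => hx (h5 _ h.2.1)), if_neg (fun h => hx (h4 _ h.2.1))]
  obtain ⟨q2, hq2⟩ := Alt_dvd sc (q1 * Num a v p Ac)
  have hq2z : ∀ z : Fin N → ℚ, (∀ x ∈ A, ∀ y ∈ A, cl x = cl y → z x = z y) → eval z q2 = 0 := by
    intro z hz
    refine hN _ _ hq2 z (fun x hx y hy => ?_)
    rw [Finset.mem_filter] at hx hy
    exact hz x hx.1 y hy.1 (hx.2.trans hy.2.symm)
  have hV : Van s = Van so * Van sc := by
    rw [Van, Van, Van, ← PP_add]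
    congr 1; funext x y
    by_cases hxy : x < y
    · simp only [hs, hso, hsc, Sd_iff, hxy, hxy.ne, false_or, true_and, hAo, hAc, Finset.mem_filter,
        Prod.mk.injEq]
      by_cases hx : cl x = c <;> by_cases hy : cl y = c <;> simp [hx, hy]
      intro _ _ _ h; exact absurd h.symm hy
    · simp [hxy]
  rw [one_mul, one_mul, show Num a v p Ac * (Van so * q1) = Van so * (q1 * Num a v p Ac) by ring,
    Alt_inv_mul hVo, hq2, ← mul_assoc, ← hV, Alt_anti_mul (Van_anti s)] at e2
  rw [hq1, show Num a v p Ac * (Van so * q1) = Van so * (q1 * Num a v p Ac) by ring] at e1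
  refine ⟨C ((W so).card * (W sc).card : ℚ)⁻¹ * ∑ σ ∈ W s, rename σ q2, ?_, ?_⟩
  · have h1 : ((W so).card * (W sc).card : ℚ) ≠ 0 := by
      have h1 := Finset.card_ne_zero_of_mem (one_mem_W so)
      have h2 := Finset.card_ne_zero_of_mem (one_mem_W sc)
      exact_mod_cast mul_ne_zero h1 h2
    have h2 : C ((W so).card * (W sc).card : ℚ)⁻¹ * ((W so).card * (W sc).card : MvPolynomial (Fin N) ℚ) = 1 := by
      have : ((W so).card * (W sc).card : MvPolynomial (Fin N) ℚ) = C ((W so).card * (W sc).card : ℚ) := by simp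
      rw [this, ← C_mul, inv_mul_cancel₀ h1, C_1]
    rw [mul_left_comm, e2, e1]
    rw [mul_comm h]
    linear_combination (-Alt s (Num a v p Ac * h)) * h2
  · rw [map_mul, map_sum, Finset.sum_eq_zero, mul_zero]
    intro σ hσ
    rw [eval_rename]
    apply hq2z
    intro x hx y hy hxy
    obtain ⟨h1, h2, h3⟩ := W_Sd hσ
    exact hz _ ((h1 x).2 hx) _ ((h1 y).2 hy) (by
      have := congrArg Prod.snd (h2 x); have h4 := congrArg Prod.snd (h2 y); simp only at this h4
      rw [this, h4, hxy])

theorem thmT {Cl : Type*} [DecidableEq Cl] (a : Fin n → Fin n → ℕ) (v : Fin N → Fin n) (A : Finset (Fin N)) (cl : Fin N → Cl)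
    (p : Fin N → ℕ) (hp : ∀ x ∈ A, ∀ y ∈ A, cl x = cl y → p x = p y)
    (H : ∀ w ∈ W (Sd A v), (¬ ∀ x ∈ A, p (w.symm x) = p x) →
      ∃ c, Null v (A.filter (fun x => cl x = c)) (Num a v (fun x => p (w.symm x)) (A.filter (fun x => cl x = c))))
    (z : Fin N → ℚ) (hz : ∀ x ∈ A, ∀ y ∈ A, cl x = cl y ↔ z x = z y) :
    ∃ κ : ℚ, κ ≠ 0 ∧ ∀ Φ, Inv (Sd A (fun x => (v x, p x))) Φ → ∀ P,
      Alt (Sd A v) (Φ * Van (Sd A (fun x => (v x, p x))) * Num a v p A) = Van (Sd A v) * P →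
      eval z P = κ * eval z Φ := by
  set s := Sd A v with hs
  set sp := Sd A (fun x => (v x, p x)) with hsp
  set sc := Sd A (fun x => (v x, cl x)) with hsc
  have hcs : sc ≤ s := Sd_le subset_rfl (fun x _ y _ h => congrArg Prod.fst h)
  have hps : sp ≤ s := Sd_le subset_rfl (fun x _ y _ h => congrArg Prod.fst h)
  have hcp : sc ≤ sp := Sd_le subset_rfl (fun x hx y hy h => by
    have h1 := congrArg Prod.fst h
    have h2 := congrArg Prod.snd h
    simp only at h1 h2
    rw [h1, hp x hx y hy h2])
  set D := PP (fun x y => if x < y ∧ s x y ∧ ¬ sc x y then 1 else 0) with hD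
  set D' := PP (fun x y => if x < y ∧ sp x y ∧ ¬ sc x y then 1 else 0) with hD'
  have hzs : ∀ x y, z x = z y → s x y → sc x y := by
    rintro x y hxy (h | ⟨h1, h2, h3⟩)
    · exact Or.inl h
    · exact Or.inr ⟨h1, h2, Prod.ext h3 ((hz x h1 y h2).2 hxy)⟩
  have hDz : eval z D ≠ 0 := eval_PP_ne_zero _ _ (fun x y hxy => if_neg (fun h => h.2.2 (hzs x y hxy h.2.1)))
  have hD'z : eval z D' ≠ 0 :=
    eval_PP_ne_zero _ _ (fun x y hxy => if_neg (fun h => h.2.2 (hzs x y hxy (hps h.2.1))))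
  have hNz : eval z (Num a v p A) ≠ 0 :=
    eval_PP_ne_zero _ _ (fun x y hxy => if_neg (fun h => h.2.2.ne
      (hp x h.1 y h.2.1 ((hz x h.1 y h.2.1).2 hxy))))
  have hcard : ∀ t : Setoid (Fin N), ((W t).card : ℚ) ≠ 0 := by
    intro t
    have h1 := Finset.card_ne_zero_of_mem (one_mem_W t)
    exact_mod_cast h1
  refine ⟨(W sp).card * eval z D' * eval z (Num a v p A) / eval z D,
    div_ne_zero (mul_ne_zero (mul_ne_zero (hcard _) hD'z) hNz) hDz, ?_⟩
  intro Φ hΦ P hP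
  set G := Φ * Van sp * Num a v p A with hG
  have hGanti : Anti sp G := by
    rw [hG, mul_comm]
    exact (Num_inv a v p A).anti (hΦ.anti (Van_anti sp))
  have e1 : Alt sc (Alt s G) = (W sc).card * (Van s * P) := by
    rw [Alt_of_anti ((anti_Alt s G).mono hcs), hP]
  have e2 : ∀ w ∈ W s, ∃ q, Alt sc (sg w * rename w G) = Van sc * q ∧
      eval z q = if w ∈ W sp then (W sc).card * eval z (D' * Num a v p A * Φ) else 0 := by
    intro w hw
    by_cases hwp : w ∈ W sp
    · refine ⟨(W sc).card * (D' * Num a v p A * Φ), ?_, by simp [hwp]⟩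
      have : sg w * rename w G = G := by
        rw [hGanti w hwp]
        linear_combination G * sg_sq w
      rw [this, Alt_of_anti (hGanti.mono hcp), hG, Van_le hcp]
      ring
    · rw [if_neg hwp]
      obtain ⟨h1, h2, h3⟩ := W_Sd_symm hw
      obtain ⟨c, hc⟩ := H w hw (fun h => hwp (by
        rw [← inv_inv w]
        apply inv_mem_W
        rw [mem_W]
        intro x
        by_cases hx : x ∈ A
        · refine Or.inr ⟨hx, (h1 x).2 hx, ?_⟩
          have h4 := h x hx
          have h5 := h2 x
          change (v x, p x) = (v (w.symm x), p (w.symm x))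
          rw [h4, h5]
        · exact Or.inl (h3 x hx).symm))
      obtain ⟨k, hk⟩ := Num_mono_dvd a v (fun x => p (w.symm x)) (Finset.filter_subset (fun x => cl x = c) A)
      obtain ⟨q, hq1, hq2⟩ := T1 a v A cl c (fun x => p (w.symm x)) hc z (fun x hx y hy h => (hz x hx y hy).1 h)
        (sg w * rename w (Φ * Van sp) * k)
      refine ⟨q, ?_, hq2⟩
      have h8 : rename w G = rename w (Φ * Van sp) * rename w (Num a v p A) := map_mul _ _ _
      rw [← hq1, h8, rename_Num a v p A hw, hk]
      congr 1; ring
  choose! q hq1 hq2 using e2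
  have e3 : Alt sc (Alt s G) = Van sc * ∑ w ∈ W s, q w := by
    rw [Alt_apply s, map_sum, Finset.mul_sum]
    exact Finset.sum_congr rfl hq1
  rw [e1, Van_le hcs, ← hD] at e3
  have e4 : ((W sc).card : MvPolynomial (Fin N) ℚ) * (D * P) = ∑ w ∈ W s, q w := by
    apply mul_left_cancel₀ (Van_ne_zero sc)
    rw [← e3]; ring
  have e5 := congrArg (eval z) e4
  rw [map_sum, Finset.sum_congr rfl hq2, ← Finset.sum_filter, Finset.sum_const, nsmul_eq_mul] at e5
  have e6 : (W s).filter (fun w => w ∈ W sp) = W sp := by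
    ext w
    rw [Finset.mem_filter]
    exact ⟨fun h => h.2, fun h => ⟨W_mono hps h, h⟩⟩
  rw [e6] at e5
  simp only [map_mul, map_natCast] at e5
  have h7 := hcard sc
  have e7 : eval z D * eval z P = (W sp).card * (eval z D' * eval z (Num a v p A) * eval z Φ) := by
    apply mul_left_cancel₀ h7
    rw [e5]; ring
  field_simp
  linear_combination e7

end PartB
end MuInj

open MvPolynomial
open scoped Classical TensorProduct

namespace MuInj
open Equiv (Perm)
section PartD
variable {N n : ℕ}

/-- Euler form attached to a matrix of arrow multiplicities -/
noncomputable def chi (a : Fin n → Fin n → ℕ) : LinearMap.BilinForm ℤ (Fin n → ℤ) :=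
  Matrix.toBilin' (Matrix.of fun i j => (if i = j then 1 else 0) - (a i j : ℤ))

/-- dimension vector of a set of variables -/
noncomputable def dm (v : Fin N → Fin n) (A : Finset (Fin N)) : Fin n → ℤ := ∑ x ∈ A, Pi.single (v x) 1

lemma dm_apply (v : Fin N → Fin n) (A : Finset (Fin N)) (i : Fin n) :
    dm v A i = (A.filter (fun x => v x = i)).card := by
  simp only [dm, Finset.sum_apply, Pi.single_apply]
  rw [Finset.card_filter]
  push_cast
  exact Finset.sum_congr rfl fun x _ => by simp [eq_comm]

lemma dm_nonneg (v : Fin N → Fin n) (A : Finset (Fin N)) : 0 ≤ dm v A := by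
  intro i; rw [dm_apply]; simp

lemma dm_mono (v : Fin N → Fin n) {A B : Finset (Fin N)} (h : A ⊆ B) : dm v A ≤ dm v B := by
  intro i; rw [dm_apply, dm_apply]
  exact Int.ofNat_le.2 (Finset.card_le_card (Finset.filter_subset_filter _ h))

lemma dm_sum (v : Fin N → Fin n) (A : Finset (Fin N)) : ∑ i, dm v A i = A.card := by
  simp only [dm, Finset.sum_apply]
  rw [Finset.sum_comm]
  simp

lemma dm_eq_of_subset (v : Fin N → Fin n) {A B : Finset (Fin N)} (h : A ⊆ B) (h' : dm v A = dm v B) : A = B := by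
  apply Finset.eq_of_subset_of_card_le h
  have h1 := dm_sum v A
  rw [h', dm_sum] at h1
  have : B.card = A.card := by exact_mod_cast h1
  omega

lemma dm_sdiff (v : Fin N → Fin n) {A B : Finset (Fin N)} (h : A ⊆ B) : dm v (B \ A) = dm v B - dm v A := by
  rw [eq_sub_iff_add_eq]
  exact Finset.sum_sdiff h

lemma dm_fiber {Cl : Type*} [DecidableEq Cl] (v : Fin N → Fin n) (A : Finset (Fin N)) (cl : Fin N → Cl) (C : Finset Cl)
    (h : ∀ x ∈ A, cl x ∈ C) : ∑ c ∈ C, dm v (A.filter (fun x => cl x = c)) = dm v A :=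
  Finset.sum_fiberwise_of_maps_to h _

lemma chi_dm (a : Fin n → Fin n → ℕ) (v : Fin N → Fin n) (A B : Finset (Fin N)) :
    chi a (dm v A) (dm v B) = ∑ x ∈ A, ∑ y ∈ B, ((if v x = v y then 1 else 0) - (a (v x) (v y) : ℤ)) := by
  simp only [dm, map_sum, LinearMap.sum_apply]
  rw [Finset.sum_comm]
  refine Finset.sum_congr rfl fun x _ => Finset.sum_congr rfl fun y _ => ?_
  simp [chi, Matrix.toBilin'_single]

lemma exists_sub_dm (v : Fin N → Fin n) (A : Finset (Fin N)) (k : Fin n → ℤ) (h0 : 0 ≤ k) (h1 : k ≤ dm v A) :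
    ∃ B ⊆ A, dm v B = k := by
  have : ∀ i, ∃ B ⊆ A.filter (fun x => v x = i), (B.card : ℤ) = k i := by
    intro i
    have h2 := h1 i
    have h3 := h0 i
    simp only [Pi.zero_apply] at h3
    rw [dm_apply] at h2
    obtain ⟨B, hB, hB'⟩ := Finset.exists_subset_card_eq (s := A.filter (fun x => v x = i)) (n := (k i).toNat) (Int.toNat_le.2 h2)
    exact ⟨B, hB, by omega⟩
  choose B hB hB' using this
  refine ⟨Finset.univ.biUnion B, ?_, ?_⟩
  · intro x hx
    simp only [Finset.mem_biUnion, Finset.mem_univ, true_and] at hx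
    obtain ⟨i, hi⟩ := hx
    exact (Finset.mem_filter.1 (hB i hi)).1
  · funext i
    rw [dm_apply, ← hB' i]
    congr 2
    ext x
    simp only [Finset.mem_filter, Finset.mem_biUnion, Finset.mem_univ, true_and]
    constructor
    · rintro ⟨⟨j, hj⟩, h⟩
      have := (Finset.mem_filter.1 (hB j hj)).2
      rw [← h, this]; exact hj
    · intro h
      exact ⟨⟨i, h⟩, (Finset.mem_filter.1 (hB i h)).2⟩

lemma exists_clusters {Cl : Type*} [DecidableEq Cl] [Nonempty Cl] (v : Fin N → Fin n) (C : Finset Cl) (k : Cl → Fin n → ℤ)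
    (h0 : ∀ c, 0 ≤ k c) : ∀ (A : Finset (Fin N)), ∑ c ∈ C, k c = dm v A →
    ∃ cl : Fin N → Cl, (∀ x ∈ A, cl x ∈ C) ∧ ∀ c ∈ C, dm v (A.filter (fun x => cl x = c)) = k c := by
  induction C using Finset.induction_on with
  | empty =>
    intro A hA
    refine ⟨fun _ => Classical.arbitrary _, ?_, by simp⟩
    intro x hx
    exfalso
    have h1 := dm_sum v A
    rw [← hA] at h1
    simp at h1
    rw [eq_comm, Int.natCast_eq_zero, Finset.card_eq_zero] at h1
    simp [h1] at hx
  | insert c C hc ih =>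
    intro A hA
    rw [Finset.sum_insert hc] at hA
    obtain ⟨B, hB, hBk⟩ := exists_sub_dm v A (k c) (h0 c) (by
      rw [← hA]
      exact le_add_of_nonneg_right (Finset.sum_nonneg fun c _ => h0 c))
    obtain ⟨cl, h1, h2⟩ := ih (A \ B) (by rw [dm_sdiff v hB, hBk, ← hA]; abel)
    refine ⟨fun x => if x ∈ B then c else cl x, ?_, ?_⟩
    · intro x hx
      by_cases hxB : x ∈ B
      · simp [hxB]
      · simp [hxB, h1 x (Finset.mem_sdiff.2 ⟨hx, hxB⟩)]
    · intro d hd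
      rcases Finset.mem_insert.1 hd with rfl | hd'
      · rw [← hBk]
        congr 1
        ext x
        simp only [Finset.mem_filter]
        constructor
        · rintro ⟨h, h'⟩
          by_contra hxB
          rw [if_neg hxB] at h'
          exact hc (h' ▸ h1 x (Finset.mem_sdiff.2 ⟨h, hxB⟩))
        · intro h
          exact ⟨hB h, if_pos h⟩
      · rw [← h2 d hd']
        congr 1
        ext x
        have hdc : c ≠ d := fun h => hc (h ▸ hd')
        simp only [Finset.mem_filter, Finset.mem_sdiff]
        by_cases hxB : x ∈ B <;> simp [hxB, hdc]

lemma dg_identity (a : Fin n → Fin n → ℕ) (v : Fin N → Fin n) (p : Fin N → ℕ) (A : Finset (Fin N)) :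
    (dg (ve (Sd A v)) : ℤ) - dg (ve (Sd A (fun x => (v x, p x)))) - dg (ne a v p A) =
    ∑ x ∈ A, ∑ y ∈ A, if p x < p y then ((if v x = v y then 1 else 0) - (a (v x) (v y) : ℤ)) else 0 := by
  have e1 : (dg (ve (Sd A v)) : ℤ) = dg (ve (Sd A (fun x => (v x, p x)))) +
      ∑ x, ∑ y, (if x < y ∧ x ∈ A ∧ y ∈ A ∧ v x = v y ∧ p x < p y then 1 else 0) +
      ∑ x, ∑ y, (if y < x ∧ x ∈ A ∧ y ∈ A ∧ v x = v y ∧ p x < p y then 1 else 0) := by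
    rw [Finset.sum_comm (f := fun x y => (if y < x ∧ x ∈ A ∧ y ∈ A ∧ v x = v y ∧ p x < p y then (1:ℤ) else 0))]
    simp only [dg]
    push_cast
    rw [← Finset.sum_add_distrib, ← Finset.sum_add_distrib]
    refine Finset.sum_congr rfl fun x _ => ?_
    rw [← Finset.sum_add_distrib, ← Finset.sum_add_distrib]
    refine Finset.sum_congr rfl fun y _ => ?_
    simp only [ve, Sd_iff]
    by_cases h1 : x < y
    · by_cases h2 : x ∈ A
      · by_cases h3 : y ∈ A
        · by_cases h4 : v x = v y
          · rcases lt_trichotomy (p x) (p y) with h5 | h5 | h5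
            · simp [h1, h1.ne, h2, h3, h4, h5, h5.ne, h5.not_gt]
            · simp [h1, h1.ne, h2, h3, h4, h5]
            · simp [h1, h1.ne, h2, h3, h4, h5, h5.ne', h5.not_gt]
          · have h4' : ¬ v y = v x := fun h => h4 h.symm
            simp [h1.ne, h4, h4']
        · simp [h1.ne, h3]
      · simp [h1.ne, h2]
    · simp [h1]
  have e2 : (dg (ne a v p A) : ℤ) = ∑ x ∈ A, ∑ y ∈ A, if p x < p y then (a (v x) (v y) : ℤ) else 0 := by
    simp only [dg, ne]
    push_cast
    rw [← Finset.sum_subset (Finset.subset_univ A)]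
    · refine Finset.sum_congr rfl fun x hx => ?_
      rw [← Finset.sum_subset (Finset.subset_univ A)]
      · refine Finset.sum_congr rfl fun y hy => ?_
        simp [hx, hy]
      · intro y _ hy; simp [hy]
    · intro x _ hx; simp [hx]
  have e3 : ∑ x, ∑ y, (if x < y ∧ x ∈ A ∧ y ∈ A ∧ v x = v y ∧ p x < p y then (1:ℤ) else 0) +
      ∑ x, ∑ y, (if y < x ∧ x ∈ A ∧ y ∈ A ∧ v x = v y ∧ p x < p y then 1 else 0) =
      ∑ x ∈ A, ∑ y ∈ A, if p x < p y then (if v x = v y then (1:ℤ) else 0) else 0 := by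
    rw [← Finset.sum_add_distrib, ← Finset.sum_subset (Finset.subset_univ A)]
    · refine Finset.sum_congr rfl fun x hx => ?_
      rw [← Finset.sum_add_distrib, ← Finset.sum_subset (Finset.subset_univ A)]
      · refine Finset.sum_congr rfl fun y hy => ?_
        by_cases h4 : v x = v y
        · by_cases h5 : p x < p y
          · rcases lt_trichotomy x y with h | h | h
            · simp [h, h.not_gt, hx, hy, h4, h5]
            · subst h; simp at h5
            · simp [h, h.not_gt, hx, hy, h4, h5]
          · simp [h5]
        · simp [h4]
      · intro y _ hy; simp [hy]
    · intro x _ hx; simp [hx]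
  rw [e1, e2, add_assoc, e3, add_sub_cancel_left, ← Finset.sum_sub_distrib]
  refine Finset.sum_congr rfl fun x _ => ?_
  rw [← Finset.sum_sub_distrib]
  refine Finset.sum_congr rfl fun y _ => ?_
  split_ifs <;> simp

lemma dg_chi (a : Fin n → Fin n → ℕ) (v : Fin N → Fin n) (p : Fin N → ℕ) (A : Finset (Fin N)) (K : ℕ)
    (hK : ∀ x ∈ A, p x < K) :
    (dg (ve (Sd A v)) : ℤ) - dg (ve (Sd A (fun x => (v x, p x)))) - dg (ne a v p A) =
    ∑ u ∈ Finset.range K, ∑ w ∈ Finset.range K, if u < w then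
      chi a (dm v (A.filter (fun x => p x = u))) (dm v (A.filter (fun x => p x = w))) else 0 := by
  rw [dg_identity, ← Finset.sum_fiberwise_of_maps_to (fun x hx => Finset.mem_range.2 (hK x hx))]
  refine Finset.sum_congr rfl fun u _ => ?_
  have : ∀ x ∈ A.filter (fun x => p x = u), (∑ y ∈ A, if p x < p y then
      ((if v x = v y then 1 else 0) - (a (v x) (v y) : ℤ)) else 0) =
      ∑ w ∈ Finset.range K, ∑ y ∈ A.filter (fun y => p y = w), if p x < p y then
      ((if v x = v y then 1 else 0) - (a (v x) (v y) : ℤ)) else 0 := by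
    intro x hx
    rw [Finset.sum_fiberwise_of_maps_to (fun x hx => Finset.mem_range.2 (hK x hx))]
  rw [Finset.sum_congr rfl this, Finset.sum_comm]
  refine Finset.sum_congr rfl fun w _ => ?_
  rw [chi_dm]
  by_cases huw : u < w
  · rw [if_pos huw]
    refine Finset.sum_congr rfl fun x hx => Finset.sum_congr rfl fun y hy => ?_
    rw [(Finset.mem_filter.1 hx).2, (Finset.mem_filter.1 hy).2, if_pos huw]
  · rw [if_neg huw]
    refine Finset.sum_eq_zero fun x hx => Finset.sum_eq_zero fun y hy => ?_
    rw [(Finset.mem_filter.1 hx).2, (Finset.mem_filter.1 hy).2, if_neg huw]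

/-- indicator labelling -/
noncomputable def ind (Y : Finset (Fin N)) : Fin N → ℕ := fun x => if x ∈ Y then 1 else 0

lemma null_of_chi_neg (a : Fin n → Fin n → ℕ) (v : Fin N → Fin n) (A Y : Finset (Fin N)) (hY : Y ⊆ A)
    (h : chi a (dm v A - dm v Y) (dm v Y) < 0) : Null v A (Num a v (ind Y) A) := by
  apply deg_null v A (Sd A (fun x => (v x, ind Y x)))
  · exact Sd_le subset_rfl (fun x _ y _ h => congrArg Prod.fst h)
  · intro x y hxy
    by_cases hh : x ∈ A ∧ y ∈ A ∧ ind Y x < ind Y y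
    · exact ⟨hh.1, hh.2.1⟩
    · exact absurd (if_neg hh) hxy
  · exact Num_inv a v (ind Y) A
  · have h1 := dg_chi a v (ind Y) A 2 (fun x _ => by unfold ind; split_ifs <;> simp)
    have h2 : A.filter (fun x => ind Y x = 0) = A \ Y := by
      ext x; simp [ind, Finset.mem_sdiff]
    have h3 : A.filter (fun x => ind Y x = 1) = Y := by
      ext x; simp only [ind, Finset.mem_filter]
      by_cases hx : x ∈ Y
      · simp [hx, hY hx]
      · simp [hx]
    simp only [Finset.sum_range_succ, Finset.sum_range_zero, h2, h3] at h1
    simp only [lt_self_iff_false, if_false, zero_lt_one, if_true, Nat.not_lt_zero, zero_add, add_zero] at h1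
    rw [dm_sdiff v hY] at h1
    omega

/-- combinatorial hypotheses -/
structure Dat (a : Fin n → Fin n → ℕ) (β : ℕ → Fin n → ℤ) (r : ℕ) : Prop where
  nonneg : ∀ u, 0 ≤ β u
  neg : ∀ u w, u < w → chi a (β u) (β w) ≤ 0
  one : ∀ u, u < r → chi a (β u) (β u) = 1
  gen : ∀ u, u < r → ∀ δ : Fin n → ℤ, 0 ≤ δ → δ ≤ β u → ∃ m : ℕ → ℕ,
    ∑ w ∈ Finset.range r, (m w : ℤ) • β w = δ ∧
    (∀ u' w', u' < w' → m u' ≠ 0 → m w' ≠ 0 → chi a (β u') (β w') = 0) ∧ (∀ w, r ≤ w → m w = 0)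

/-- generic decompositions give a nonzero constant -/
def Eff (a : Fin n → Fin n → ℕ) (β : ℕ → Fin n → ℤ) (r : ℕ) (v : Fin N → Fin n) (B : Finset (Fin N)) : Prop :=
  ∀ (m : ℕ → ℕ) (p : Fin N → ℕ),
    (∀ u' w', u' < w' → m u' ≠ 0 → m w' ≠ 0 → chi a (β u') (β w') = 0) →
    (∀ x ∈ B, p x < r) →
    (∀ k, k < r → dm v (B.filter (fun x => p x = k)) = (m k : ℤ) • β k) →
    ∃ c : ℚ, c ≠ 0 ∧ Alt (Sd B v) (Van (Sd B (fun x => (v x, p x))) * Num a v p B) = C c * Van (Sd B v)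

lemma lemD_step {a : Fin n → Fin n → ℕ} {β : ℕ → Fin n → ℤ} {r : ℕ} (hD : Dat a β r) (v : Fin N → Fin n)
    (B : Finset (Fin N)) (u k : ℕ) (hu : u < r) (huk : u ≤ k) (hB : dm v B = β u)
    (p : Fin N → ℕ) (hpk : ∀ x ∈ B, p x ≤ k) (hN : ¬ Null v B (Num a v p B))
    (hE : ∀ S : Finset (Fin N), S.card < B.card → Eff a β r v S) :
    chi a (dm v (B.filter (fun x => p x = k))) (β k) ≤ (if u = k then 1 else 0) ∧
    (u = k → chi a (dm v (B.filter (fun x => p x = k))) (β k) = 1 → B.filter (fun x => p x = k) = B) := by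
  set S := B.filter (fun x => p x = k) with hS
  have hSB : S ⊆ B := Finset.filter_subset _ _
  by_cases hSe : S = B
  · rw [hSe, hB]
    refine ⟨?_, fun _ _ => rfl⟩
    by_cases h : u = k
    · subst h; simp [hD.one u hu]
    · rw [if_neg h]; exact hD.neg u k (lt_of_le_of_ne huk h)
  have hcard : S.card < B.card := Finset.card_lt_card (hSB.ssubset_of_ne hSe)
  obtain ⟨m, hm1, hm2, hm3⟩ := hD.gen u hu (dm v S) (dm_nonneg v S) (hB ▸ dm_mono v hSB)
  obtain ⟨pb, hpb1, hpb2⟩ := exists_clusters v (Finset.range r) (fun w => (m w : ℤ) • β w)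
    (fun w => smul_nonneg (by simp) (hD.nonneg w)) S hm1
  obtain ⟨c, hc, hcA⟩ := hE S hcard m pb hm2 (fun x hx => Finset.mem_range.1 (hpb1 x hx))
    (fun k hk => hpb2 k (Finset.mem_range.2 hk))
  have hall : ∀ w, m w ≠ 0 → w < k := by
    by_contra hcon
    push Not at hcon
    obtain ⟨w0, hw0, hkw0⟩ := hcon
    have hne : ((Finset.range r).filter (fun w => m w ≠ 0)).Nonempty := by
      refine ⟨w0, Finset.mem_filter.2 ⟨Finset.mem_range.2 ?_, hw0⟩⟩
      by_contra h; exact hw0 (hm3 w0 (not_lt.1 h))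
    obtain ⟨w, hw, hwmax⟩ := Finset.exists_max_image _ id hne
    simp only [Finset.mem_filter, Finset.mem_range, id] at hw hwmax
    have hkw : k ≤ w := by
      refine hkw0.trans (hwmax w0 ⟨?_, hw0⟩)
      by_contra h; exact hw0 (hm3 w0 (not_lt.1 h))
    set Y := S.filter (fun x => pb x = w) with hY
    have hYS : Y ⊆ S := Finset.filter_subset _ _
    have hYd : dm v Y = (m w : ℤ) • β w := hpb2 w (Finset.mem_range.2 hw.1)
    rcases Nat.lt_or_eq_of_le (huk.trans hkw) with h1 | h1
    · -- degree argument
      have hnull : Null v B (Num a v (ind Y) B) := by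
        apply null_of_chi_neg a v B Y (hYS.trans hSB)
        rw [hYd, hB]
        simp only [map_sub, map_smul, LinearMap.sub_apply, LinearMap.smul_apply, smul_eq_mul]
        rw [hD.one w hw.1]
        have h2 := hD.neg u w h1
        have h3 : (1:ℤ) ≤ m w := by have := hw.2; omega
        nlinarith
      apply hN
      have hg : Null v B (Num a v (ind S) B * Num a v pb S) := by
        refine hnull.dvd ?_
        rw [Num, Num, Num, ← PP_add]
        apply PP_dvd
        intro x y
        unfold ne
        by_cases hxy : x ∈ B ∧ y ∈ B ∧ ind Y x < ind Y y
        · rw [if_pos hxy]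
          have hyY : y ∈ Y := by
            by_contra h; have := hxy.2.2; simp [ind, h] at this
          have hxY : x ∉ Y := by
            intro h; have := hxy.2.2; simp [ind, h, hyY] at this
          by_cases hxS : x ∈ S
          · have h5 : pb x < pb y := by
              rw [(Finset.mem_filter.1 hyY).2]
              have h6 := hpb1 x hxS
              have h7 : m (pb x) ≠ 0 := by
                intro h0
                have h8 := hpb2 (pb x) h6
                rw [h0] at h8
                have h9 := dm_sum v (S.filter (fun y => pb y = pb x))
                rw [h8] at h9
                simp only [Nat.cast_zero, zero_smul, Pi.zero_apply, Finset.sum_const_zero] at h9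
                have h10 : (S.filter (fun y => pb y = pb x)).card = 0 := by exact_mod_cast h9.symm
                rw [Finset.card_eq_zero] at h10
                have : x ∈ S.filter (fun y => pb y = pb x) := Finset.mem_filter.2 ⟨hxS, rfl⟩
                rw [h10] at this; simp at this
              refine lt_of_le_of_ne (hwmax _ ⟨Finset.mem_range.1 h6, h7⟩) (fun h => hxY (Finset.mem_filter.2 ⟨hxS, h⟩))
            rw [if_pos (show x ∈ S ∧ y ∈ S ∧ pb x < pb y from ⟨hxS, hYS hyY, h5⟩)]
            omega
          · rw [if_pos (show x ∈ B ∧ y ∈ B ∧ ind S x < ind S y from ⟨hxy.1, hxy.2.1, by simp [ind, hxS, hYS hyY]⟩)]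
            omega
        · rw [if_neg hxy]; omega
      have hg2 : Null v B (Num a v (ind S) B) := by
        refine trans_null v B S hSB _ _ ?_ c hc hcA ?_
        · intro w hw
          obtain ⟨h1, h2, h3⟩ := W_Sd_symm hw
          rw [rename_Num a v _ B (W_mono (Sd_le hSB (fun _ _ _ _ h => h)) hw)]
          congr 1
          funext x
          simp [ind, h1]
        · rw [mul_left_comm]; exact hg.mul _
      refine hg2.dvd (PP_dvd ?_)
      intro x y
      unfold ne
      by_cases hxy : x ∈ B ∧ y ∈ B ∧ ind S x < ind S y
      · have hyY : y ∈ S := by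
          by_contra h; have := hxy.2.2; simp [ind, h] at this
        have hxY : x ∉ S := by
          intro h; have := hxy.2.2; simp [ind, h, hyY] at this
        rw [if_pos hxy, if_pos]
        refine ⟨hxy.1, hxy.2.1, ?_⟩
        rw [(Finset.mem_filter.1 hyY).2]
        exact lt_of_le_of_ne (hpk x hxy.1) (fun h => hxY (Finset.mem_filter.2 ⟨hxy.1, h⟩))
      · rw [if_neg hxy]; omega
    · have : w = u := h1.symm
      subst this
      apply hSe
      apply dm_eq_of_subset v hSB
      apply le_antisymm (dm_mono v hSB)
      rw [hB]
      refine le_trans ?_ (hYd ▸ dm_mono v hYS)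
      intro i
      have h2 := hD.nonneg w i
      have h3 : (1:ℤ) ≤ m w := by have := hw.2; omega
      simp only [Pi.smul_apply, smul_eq_mul, Pi.zero_apply] at h2 ⊢
      nlinarith
  have hle : chi a (dm v S) (β k) ≤ 0 := by
    rw [← hm1]
    simp only [map_sum, map_smul, LinearMap.sum_apply, LinearMap.smul_apply, smul_eq_mul]
    apply Finset.sum_nonpos
    intro w _
    by_cases h : m w = 0
    · simp [h]
    · exact mul_nonpos_of_nonneg_of_nonpos (by simp) (hD.neg w k (hall w h))
  refine ⟨hle.trans (by split_ifs <;> simp), ?_⟩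
  intro _ h; omega

lemma lemD {a : Fin n → Fin n → ℕ} {β : ℕ → Fin n → ℤ} {r : ℕ} (hD : Dat a β r) (v : Fin N → Fin n)
    {Cl : Type*} [DecidableEq Cl] (A : Finset (Fin N)) (cl : Fin N → Cl) (𝒞 : Finset Cl) (u : Cl → ℕ)
    (hcl : ∀ x ∈ A, cl x ∈ 𝒞) (hu : ∀ c ∈ 𝒞, u c < r)
    (hd : ∀ c ∈ 𝒞, dm v (A.filter (fun x => cl x = c)) = β (u c))
    (hE : ∀ S : Finset (Fin N), S.card < A.card → Eff a β r v S)
    (p : Fin N → ℕ)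
    (hp : ∀ x ∈ A, p x < r)
    (hpd : ∀ k, dm v (A.filter (fun x => p x = k)) = dm v (A.filter (fun x => u (cl x) = k)))
    (hN : ∀ c ∈ 𝒞, ¬ Null v (A.filter (fun x => cl x = c)) (Num a v p (A.filter (fun x => cl x = c)))) :
    ∀ x ∈ A, p x = u (cl x) := by
  have key : ∀ j, j ≤ r → ∀ x ∈ A, (r - j ≤ p x ∨ r - j ≤ u (cl x)) → p x = u (cl x) := by
    intro j
    induction j with
    | zero =>
      intro _ x hx h
      have := hp x hx
      have := hu _ (hcl x hx)
      omega
    | succ j ih =>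
      intro hj
      set k := r - (j + 1) with hk
      have hkk : r - j = k + 1 := by omega
      have ih := ih (by omega)
      rw [hkk] at ih
      have hkr : k < r := by omega
      have step : ∀ c ∈ 𝒞, u c ≤ k → _ := fun c hc huk =>
        lemD_step hD v (A.filter (fun x => cl x = c)) (u c) k (hu c hc) huk (hd c hc) p (by
          intro x hx
          rw [Finset.mem_filter] at hx
          by_contra h
          have := ih x hx.1 (Or.inl (by omega))
          rw [hx.2] at this
          omega) (hN c hc) (fun S hS => hE S (hS.trans_le (Finset.card_le_card (Finset.filter_subset _ _))))
      have hle : ∀ c ∈ 𝒞, chi a (dm v ((A.filter (fun x => cl x = c)).filter (fun x => p x = k))) (β k) ≤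
          (if u c = k then 1 else 0) := by
        intro c hc
        by_cases huk : u c ≤ k
        · exact (step c hc huk).1
        · have : (A.filter (fun x => cl x = c)).filter (fun x => p x = k) = ∅ := by
            ext x
            simp only [Finset.mem_filter]
            constructor
            · rintro ⟨⟨h1, h2⟩, h3⟩
              have := ih x h1 (Or.inr (by rw [h2]; omega))
              rw [h2] at this
              omega
            · intro h; simp at h
          rw [this]
          simp only [dm, Finset.sum_empty, map_zero, LinearMap.zero_apply]
          split_ifs <;> simp
      have hsum : ∑ c ∈ 𝒞, chi a (dm v ((A.filter (fun x => cl x = c)).filter (fun x => p x = k))) (β k) =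
          ∑ c ∈ 𝒞, (if u c = k then 1 else 0) := by
        have h1 := dm_fiber v (A.filter (fun x => p x = k)) cl 𝒞 (fun x hx => hcl x (Finset.mem_filter.1 hx).1)
        have h2 := dm_fiber v (A.filter (fun x => u (cl x) = k)) cl 𝒞 (fun x hx => hcl x (Finset.mem_filter.1 hx).1)
        rw [← hpd k, ← h1] at h2
        have h3 := congrArg (fun t => chi a t (β k)) h2
        simp only [map_sum, LinearMap.sum_apply] at h3
        simp only [Finset.filter_filter] at h3 ⊢
        rw [Finset.sum_congr rfl (g := fun c => chi a (dm v (A.filter (fun x => p x = k ∧ cl x = c))) (β k))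
          (fun c _ => by simp only [and_comm]), ← h3]
        refine Finset.sum_congr rfl fun c hc => ?_
        by_cases h : u c = k
        · rw [if_pos h, ← hD.one k hkr]
          congr 2
          rw [← h, ← hd c hc]
          congr 1
          ext x
          simp only [Finset.mem_filter]
          constructor
          · rintro ⟨h1, h2, h3⟩; exact ⟨h1, h3⟩
          · rintro ⟨h1, h3⟩; exact ⟨h1, by rw [h3], h3⟩
        · rw [if_neg h]
          have : A.filter (fun x => u (cl x) = k ∧ cl x = c) = ∅ := by
            ext x
            simp only [Finset.mem_filter]
            constructor
            · rintro ⟨h1, h2, h3⟩; rw [h3] at h2; exact absurd h2 h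
            · intro h; simp at h
          rw [this]
          simp [dm]
      have heq := (Finset.sum_eq_sum_iff_of_le hle).1 hsum
      have hsub : A.filter (fun x => u (cl x) = k) ⊆ A.filter (fun x => p x = k) := by
        intro x hx
        rw [Finset.mem_filter] at hx ⊢
        refine ⟨hx.1, ?_⟩
        have h1 := hcl x hx.1
        have h2 := (step _ h1 hx.2.le).2 hx.2 (by rw [heq _ h1, if_pos hx.2])
        have h3 : x ∈ A.filter (fun y => cl y = cl x) := Finset.mem_filter.2 ⟨hx.1, rfl⟩
        rw [← h2] at h3
        exact (Finset.mem_filter.1 h3).2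
      have hse := dm_eq_of_subset v hsub (hpd k).symm
      intro x hx h
      by_cases h1 : k + 1 ≤ p x ∨ k + 1 ≤ u (cl x)
      · exact ih x hx h1
      · have h2 : p x = k ∨ u (cl x) = k := by omega
        have h3 : (p x = k ↔ u (cl x) = k) := by
          have := Finset.ext_iff.1 hse x
          simp only [Finset.mem_filter, hx, true_and] at this
          exact this.symm
        rcases h2 with h2 | h2
        · rw [h2, h3.1 h2]
        · rw [h2, h3.2 h2]
  intro x hx
  exact key r le_rfl x hx (Or.inl (by omega))

lemma dm_perm (v : Fin N → Fin n) (A : Finset (Fin N)) {w : Perm (Fin N)} (hw : w ∈ W (Sd A v)) (p : Fin N → ℕ) (k : ℕ) :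
    dm v (A.filter (fun x => p (w.symm x) = k)) = dm v (A.filter (fun x => p x = k)) := by
  obtain ⟨h1, h2, -⟩ := W_Sd_symm hw
  obtain ⟨h1', h2', -⟩ := W_Sd hw
  unfold dm
  refine Finset.sum_bij' (fun x _ => w.symm x) (fun x _ => w x) ?_ ?_ ?_ ?_ ?_
  · intro x hx; simpa [h1] using hx
  · intro x hx; simpa [h1'] using hx
  · intros; simp
  · intros; simp
  · intro x _; rw [h2]

lemma H_of {a : Fin n → Fin n → ℕ} {β : ℕ → Fin n → ℤ} {r : ℕ} (hD : Dat a β r) (v : Fin N → Fin n)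
    {Cl : Type*} [DecidableEq Cl] (A : Finset (Fin N)) (cl : Fin N → Cl) (𝒞 : Finset Cl) (u : Cl → ℕ)
    (hcl : ∀ x ∈ A, cl x ∈ 𝒞) (hu : ∀ c ∈ 𝒞, u c < r)
    (hd : ∀ c ∈ 𝒞, dm v (A.filter (fun x => cl x = c)) = β (u c))
    (hE : ∀ S : Finset (Fin N), S.card < A.card → Eff a β r v S)
    (p : Fin N → ℕ) (hp : ∀ x ∈ A, p x = u (cl x)) :
    ∀ w ∈ W (Sd A v), (¬ ∀ x ∈ A, p (w.symm x) = p x) →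
      ∃ c, Null v (A.filter (fun x => cl x = c)) (Num a v (fun x => p (w.symm x)) (A.filter (fun x => cl x = c))) := by
  intro w hw hne
  by_contra hcon
  push Not at hcon
  apply hne
  intro x hx
  obtain ⟨h1, h2, -⟩ := W_Sd_symm hw
  rw [hp x hx]
  refine lemD hD v A cl 𝒞 u hcl hu hd hE (fun x => p (w.symm x)) ?_ ?_ (fun c _ => hcon c) x hx
  · intro y hy
    have h3 := (h1 y).2 hy
    rw [hp _ h3]; exact hu _ (hcl _ h3)
  · intro k
    rw [dm_perm v A hw]
    congr 1
    refine Finset.filter_congr fun x hx => ?_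
    rw [hp x hx]

lemma PP_homog (e : Fin N → Fin N → ℕ) : (PP e).IsHomogeneous (dg e) := by
  refine IsHomogeneous.prod _ _ _ fun x _ => IsHomogeneous.prod _ _ _ fun y _ => ?_
  have := ((isHomogeneous_X ℚ y).sub (isHomogeneous_X ℚ x)).pow (e x y)
  simpa using this

lemma Alt_homog (s : Setoid (Fin N)) {G : MvPolynomial (Fin N) ℚ} {d : ℕ} (h : G.IsHomogeneous d) :
    (Alt s G).IsHomogeneous d := by
  rw [Alt_apply]
  refine IsHomogeneous.sum _ _ _ fun σ _ => ?_
  have h1 : (sg σ).IsHomogeneous 0 := by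
    rcases sg_eq σ with h | h <;> rw [h]
    · exact isHomogeneous_one _ _
    · exact (isHomogeneous_one _ _).neg
  have h2 := h1.mul (h.rename_isHomogeneous (f := σ))
  rwa [zero_add] at h2

theorem eff_all {a : Fin n → Fin n → ℕ} {β : ℕ → Fin n → ℤ} {r : ℕ} (hD : Dat a β r) (v : Fin N → Fin n) :
    ∀ (d : ℕ) (A : Finset (Fin N)), A.card = d → Eff a β r v A := by
  intro d
  induction d using Nat.strong_induction_on with
  | _ d ih =>
  intro A hA m p hm hpr hpd
  have hE : ∀ S : Finset (Fin N), S.card < A.card → Eff a β r v S := fun S hS => ih _ (hA ▸ hS) S rfl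
  have hcls : ∀ k, ∃ cl : Fin N → ℕ, k < r → (∀ x ∈ A.filter (fun x => p x = k), cl x ∈ Finset.range (m k)) ∧
      ∀ c ∈ Finset.range (m k), dm v ((A.filter (fun x => p x = k)).filter (fun x => cl x = c)) = β k := by
    intro k
    by_cases hk : k < r
    · obtain ⟨cl, h⟩ := exists_clusters v (Finset.range (m k)) (fun _ => β k) (fun _ => hD.nonneg k)
        (A.filter (fun x => p x = k)) (by rw [hpd k hk]; simp)
      exact ⟨cl, fun _ => h⟩
    · exact ⟨fun _ => 0, fun h => absurd h hk⟩
  choose cl0 hcl0 using hcls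
  let cl : Fin N → ℕ × ℕ := fun x => (p x, cl0 (p x) x)
  let 𝒞 : Finset (ℕ × ℕ) := (Finset.range r).biUnion (fun k => (Finset.range (m k)).image (fun j => (k, j)))
  have hmem : ∀ c, c ∈ 𝒞 ↔ c.1 < r ∧ c.2 < m c.1 := by
    rintro ⟨k, j⟩
    simp only [𝒞, Finset.mem_biUnion, Finset.mem_range, Finset.mem_image, Prod.mk.injEq]
    constructor
    · rintro ⟨k', h1, j', h2, rfl, rfl⟩; exact ⟨h1, h2⟩
    · rintro ⟨h1, h2⟩; exact ⟨k, h1, j, h2, rfl, rfl⟩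
  obtain ⟨κ, hκ, hT⟩ := thmT a v A cl p (fun x _ y _ h => congrArg Prod.fst h)
    (H_of hD v A cl 𝒞 Prod.fst (by
      intro x hx
      rw [hmem]
      exact ⟨hpr x hx, Finset.mem_range.1 ((hcl0 _ (hpr x hx)).1 x (Finset.mem_filter.2 ⟨hx, rfl⟩))⟩)
      (fun c hc => ((hmem c).1 hc).1)
      (by
        rintro ⟨k, j⟩ hc
        rw [hmem] at hc
        rw [← (hcl0 k hc.1).2 j (Finset.mem_range.2 hc.2), Finset.filter_filter]
        congr 1
        ext x
        simp only [cl, Finset.mem_filter, Prod.mk.injEq]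
        constructor
        · rintro ⟨h1, h2, h3⟩; subst h2; exact ⟨h1, rfl, h3⟩
        · rintro ⟨h1, h2, h3⟩; subst h2; exact ⟨h1, rfl, h3⟩) hE p (fun x _ => rfl))
    (fun x => (Nat.pair (cl x).1 (cl x).2 : ℚ)) (by
      intro x _ y _
      constructor
      · intro h; rw [h]
      · intro h
        have h1 : Nat.pair (cl x).1 (cl x).2 = Nat.pair (cl y).1 (cl y).2 := by exact_mod_cast h
        rw [Nat.pair_eq_pair] at h1
        exact Prod.ext h1.1 h1.2)
  obtain ⟨P, hP⟩ := Alt_dvd (Sd A v) (Van (Sd A (fun x => (v x, p x))) * Num a v p A)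
  have hev := hT 1 (fun σ _ => by simp) P (by rw [one_mul, hP])
  rw [map_one, mul_one] at hev
  have hP0 : P ≠ 0 := by
    rintro rfl
    rw [map_zero] at hev; exact hκ hev.symm
  have hdeg := dg_chi a v p A r hpr
  rw [Finset.sum_eq_zero] at hdeg
  · have h1 := Alt_homog (Sd A v) ((PP_homog (ve (Sd A (fun x => (v x, p x))))).mul (PP_homog (ne a v p A)))
    have h2 := congrArg totalDegree hP
    have h1' : (Alt (Sd A v) (Van (Sd A (fun x => (v x, p x))) * Num a v p A)).totalDegree ≤
      dg (ve (Sd A (fun x => (v x, p x)))) + dg (ne a v p A) := h1.totalDegree_le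
    rw [totalDegree_mul_of_isDomain (Van_ne_zero _) hP0, Van_eq (Sd A v),
      (PP_homog (ve (Sd A v))).totalDegree (Van_ne_zero _)] at h2
    have h3 : P.totalDegree = 0 := by omega
    rw [totalDegree_eq_zero_iff_eq_C] at h3
    rw [h3] at hP0
    refine ⟨coeff 0 P, fun h => hP0 (by rw [h, C_0]), ?_⟩
    rw [hP, mul_comm, ← h3]
  · intro u hu
    refine Finset.sum_eq_zero fun w hw => ?_
    rw [Finset.mem_range] at hu hw
    by_cases huw : u < w
    · rw [if_pos huw, hpd u hu, hpd w hw]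
      simp only [map_smul, LinearMap.smul_apply, smul_eq_mul]
      by_cases h1 : m u = 0
      · simp [h1]
      by_cases h2 : m w = 0
      · simp [h2]
      rw [hm u w huw h1 h2]; simp
    · rw [if_neg huw]

end PartD
end MuInj

open MvPolynomial
open scoped Classical TensorProduct

namespace MuInj
open Equiv (Perm)
section PartE
variable {n : ℕ}

/-- partial form -/
noncomputable def ch (b : Fin n → Fin n → ℤ) (o : Fin n → Fin n → Prop) : LinearMap.BilinForm ℤ (Fin n → ℤ) :=
  Matrix.toBilin' (Matrix.of fun i j => (if i = j then 1 else 0) - (if o i j then b i j else 0))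

/-- symmetric form -/
noncomputable def BB (b : Fin n → Fin n → ℤ) : LinearMap.BilinForm ℤ (Fin n → ℤ) :=
  Matrix.toBilin' (Matrix.of fun i j => (if i = j then 2 else 0) - b i j)

/-- basis vector -/
def ee (i : Fin n) : Fin n → ℤ := Pi.single i 1

/-- reflection -/
noncomputable def sr (b : Fin n → Fin n → ℤ) (i : Fin n) (y : Fin n → ℤ) : Fin n → ℤ := y - BB b y (ee i) • ee i

lemma BB_apply (b : Fin n → Fin n → ℤ) (x y : Fin n → ℤ) :
    BB b x y = ∑ j, ∑ k, x j * ((if j = k then 2 else 0) - b j k) * y k := by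
  rw [BB, Matrix.toBilin'_apply]; rfl

lemma ch_apply (b : Fin n → Fin n → ℤ) (o : Fin n → Fin n → Prop) (x y : Fin n → ℤ) :
    ch b o x y = ∑ j, ∑ k, x j * ((if j = k then 1 else 0) - (if o j k then b j k else 0)) * y k := by
  rw [ch, Matrix.toBilin'_apply]; rfl

lemma BB_ee (b : Fin n → Fin n → ℤ) (x : Fin n → ℤ) (i : Fin n) :
    BB b x (ee i) = 2 * x i - ∑ j, x j * b j i := by
  rw [BB_apply]
  simp [ee, Pi.single_apply, mul_sub, mul_comm]

lemma ch_ee_right (b : Fin n → Fin n → ℤ) (o) (x : Fin n → ℤ) (i : Fin n) :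
    ch b o x (ee i) = x i - ∑ j, x j * (if o j i then b j i else 0) := by
  rw [ch_apply]
  simp [ee, Pi.single_apply, mul_sub]

lemma ch_ee_left (b : Fin n → Fin n → ℤ) (o) (x : Fin n → ℤ) (i : Fin n) :
    ch b o (ee i) x = x i - ∑ j, (if o i j then b i j else 0) * x j := by
  rw [ch_apply]
  simp [ee, Pi.single_apply, sub_mul]

/-- form data -/
structure BD (b : Fin n → Fin n → ℤ) : Prop where
  symm : ∀ i j, b i j = b j i
  diag : ∀ i, b i i = 0
  nonneg : ∀ i j, 0 ≤ b i j
  pos : ∀ x, x ≠ 0 → 0 < BB b x x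

variable {b : Fin n → Fin n → ℤ}

lemma BB_symm (hb : BD b) (x y : Fin n → ℤ) : BB b x y = BB b y x := by
  rw [BB_apply, BB_apply, Finset.sum_comm]
  refine Finset.sum_congr rfl fun j _ => Finset.sum_congr rfl fun k _ => ?_
  rw [hb.symm k j]
  by_cases h : j = k
  · subst h; simp; ring
  · simp [h, Ne.symm h]; ring

lemma BB_ee_ee (hb : BD b) (i : Fin n) : BB b (ee i) (ee i) = 2 := by
  rw [BB_ee]; simp [ee, Pi.single_apply, hb.diag]

lemma BB_nonneg (hb : BD b) (x : Fin n → ℤ) : 0 ≤ BB b x x := by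
  by_cases h : x = 0
  · simp [h]
  · exact (hb.pos x h).le

lemma BB_sr (hb : BD b) (i : Fin n) (x : Fin n → ℤ) : BB b (sr b i x) (sr b i x) = BB b x x := by
  simp only [sr, map_sub, map_smul, LinearMap.sub_apply, LinearMap.smul_apply, smul_eq_mul, BB_ee_ee hb, BB_symm hb (ee i) x]
  ring

lemma sr_ee (hb : BD b) (i : Fin n) (x : Fin n → ℤ) : BB b (sr b i x) (ee i) = - BB b x (ee i) := by
  simp only [sr, map_sub, map_smul, LinearMap.sub_apply, LinearMap.smul_apply, smul_eq_mul, BB_ee_ee hb]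
  ring

lemma sr_sr (hb : BD b) (i : Fin n) (x : Fin n → ℤ) : sr b i (sr b i x) = x := by
  rw [sr, sr_ee hb, sr]; simp

lemma sr_apply_ne (i j : Fin n) (h : j ≠ i) (x : Fin n → ℤ) : sr b i x j = x j := by
  simp [sr, ee, h]

lemma sr_apply_self (i : Fin n) (x : Fin n → ℤ) : sr b i x i = x i - BB b x (ee i) := by
  simp [sr, ee]

/-- step of orders: i goes from minimum to maximum -/
structure Stp (o o' : Fin n → Fin n → Prop) (i : Fin n) : Prop where
  h1 : ∀ j, j ≠ i → o i j
  h2 : ∀ j, ¬ o j i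
  h3 : ∀ j, j ≠ i → o' j i
  h4 : ∀ j, ¬ o' i j
  h5 : ∀ j k, j ≠ i → k ≠ i → (o j k ↔ o' j k)

variable {o o' : Fin n → Fin n → Prop} {i : Fin n}

lemma Stp.r (hs : Stp o o' i) (x : Fin n → ℤ) : ch b o x (ee i) = x i := by
  rw [ch_ee_right]; simp [hs.h2]

lemma Stp.l' (hs : Stp o o' i) (x : Fin n → ℤ) : ch b o' (ee i) x = x i := by
  rw [ch_ee_left]; simp [hs.h4]

lemma Stp.r' (hb : BD b) (hs : Stp o o' i) (x : Fin n → ℤ) : ch b o' x (ee i) = BB b x (ee i) - x i := by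
  rw [ch_ee_right, BB_ee]
  have : ∀ j, (if o' j i then b j i else 0) = b j i := by
    intro j
    by_cases h : j = i
    · subst h; simp [hb.diag]
    · simp [hs.h3 j h]
  simp only [this]; ring

lemma Stp.l (hb : BD b) (hs : Stp o o' i) (x : Fin n → ℤ) : ch b o (ee i) x = BB b x (ee i) - x i := by
  rw [ch_ee_left, BB_ee]
  have : ∀ j, (if o i j then b i j else 0) * x j = x j * b j i := by
    intro j
    by_cases h : j = i
    · subst h; simp [hb.diag]
    · simp [hs.h1 j h, hb.symm i j, mul_comm]
  simp only [this]; ring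

lemma Stp.diff (hb : BD b) (hs : Stp o o' i) (x y : Fin n → ℤ) :
    ch b o' x y = ch b o x y + BB b x (ee i) * y i - x i * BB b y (ee i) := by
  have key : ∀ j k, ((if j = k then (1:ℤ) else 0) - (if o' j k then b j k else 0)) =
      ((if j = k then 1 else 0) - (if o j k then b j k else 0)) + (if k = i then (- b j i) else 0) + (if j = i then b k i else 0) := by
    intro j k
    by_cases hj : j = i
    · subst hj
      by_cases hk : k = j
      · subst hk; simp [hb.diag]
      · simp [hs.h4, hs.h1 k hk, hk, Ne.symm hk, hb.symm j k]
    · by_cases hk : k = i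
      · subst hk; simp [hs.h3 j hj, hs.h2, hj]
      · simp [hj, hk, hs.h5 j k hj hk]
  rw [ch_apply, ch_apply, BB_ee, BB_ee]
  simp only [key]
  simp only [mul_add, add_mul, Finset.sum_add_distrib]
  simp only [mul_ite, ite_mul, mul_zero, zero_mul, Finset.sum_ite_eq', Finset.mem_univ, if_true]
  have e1 : ∑ j, x j * -b j i * y i = - (∑ j, x j * b j i) * y i := by
    rw [← Finset.sum_neg_distrib, Finset.sum_mul]
    exact Finset.sum_congr rfl fun j _ => by ring
  have e2 : ∑ j, ∑ k, (if j = i then x j * b k i * y k else 0) = x i * ∑ k, y k * b k i := by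
    rw [Finset.sum_comm]
    simp only [Finset.sum_ite_eq', Finset.mem_univ, if_true, Finset.mul_sum]
    exact Finset.sum_congr rfl fun j _ => by ring
  rw [e1, e2]; ring

lemma Stp.inv (hb : BD b) (hs : Stp o o' i) (x y : Fin n → ℤ) :
    ch b o' (sr b i x) (sr b i y) = ch b o x y := by
  simp only [sr, map_sub, map_smul, LinearMap.sub_apply, LinearMap.smul_apply, smul_eq_mul, hs.l', hs.r' hb, hs.diff hb x y]
  simp [ee, BB_ee_ee hb]
  have := BB_ee_ee hb i
  simp only [ee] at this
  ring

lemma sr_nonneg (hb : BD b) {a : Fin n → ℤ} (h0 : 0 ≤ a) (h2 : BB b a a = 2) (hne : a ≠ ee i) : 0 ≤ sr b i a := by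
  by_contra hcon
  have hj : ∀ j, j ≠ i → 0 ≤ sr b i a j := fun j hj => by rw [sr_apply_ne i j hj]; exact h0 j
  have hi : sr b i a i < 0 := by
    by_contra hi
    push Not at hi
    apply hcon
    intro j
    by_cases h : j = i
    · subst h; exact hi
    · exact hj j h
  obtain ⟨k, hk⟩ : ∃ k, k = - sr b i a i := ⟨_, rfl⟩
  obtain ⟨c, hc⟩ : ∃ c, c = sr b i a + k • ee i := ⟨_, rfl⟩
  have hci : c i = 0 := by simp [hc, ee, hk]
  have hc0 : 0 ≤ c := by
    intro j
    by_cases h : j = i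
    · subst h; simp [hci]
    · simp [hc, ee, h]; exact hj j h
  have hN : BB b c (ee i) ≤ 0 := by
    rw [BB_ee, hci]
    have : 0 ≤ ∑ j, c j * b j i := Finset.sum_nonneg fun j _ => mul_nonneg (hc0 j) (hb.nonneg j i)
    linarith
  have hsr : sr b i a = c - k • ee i := by simp [hc]
  have hB := BB_sr hb i a
  rw [h2, hsr] at hB
  simp only [map_sub, map_smul, LinearMap.sub_apply, LinearMap.smul_apply, smul_eq_mul, BB_ee_ee hb, BB_symm hb (ee i) c] at hB
  have hk0 : 1 ≤ k := by omega
  have hcc : c = 0 := by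
    by_contra h
    have := hb.pos c h
    nlinarith
  rw [hcc] at hB hsr
  simp at hB
  have hk1 : k = 1 := by nlinarith
  apply hne
  rw [← sr_sr hb i a, hsr, hk1, sr]
  have := BB_ee_ee hb i
  simp [this, two_smul]

/-- generic decomposition exists -/
def Good (b : Fin n → Fin n → ℤ) (o : Fin n → Fin n → Prop) (δ : Fin n → ℤ) : Prop :=
  ∃ s : Multiset (Fin n → ℤ), s.sum = δ ∧ (∀ x ∈ s, 0 ≤ x ∧ BB b x x = 2) ∧ ∀ x ∈ s, ∀ y ∈ s, 0 ≤ ch b o x y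

lemma good_zero : Good b o 0 := ⟨0, by simp, by simp, by simp⟩

lemma good_add (hb : BD b) (hs : Stp o o' i) (δ : Fin n → ℤ) (hz : BB b δ (ee i) = δ i) (p : ℕ) (h : Good b o δ) :
    Good b o (δ + p • ee i) := by
  obtain ⟨s, hsum, hr, hc⟩ := h
  have hsumf : (s.map (fun x => ch b o (ee i) x)).sum = 0 := by
    have := map_multiset_sum (ch b o (ee i)) s
    rw [hsum, hs.l hb, hz] at this
    rw [← this]; simp
  have hni : ee i ∉ s := by
    intro hmem
    have h1 : ∀ z ∈ s.map (fun x => ch b o (ee i) x), 0 ≤ z := by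
      intro z hz
      obtain ⟨x, hx, rfl⟩ := Multiset.mem_map.1 hz
      exact hc _ hmem _ hx
    have h2 := Multiset.all_zero_of_le_zero_le_of_sum_eq_zero h1 hsumf _ (Multiset.mem_map_of_mem _ hmem)
    rw [hs.r] at h2
    simp [ee] at h2
  have hle : ∀ x ∈ s, ch b o (ee i) x ≤ 0 := by
    intro x hx
    have := sr_nonneg hb (hr x hx).1 (hr x hx).2 (i := i) (fun h => hni (h ▸ hx)) i
    rw [sr_apply_self] at this
    rw [hs.l hb]
    simp at this; linarith
  have hzero : ∀ x ∈ s, ch b o (ee i) x = 0 := by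
    intro x hx
    have h3 : ∀ z ∈ s.map (fun x => - ch b o (ee i) x), 0 ≤ z := by
      intro z hz
      obtain ⟨x, hx, rfl⟩ := Multiset.mem_map.1 hz
      have := hle _ hx
      linarith
    have h4 : (s.map (fun x => - ch b o (ee i) x)).sum = 0 := by
      have h5 := map_multiset_sum (-(ch b o (ee i))) s
      simp only [LinearMap.neg_apply] at h5
      rw [hsum, hs.l hb, hz] at h5
      rw [← h5]; simp
    have := Multiset.all_zero_of_le_zero_le_of_sum_eq_zero h3 h4 _ (Multiset.mem_map_of_mem _ hx)
    linarith
  refine ⟨s + Multiset.replicate p (ee i), by simp [hsum], ?_, ?_⟩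
  · intro x hx
    rcases Multiset.mem_add.1 hx with h | h
    · exact hr x h
    · rw [Multiset.eq_of_mem_replicate h]
      exact ⟨by simp [ee], BB_ee_ee hb i⟩
  · intro x hx y hy
    rcases Multiset.mem_add.1 hx with h | h <;> rcases Multiset.mem_add.1 hy with h' | h'
    · exact hc x h y h'
    · rw [Multiset.eq_of_mem_replicate h', hs.r]; exact (hr x h).1 i
    · rw [Multiset.eq_of_mem_replicate h, hzero y h']
    · rw [Multiset.eq_of_mem_replicate h, Multiset.eq_of_mem_replicate h', hs.r]; simp [ee]

lemma good_refl (hb : BD b) (hs : Stp o o' i) (δ : Fin n → ℤ) (h0 : 0 ≤ δ) (h : Good b o' (sr b i δ)) :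
    Good b o δ := by
  obtain ⟨s, hsum, hr, hc⟩ := h
  have hni : ee i ∉ s := by
    intro hmem
    have h1 : ∀ z ∈ s.map (fun x => ch b o' x (ee i)), 0 ≤ z := by
      intro z hz
      obtain ⟨x, hx, rfl⟩ := Multiset.mem_map.1 hz
      exact hc _ hx _ hmem
    have h2 := Multiset.single_le_sum h1 _ (Multiset.mem_map_of_mem _ hmem)
    have h3 := map_multiset_sum ((ch b o').flip (ee i)) s
    have h4 : (s.map (fun x => ch b o' x (ee i))).sum = ch b o' s.sum (ee i) := h3.symm
    rw [h4, hsum, hs.l', hs.r' hb, sr_ee hb, sr_apply_self] at h2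
    have := h0 i
    simp [ee] at h2 this
    omega
  have hssr : ∀ t : Multiset (Fin n → ℤ), sr b i t.sum = (t.map (sr b i)).sum := by
    intro t
    induction t using Multiset.induction_on with
    | empty => simp [sr]
    | cons x t ih =>
      rw [Multiset.sum_cons, Multiset.map_cons, Multiset.sum_cons, ← ih]
      simp only [sr, map_add, LinearMap.add_apply, add_smul]; abel
  refine ⟨s.map (sr b i), ?_, ?_, ?_⟩
  · rw [← hssr, hsum, sr_sr hb]
  · intro x hx
    obtain ⟨y, hy, rfl⟩ := Multiset.mem_map.1 hx
    exact ⟨sr_nonneg hb (hr y hy).1 (hr y hy).2 (fun h => hni (h ▸ hy)), by rw [BB_sr hb]; exact (hr y hy).2⟩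
  · intro x hx y hy
    obtain ⟨x', hx', rfl⟩ := Multiset.mem_map.1 hx
    obtain ⟨y', hy', rfl⟩ := Multiset.mem_map.1 hy
    rw [← hs.inv hb, sr_sr hb, sr_sr hb]
    exact hc x' hx' y' hy'

end PartE
end MuInj

open MvPolynomial
open scoped Classical TensorProduct

namespace MuInj
open Equiv (Perm)
section PartE2
variable {n : ℕ} {b : Fin n → Fin n → ℤ}

lemma BB_dual (hb : BD b) : ∃ d : ℤ, 0 < d ∧ ∀ w : Fin n → ℤ, ∃ z, ∀ y, BB b z y = d * ∑ i, w i * y i := by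
  obtain ⟨M, hM⟩ : ∃ M : Matrix (Fin n) (Fin n) ℤ, M = Matrix.of fun i j => (if i = j then 2 else 0) - b i j := ⟨_, rfl⟩
  have hBB : ∀ x y, BB b x y = x ⬝ᵥ M.mulVec y := by
    intro x y; rw [BB, ← hM, Matrix.toBilin'_apply']
  have hdet : M.det ≠ 0 := by
    intro h
    obtain ⟨v, hv, hv'⟩ := Matrix.exists_mulVec_eq_zero_iff.2 h
    have := hb.pos v hv
    rw [hBB, hv'] at this
    simp at this
  refine ⟨M.det * M.det, mul_self_pos.2 hdet, fun w => ⟨M.det • Matrix.vecMul w M.adjugate, fun y => ?_⟩⟩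
  rw [hBB, Matrix.dotProduct_mulVec, Matrix.smul_vecMul, Matrix.vecMul_vecMul, Matrix.adjugate_mul]
  simp only [Matrix.vecMul_smul, Matrix.vecMul_one, smul_dotProduct, smul_eq_mul]
  rw [mul_assoc]; rfl

lemma BB_cs (hb : BD b) (x y : Fin n → ℤ) : BB b x y ^ 2 ≤ BB b x x * BB b y y := by
  by_cases hy : y = 0
  · simp [hy]
  have h1 := BB_nonneg hb (BB b y y • x - BB b x y • y)
  simp only [map_sub, map_smul, LinearMap.sub_apply, LinearMap.smul_apply, smul_eq_mul, BB_symm hb y x] at h1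
  have h2 := hb.pos y hy
  have h3 : 0 ≤ BB b y y * (BB b x x * BB b y y - BB b x y ^ 2) := by linarith
  have := nonneg_of_mul_nonneg_right h3 h2
  linarith

lemma fin_le (hb : BD b) (K : ℤ) : {y : Fin n → ℤ | BB b y y ≤ K}.Finite := by
  obtain ⟨d, hd, hz⟩ := BB_dual hb
  choose z hz using fun i => hz (ee i)
  have hz' : ∀ i y, BB b (z i) y = d * y i := by
    intro i y; rw [hz]; simp [ee, Pi.single_apply]
  refine (Set.finite_Icc (fun i => - (BB b (z i) (z i) * K)) (fun i => BB b (z i) (z i) * K)).subset ?_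
  intro y hy
  have hy : BB b y y ≤ K := hy
  have key : ∀ i, (y i) ^ 2 ≤ BB b (z i) (z i) * K := by
    intro i
    have h1 := BB_cs hb (z i) y
    rw [hz'] at h1
    have h2 := mul_le_mul_of_nonneg_left hy (BB_nonneg hb (z i))
    have h3 : y i ^ 2 ≤ (d * y i) ^ 2 := by
      rw [mul_pow]
      have : 1 ≤ d ^ 2 := by nlinarith
      nlinarith [sq_nonneg (y i)]
    linarith
  constructor <;> intro i <;> have h := key i <;> have h' : |y i| ≤ y i ^ 2 := (by rw [← sq_abs, ← Int.natCast_natAbs]; have := Nat.le_self_pow (n := 2) (by norm_num) (y i).natAbs; exact_mod_cast this)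
  · have := neg_abs_le (y i); show _ ≤ _; linarith
  · have := le_abs_self (y i); show _ ≤ _; linarith

/-- next reflection time -/
def nxt (π : Fin n ≃ Fin n) : ℕ → Fin n → ℕ
  | 0, x => π x
  | t + 1, x => if nxt π t x = t then t + n else nxt π t x

lemma nxt_spec (π : Fin n ≃ Fin n) (t : ℕ) (x : Fin n) :
    t ≤ nxt π t x ∧ nxt π t x < t + n ∧ nxt π t x % n = π x := by
  induction t with
  | zero => simp [nxt, Nat.mod_eq_of_lt]
  | succ t ih =>
    rw [nxt]
    have := x.pos
    split_ifs with h
    · refine ⟨by omega, by omega, ?_⟩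
      rw [h] at ih
      simp [ih.2.2]
    · exact ⟨by omega, by omega, ih.2.2⟩

lemma nxt_inj (π : Fin n ≃ Fin n) (t : ℕ) {x y : Fin n} (h : nxt π t x = nxt π t y) : x = y := by
  have h1 := (nxt_spec π t x).2.2
  rw [h, (nxt_spec π t y).2.2] at h1
  exact (π.injective (Fin.ext h1)).symm

lemma nxt_ex (π : Fin n ≃ Fin n) (hn : 0 < n) (t : ℕ) : ∃ i, nxt π t i = t := by
  refine ⟨π.symm ⟨t % n, Nat.mod_lt _ hn⟩, ?_⟩
  obtain ⟨h1, h2, h3⟩ := nxt_spec π t (π.symm ⟨t % n, Nat.mod_lt _ hn⟩)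
  simp only [Equiv.apply_symm_apply] at h3
  obtain ⟨k, hk⟩ := Nat.exists_eq_add_of_le h1
  rw [hk] at h3 h2 ⊢
  have h4 : k < n := by omega
  have h5 : (t + k) ≡ t + 0 [MOD n] := h3
  have h6 := Nat.ModEq.add_left_cancel' t h5
  have h7 : k % n = 0 % n := h6
  rw [Nat.mod_eq_of_lt h4] at h7
  simp at h7
  omega

/-- order at time t -/
def od (π : Fin n ≃ Fin n) (t : ℕ) (j k : Fin n) : Prop := nxt π t j < nxt π t k

lemma od_stp (π : Fin n ≃ Fin n) (t : ℕ) (i : Fin n) (hi : nxt π t i = t) : Stp (od π t) (od π (t + 1)) i := by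
  have hlt : ∀ j, j ≠ i → t < nxt π t j ∧ nxt π (t+1) j = nxt π t j := by
    intro j hj
    have h1 := (nxt_spec π t j).1
    have h2 : nxt π t j ≠ t := fun h => hj (nxt_inj π t (h.trans hi.symm))
    refine ⟨by omega, ?_⟩
    rw [nxt, if_neg h2]
  have hi' : nxt π (t+1) i = t + n := by rw [nxt, if_pos hi]
  refine ⟨?_, ?_, ?_, ?_, ?_⟩
  · intro j hj; rw [od, hi]; exact (hlt j hj).1
  · intro j; rw [od, hi]; have := (nxt_spec π t j).1; omega
  · intro j hj; rw [od, hi', (hlt j hj).2]; exact (nxt_spec π t j).2.1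
  · intro j; rw [od, hi']; have := (nxt_spec π (t+1) j).2.1; omega
  · intro j k hj hk; rw [od, od, (hlt j hj).2, (hlt k hk).2]

lemma exists_zero (hb : BD b) (π : Fin n ≃ Fin n) (ix : ℕ → Fin n) (hix : ∀ t, nxt π t (ix t) = t) (t0 : ℕ)
    (y : ℕ → Fin n → ℤ) (h0 : ∀ k, 0 ≤ y k) (hs : ∀ k, y (k+1) = sr b (ix (t0 + k)) (y k)) : ∃ k, y k = 0 := by
  obtain ⟨d, hd, hz⟩ := BB_dual hb
  obtain ⟨ρ, hρ⟩ := hz (fun _ => 1)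
  have hρi : ∀ i, BB b ρ (ee i) = d := by
    intro i; rw [hρ]; simp [ee, Pi.single_apply]
  have hBy : ∀ k, BB b (y k) (y k) = BB b (y 0) (y 0) := by
    intro k
    induction k with
    | zero => rfl
    | succ k ih => rw [hs, BB_sr hb, ih]
  obtain ⟨g, hg⟩ : ∃ g : ℕ → ℤ, ∀ k, g k = ch b (od π (t0 + k)) (y k) ρ := ⟨_, fun _ => rfl⟩
  have hgs : ∀ k, g (k+1) = g k - d * y k (ix (t0+k)) := by
    intro k
    have st := od_stp π (t0 + k) _ (hix (t0+k))
    rw [hg, hg, hs, ← st.inv hb, ← add_assoc]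
    have : ρ = sr b (ix (t0+k)) ρ + d • ee (ix (t0+k)) := by rw [sr, hρi]; simp
    conv_lhs => rw [this]
    rw [map_add, map_smul, st.r' hb, sr_ee hb, sr_apply_self, smul_eq_mul]
    ring
  have hbd : BddBelow (Set.range g) := by
    refine Set.Finite.bddBelow ?_
    refine Set.Finite.subset (((fin_le hb (BB b (y 0) (y 0))).prod (Set.finite_univ (α := Fin n → Fin n → Prop))).image
      (fun q : (Fin n → ℤ) × (Fin n → Fin n → Prop) => ch b q.2 q.1 ρ)) ?_
    rintro _ ⟨k, rfl⟩
    exact ⟨(y k, od π (t0+k)), ⟨(hBy k).le, trivial⟩, (hg k).symm⟩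
  obtain ⟨C, hC⟩ := hbd
  obtain ⟨k, hk⟩ : ∃ k, ∀ l, g k ≤ g l := by
    obtain ⟨_, ⟨k, rfl⟩, hk⟩ := Int.exists_least_of_bdd (P := fun z => ∃ k, g k = z) ⟨C, fun z ⟨l, hl⟩ => hl ▸ hC ⟨l, rfl⟩⟩ ⟨_, 0, rfl⟩
    exact ⟨k, fun l => hk _ ⟨l, rfl⟩⟩
  have hanti : Antitone g := antitone_nat_of_succ_le fun l => by
    rw [hgs]
    have := mul_nonneg hd.le (h0 l (ix (t0+l)))
    linarith
  have hzero : ∀ l, k ≤ l → y l (ix (t0+l)) = 0 := by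
    intro l hl
    have h1 := hk (l+1)
    rw [hgs] at h1
    have h2 := hanti hl
    have h3 := h0 l (ix (t0+l))
    have h3 : 0 ≤ y l (ix (t0+l)) := h3
    nlinarith
  refine ⟨k, funext fun j => ?_⟩
  obtain ⟨h1, h2, h3⟩ := nxt_spec π (t0+k) j
  have hstab : ∀ e, t0 + k + e ≤ nxt π (t0+k) j → nxt π (t0+k+e) j = nxt π (t0+k) j ∧ y (k+e) j = y k j := by
    intro e
    induction e with
    | zero => simp
    | succ e ih =>
      intro he
      obtain ⟨i1, i2⟩ := ih (by omega)
      have hne : nxt π (t0+k+e) j ≠ t0+k+e := by omega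
      constructor
      · rw [← add_assoc, nxt, if_neg hne, i1]
      · rw [← add_assoc, hs, sr_apply_ne, i2]
        rintro rfl
        apply hne
        have := hix (t0 + (k+e))
        rw [← add_assoc] at this ⊢
        exact this
  obtain ⟨e, he⟩ := Nat.exists_eq_add_of_le h1
  obtain ⟨s1, s2⟩ := hstab e (by omega)
  have s3 := hzero (k+e) (by omega)
  have : ix (t0 + (k+e)) = j := by
    apply nxt_inj π (t0+(k+e))
    rw [hix, ← add_assoc, s1, he]
  rw [this, s2] at s3
  simpa using s3

lemma good_all (hb : BD b) (π : Fin n ≃ Fin n) : ∀ (K : ℕ) (δ : Fin n → ℤ), 0 ≤ δ → BB b δ δ = K → ∀ t, Good b (od π t) δ := by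
  rcases Nat.eq_zero_or_pos n with hn | hn
  · subst hn
    intro K δ _ _ t
    rw [Subsingleton.elim δ 0]; exact good_zero
  choose ix hix using nxt_ex π hn
  intro K
  induction K using Nat.strong_induction_on with
  | _ K ih =>
  intro δ h0 hK t
  by_contra hbad
  let y : ℕ → Fin n → ℤ := fun k => Nat.rec δ (fun k x => sr b (ix (t + k)) x) k
  have hys : ∀ k, y (k+1) = sr b (ix (t + k)) (y k) := fun k => rfl
  have hy : ∀ k, 0 ≤ y k ∧ BB b (y k) (y k) = K ∧ ¬ Good b (od π (t+k)) (y k) := by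
    intro k
    induction k with
    | zero => exact ⟨h0, hK, hbad⟩
    | succ k ihk =>
      obtain ⟨i1, i2, i3⟩ := ihk
      have st := od_stp π (t + k) _ (hix (t+k))
      rw [hys]
      refine ⟨?_, by rw [BB_sr hb, i2], fun hG => i3 (good_refl hb st _ i1 hG)⟩
      obtain ⟨i, hi⟩ : ∃ i, i = ix (t+k) := ⟨_, rfl⟩
      rw [← hi] at st ⊢
      intro j
      by_cases hj : j = i
      swap
      · rw [sr_apply_ne i j hj]; exact i1 j
      subst hj
      rw [sr_apply_self]
      by_contra hneg
      simp only [Pi.zero_apply, not_le] at hneg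
      apply i3
      obtain ⟨p, hp⟩ : ∃ p : ℕ, (p : ℤ) = BB b (y k) (ee j) - y k j := ⟨(BB b (y k) (ee j) - y k j).toNat, by omega⟩
      obtain ⟨δ', hδ'⟩ : ∃ δ', δ' = y k - (p:ℤ) • ee j := ⟨_, rfl⟩
      have hB := BB_ee b (y k) j
      have hNN : 0 ≤ ∑ l, y k l * b l j := Finset.sum_nonneg fun l _ => mul_nonneg (i1 l) (hb.nonneg l j)
      have hj' : δ' j = y k j - p := by simp [hδ', ee]
      have hge : 0 ≤ δ' := by
        intro l
        by_cases hl : l = j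
        · subst hl; rw [hj', hp]; simp only [Pi.zero_apply]; linarith
        · simp only [hδ', ee, Pi.sub_apply, Pi.smul_apply]
          rw [Pi.single_eq_of_ne hl]; simp; exact i1 l
      have hz : BB b δ' (ee j) = δ' j := by
        rw [hj', hδ']
        simp only [map_sub, map_smul, LinearMap.sub_apply, LinearMap.smul_apply, smul_eq_mul, BB_ee_ee hb]
        linarith
      have hyk : y k = δ' + (p:ℤ) • ee j := by simp [hδ']
      have hyk' : y k = δ' + p • ee j := by rw [hyk]; simp
      have hBlt : BB b δ' δ' < K := by
        rw [← i2, hyk]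
        simp only [map_add, map_smul, LinearMap.add_apply, LinearMap.smul_apply, smul_eq_mul, BB_ee_ee hb, BB_symm hb (ee j) δ', hz]
        have h1 := hge j
        simp only [Pi.zero_apply] at h1
        have : 0 < (p:ℤ) := by omega
        nlinarith [mul_nonneg this.le h1, mul_pos this this]
      have hBn := BB_nonneg hb δ'
      rw [hyk']
      exact good_add hb st δ' hz p (ih (BB b δ' δ').toNat (by omega) δ' hge (by omega) (t+k))
  obtain ⟨k, hk⟩ := exists_zero hb π ix hix t y (fun k => (hy k).1) hys
  apply (hy k).2.2
  rw [hk]; exact good_zero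

end PartE2
end MuInj

open MvPolynomial
open scoped Classical TensorProduct

namespace MuInj
open Equiv (Perm)
section PartE3
variable {n : ℕ}

/-- arrow multiplicities -/
noncomputable def am (Q : FinQuiver n) (i j : Fin n) : ℕ := (Finset.univ.filter (fun a : Q.Arr => Q.tl a = i ∧ Q.hd a = j)).card

lemma chi_apply (a : Fin n → Fin n → ℕ) (x y : Fin n → ℤ) :
    chi a x y = ∑ i, x i * y i - ∑ i, ∑ j, (a i j : ℤ) * (x i * y j) := by
  rw [chi, Matrix.toBilin'_apply, ← Finset.sum_sub_distrib]
  refine Finset.sum_congr rfl fun i _ => ?_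
  simp only [Matrix.of_apply, mul_sub, sub_mul, Finset.sum_sub_distrib]
  congr 1
  · simp
  · exact Finset.sum_congr rfl fun j _ => by ring

lemma am_sum (Q : FinQuiver n) (f : Fin n → Fin n → ℤ) :
    ∑ i, ∑ j, (am Q i j : ℤ) * f i j = ∑ a : Q.Arr, f (Q.tl a) (Q.hd a) := by
  have h : ∀ i j, (am Q i j : ℤ) * f i j = ∑ a : Q.Arr, if Q.tl a = i then (if Q.hd a = j then f i j else 0) else 0 := by
    intro i j
    rw [am, Finset.card_filter]
    push_cast
    rw [Finset.sum_mul]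
    refine Finset.sum_congr rfl fun a _ => ?_
    by_cases h1 : Q.tl a = i <;> by_cases h2 : Q.hd a = j <;> simp [h1, h2]
  simp only [h]
  have h2 : ∀ i, ∑ j, ∑ a : Q.Arr, (if Q.tl a = i then (if Q.hd a = j then f i j else 0) else 0)
     = ∑ a : Q.Arr, if Q.tl a = i then f i (Q.hd a) else 0 := by
    intro i
    rw [Finset.sum_comm]
    refine Finset.sum_congr rfl fun a _ => ?_
    split_ifs <;> simp
  simp only [h2]
  rw [Finset.sum_comm]
  simp

lemma chi_am (Q : FinQuiver n) (x y : Fin n → ℤ) :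
    chi (am Q) x y = ∑ i, x i * y i - ∑ a : Q.Arr, x (Q.tl a) * y (Q.hd a) := by
  rw [chi_apply, am_sum Q (fun i j => x i * y j)]

lemma chi_part {Q : FinQuiver n} (P : Subquiver Q) (hF : P.Full) (x y : Fin n → ℤ)
    (hx : ∀ i, i ∉ P.verts → x i = 0) (hy : ∀ i, i ∉ P.verts → y i = 0) : chi (am Q) x y = P.eulerZ x y := by
  rw [chi_am, Subquiver.eulerZ]
  congr 1
  · symm
    apply Finset.sum_subset (Finset.subset_univ _)
    intro i _ hi
    rw [hx i hi, zero_mul]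
  · symm
    apply Finset.sum_subset (Finset.subset_univ _)
    intro a _ ha
    by_cases h1 : Q.tl a ∈ P.verts
    · by_cases h2 : Q.hd a ∈ P.verts
      · exact absurd (hF a h2 h1) ha
      · rw [hy _ h2, mul_zero]
    · rw [hx _ h1, zero_mul]

lemma chain_of_trans (Q : FinQuiver n) {i k : Fin n} (h : Relation.TransGen (fun i k => ∃ a, Q.tl a = i ∧ Q.hd a = k) i k) :
    ∃ (m : ℕ) (c : Fin (m+1) → Q.Arr), (∀ q : Fin m, Q.hd (c q.castSucc) = Q.tl (c q.succ)) ∧ Q.tl (c 0) = i ∧ Q.hd (c (Fin.last m)) = k := by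
  induction h using Relation.TransGen.head_induction_on with
  | single h =>
    obtain ⟨a, h1, h2⟩ := h
    exact ⟨0, fun _ => a, fun q => q.elim0, h1, h2⟩
  | head h _ ih =>
    obtain ⟨a, h1, h2⟩ := h
    obtain ⟨m, c, c1, c2, c3⟩ := ih
    refine ⟨m+1, Fin.cons a c, ?_, by simpa using h1, ?_⟩
    · intro q
      refine Fin.cases ?_ (fun q => ?_) q
      · simp [h2, c2]
      · rw [← Fin.succ_castSucc, Fin.cons_succ, Fin.cons_succ]; exact c1 q
    · rw [← Fin.succ_last, Fin.cons_succ]; exact c3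

lemma exists_topo (Q : FinQuiver n) (hQ : Q.Acyclic) : ∃ π : Fin n ≃ Fin n, ∀ i k, am Q i k ≠ 0 → π i < π k := by
  let R : Fin n → Fin n → Prop := fun i k => ∃ a, Q.tl a = i ∧ Q.hd a = k
  let rk : Fin n → ℕ := fun i => (Finset.univ.filter (fun k => Relation.TransGen R k i)).card
  have hirr : ∀ i, ¬ Relation.TransGen R i i := by
    intro i h
    obtain ⟨m, c, c1, c2, c3⟩ := chain_of_trans Q h
    exact hQ m c c1 (c3.trans c2.symm)
  have hrk : ∀ i k, R i k → rk i < rk k := by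
    intro i k h
    apply Finset.card_lt_card
    rw [Finset.ssubset_iff_of_subset]
    · exact ⟨i, by simpa using Relation.TransGen.single h, by simpa using hirr i⟩
    · intro l hl
      simp only [Finset.mem_filter, Finset.mem_univ, true_and] at hl ⊢
      exact hl.tail h
  refine ⟨(Tuple.sort rk).symm, fun i k h => ?_⟩
  have hR : R i k := by
    obtain ⟨a, ha⟩ := Finset.card_ne_zero.1 h
    exact ⟨a, by simpa using ha⟩
  by_contra hle
  push Not at hle
  have := Tuple.monotone_sort rk hle
  simp only [Function.comp, Equiv.apply_symm_apply] at this
  have := hrk i k hR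
  omega

/-- symmetric matrix of a part -/
noncomputable def bm (Q : FinQuiver n) (I : Finset (Fin n)) (i k : Fin n) : ℤ :=
  if i ∈ I ∧ k ∈ I then (am Q i k : ℤ) + am Q k i else 0

lemma am_self (Q : FinQuiver n) (hQ : Q.Acyclic) (i : Fin n) : am Q i i = 0 := by
  obtain ⟨π, hπ⟩ := exists_topo Q hQ
  by_contra h
  exact lt_irrefl _ (hπ i i h)

lemma BB_bm (Q : FinQuiver n) (I : Finset (Fin n)) (x : Fin n → ℤ) :
    BB (bm Q I) x x = 2 * chi (am Q) (fun i => if i ∈ I then x i else 0) (fun i => if i ∈ I then x i else 0)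
      + 2 * ∑ i, if i ∈ I then 0 else x i ^ 2 := by
  obtain ⟨y, hy⟩ : ∃ y : Fin n → ℤ, y = fun i => if i ∈ I then x i else 0 := ⟨_, rfl⟩
  rw [← hy, BB_apply, chi_apply]
  have h1 : ∀ i k, x i * ((if i = k then 2 else 0) - bm Q I i k) * x k
    = (if i = k then 2 * (x i * x k) else 0) - ((am Q i k : ℤ) * (y i * y k) + (am Q k i : ℤ) * (y k * y i)) := by
    intro i k
    simp only [hy, bm]
    by_cases h1 : i ∈ I <;> by_cases h2 : k ∈ I <;> by_cases h3 : i = k <;> simp [h1, h2, h3] <;> ring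
  simp only [h1, Finset.sum_sub_distrib, Finset.sum_add_distrib]
  rw [Finset.sum_comm (f := fun i k => (am Q k i : ℤ) * (y k * y i))]
  simp only [Finset.sum_ite_eq, Finset.mem_univ, if_true]
  have h2 : ∑ i, 2 * (x i * x i) = 2 * ∑ i, y i * y i + 2 * ∑ i, (if i ∈ I then 0 else x i ^ 2) := by
    rw [← mul_add, ← Finset.sum_add_distrib, Finset.mul_sum]
    refine Finset.sum_congr rfl fun i _ => ?_
    simp only [hy]
    split_ifs <;> ring
  rw [h2]; ring

lemma bd_bm (Q : FinQuiver n) (hQ : Q.Acyclic) (P : Subquiver Q) (hF : P.Full) (hP : P.PosDefTits) : BD (bm Q P.verts) := by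
  refine ⟨?_, ?_, ?_, ?_⟩
  · intro i j; simp only [bm]; by_cases h1 : i ∈ P.verts <;> by_cases h2 : j ∈ P.verts <;> simp [h1, h2, add_comm]
  · intro i; simp [bm, am_self Q hQ]
  · intro i j; simp only [bm]; split_ifs <;> positivity
  · intro x hx
    rw [BB_bm]
    obtain ⟨y, hy⟩ : ∃ y : Fin n → ℤ, y = fun i => if i ∈ P.verts then x i else 0 := ⟨_, rfl⟩
    rw [← hy]
    have hys : ∀ i, i ∉ P.verts → y i = 0 := by intro i hi; simp [hy, hi]
    rw [chi_part P hF y y hys hys]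
    have hs : 0 ≤ ∑ i, (if i ∈ P.verts then 0 else x i ^ 2) := Finset.sum_nonneg fun i _ => by split_ifs <;> positivity
    by_cases h0 : y = 0
    · have : 0 < ∑ i, (if i ∈ P.verts then 0 else x i ^ 2) := by
        obtain ⟨i, hi⟩ := Function.ne_iff.1 hx
        have hi' : i ∉ P.verts := by
          intro h
          have := congrFun h0 i
          simp [hy, h] at this
          exact hi this
        refine Finset.sum_pos' (fun i _ => by split_ifs <;> positivity) ⟨i, Finset.mem_univ _, ?_⟩
        simp only [hi', if_false]
        have : x i ≠ 0 := hi
        positivity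
      rw [h0]; simp only [Subquiver.eulerZ]; simp; linarith
    · have := hP y hys h0
      linarith

lemma ch_bm (Q : FinQuiver n) (I : Finset (Fin n)) (π : Fin n ≃ Fin n) (hπ : ∀ i k, am Q i k ≠ 0 → π i < π k) (x y : Fin n → ℤ)
    (hx : ∀ i, i ∉ I → x i = 0) (hy : ∀ i, i ∉ I → y i = 0) : ch (bm Q I) (od π 0) x y = chi (am Q) x y := by
  rw [ch, chi, Matrix.toBilin'_apply, Matrix.toBilin'_apply]
  refine Finset.sum_congr rfl fun i _ => Finset.sum_congr rfl fun k _ => ?_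
  by_cases h1 : i ∈ I
  swap
  · simp [hx i h1]
  by_cases h2 : k ∈ I
  swap
  · simp [hy k h2]
  simp only [Matrix.of_apply, bm, h1, h2, and_self, if_true, od, nxt]
  congr 3
  by_cases h : (π i : ℕ) < π k
  · rw [if_pos h]
    have : am Q k i = 0 := by
      by_contra h'
      have := hπ _ _ h'
      rw [Fin.lt_def] at this
      omega
    simp [this]
  · rw [if_neg h]
    have : am Q i k = 0 := by
      by_contra h'
      exact h (hπ _ _ h')
    simp [this]

/-- cast of the roots -/
noncomputable def bh {r : ℕ} (β : Fin r → Fin n → ℕ) (u : ℕ) : Fin n → ℤ := if h : u < r then fun i => (β ⟨u, h⟩ i : ℤ) else 0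

theorem exists_dat {ℓ r : ℕ} (Q : FinQuiver n) (hQ : Q.Acyclic)
    (P : SubqPartition Q ℓ) (hDyn : P.Dynkin)
    (β : Fin r → Fin n → ℕ) (blk : Fin r → Fin ℓ) (hR : IsReinekeOrder P β blk) : Dat (am Q) (bh β) r := by
  obtain ⟨R1, R2, R3, R4, R5⟩ := hR
  have hval : ∀ u (h : u < r), bh β u = fun i => (β ⟨u, h⟩ i : ℤ) := fun u h => by rw [bh, dif_pos h]
  have hnn : ∀ u, 0 ≤ bh β u := by
    intro u i
    by_cases h : u < r
    · rw [hval u h]; simp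
    · simp [bh, h]
  have hsupp : ∀ u (h : u < r), ∀ i, i ∉ (P.part (blk ⟨u, h⟩)).verts → bh β u i = 0 := by
    intro u h i hi
    rw [hval u h]
    simp [(R2 ⟨u, h⟩).1 i hi]
  have hone : ∀ u, u < r → chi (am Q) (bh β u) (bh β u) = 1 := by
    intro u h
    rw [chi_part _ (hDyn (blk ⟨u, h⟩)).2.1 _ _ (hsupp u h) (hsupp u h), hval u h]
    exact (R2 ⟨u, h⟩).2.2
  have hinj : ∀ u w, u < r → w < r → bh β u = bh β w → u = w := by
    intro u w hu hw h
    rw [hval u hu, hval w hw] at h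
    have : β ⟨u, hu⟩ = β ⟨w, hw⟩ := by
      funext i
      have := congrFun h i
      exact_mod_cast this
    simpa using R3 this
  have hneg : ∀ u w, u < w → chi (am Q) (bh β u) (bh β w) ≤ 0 := by
    intro u w huw
    by_cases hw : w < r
    swap
    · simp [bh, hw]
    have hu : u < r := huw.trans hw
    by_cases hblk : blk ⟨u, hu⟩ = blk ⟨w, hw⟩
    · have h1 := R5 ⟨u, hu⟩ ⟨w, hw⟩ huw hblk
      have heu : ∀ u w (hu : u < r) (hw : w < r), Q.euler (β ⟨u, hu⟩) (β ⟨w, hw⟩) = chi (am Q) (bh β u) (bh β w) := by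
        intro u w hu hw
        rw [chi_am, hval u hu, hval w hw, FinQuiver.euler]
      rw [FinQuiver.lam, heu w u hw hu, heu u w hu hw] at h1
      have hs : ∀ i, i ∉ (P.part (blk ⟨u, hu⟩)).verts → (bh β u - bh β w) i = 0 := by
        intro i hi
        rw [Pi.sub_apply, hsupp u hu i hi, hsupp w hw i (hblk ▸ hi), sub_zero]
      have h2 := (hDyn (blk ⟨u, hu⟩)).2.2 (bh β u - bh β w) hs (by
        rw [sub_ne_zero]
        intro h
        have := hinj u w hu hw h
        omega)
      rw [← chi_part _ (hDyn (blk ⟨u, hu⟩)).2.1 _ _ hs hs] at h2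
      simp only [map_sub, LinearMap.sub_apply, hone u hu, hone w hw] at h2
      omega
    · rw [chi_am]
      have e1 : ∑ i, bh β u i * bh β w i = 0 := by
        refine Finset.sum_eq_zero fun i _ => ?_
        by_cases hi : i ∈ (P.part (blk ⟨u, hu⟩)).verts
        · rw [hsupp w hw i, mul_zero]
          intro hi'
          exact hblk ((P.cover i).unique hi hi')
        · rw [hsupp u hu i hi, zero_mul]
      have e2 : 0 ≤ ∑ a : Q.Arr, bh β u (Q.tl a) * bh β w (Q.hd a) :=
        Finset.sum_nonneg fun a _ => mul_nonneg (hnn _ _) (hnn _ _)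
      rw [e1]; linarith
  refine ⟨hnn, hneg, hone, ?_⟩
  intro u hu δ h0 hδ
  obtain ⟨π, hπ⟩ := exists_topo Q hQ
  obtain ⟨S, hS⟩ : ∃ S, S = P.part (blk ⟨u, hu⟩) := ⟨_, rfl⟩
  have hSD : S.IsDynkin := hS ▸ hDyn _
  have hb := bd_bm Q hQ S hSD.2.1 hSD.2.2
  have hBn := BB_nonneg hb δ
  obtain ⟨s, s1, s2, s3⟩ := good_all hb π (BB (bm Q S.verts) δ δ).toNat δ h0 (by omega) 0
  have hxs : ∀ x ∈ s, ∀ i, i ∉ S.verts → x i = 0 := by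
    intro x hx i hi
    have h1 := Multiset.single_le_sum (fun y hy => (s2 y hy).1) x hx i
    rw [s1] at h1
    have h2 := hδ i
    rw [hsupp u hu i (hS ▸ hi)] at h2
    have h3 := (s2 x hx).1 i
    simp only [Pi.zero_apply] at h3
    exact le_antisymm (h1.trans h2) h3
  have hroot : ∀ x ∈ s, ∃ w, w < r ∧ bh β w = x := by
    intro x hx
    have hx0 := (s2 x hx).1
    have hxe : (fun i => ((x i).toNat : ℤ)) = x := by
      funext i
      have := hx0 i
      simp only [Pi.zero_apply] at this
      simp [this]
    have h2 := (s2 x hx).2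
    obtain ⟨w, hw⟩ := R4 (blk ⟨u, hu⟩) (fun i => (x i).toNat) (by
      rw [← hS]
      refine ⟨fun i hi => by simp [hxs x hx i hi], ?_, ?_⟩
      · intro h
        have : x = 0 := by
          rw [← hxe]
          funext i
          have := congrFun h i
          simp only [Pi.zero_apply] at this
          simp only [this]; rfl
        rw [this] at h2
        simp at h2
      · rw [hxe, ← chi_part S hSD.2.1 _ _ (hxs x hx) (hxs x hx)]
        rw [BB_bm] at h2
        have e1 : (fun i => if i ∈ S.verts then x i else 0) = x := by
          funext i
          split_ifs with h
          · rfl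
          · exact (hxs x hx i h).symm
        have e2 : ∑ i, (if i ∈ S.verts then 0 else x i ^ 2) = 0 := by
          refine Finset.sum_eq_zero fun i _ => ?_
          split_ifs with h
          · rfl
          · simp [hxs x hx i h]
        rw [e1, e2] at h2
        omega)
    refine ⟨w, w.2, ?_⟩
    rw [hval w w.2]
    show (fun i => (β w i : ℤ)) = x
    rw [hw]; exact hxe
  refine ⟨fun w => if w < r then s.count (bh β w) else 0, ?_, ?_, ?_⟩
  · have hsub : s.toFinset ⊆ (Finset.range r).image (bh β) := by
      intro x hx
      obtain ⟨w, hw, rfl⟩ := hroot x (Multiset.mem_toFinset.1 hx)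
      exact Finset.mem_image_of_mem _ (Finset.mem_range.2 hw)
    have := Finset.sum_multiset_count_of_subset s _ hsub
    rw [s1, Finset.sum_image] at this
    · rw [this]
      refine Finset.sum_congr rfl fun w hw => ?_
      simp [Finset.mem_range.1 hw]
    · intro x hx y hy h
      exact hinj x y (by simpa using hx) (by simpa using hy) h
  · intro u' w' h1 h2 h3
    have hmem : ∀ w, (if w < r then s.count (bh β w) else 0) ≠ 0 → bh β w ∈ s := by
      intro w h
      split_ifs at h with h'
      · exact Multiset.count_ne_zero.1 h
      · exact absurd rfl h
    have hu' := hmem u' h2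
    have hw' := hmem w' h3
    have := s3 _ hu' _ hw'
    rw [ch_bm Q S.verts π hπ _ _ (hxs _ hu') (hxs _ hw')] at this
    exact le_antisymm (hneg u' w' h1) this
  · intro w hw
    exact if_neg (by omega)

end PartE3
end MuInj

open MvPolynomial
open scoped Classical TensorProduct

namespace MuInj
open Equiv (Perm)
section PartF1
variable {N n M : ℕ}

/-- layout of variables -/
structure Lay (pos : Fin N → Fin n × ℕ) (M : ℕ) : Prop where
  inj : Function.Injective pos
  lt : ∀ x, (pos x).2 < M
  surj : ∀ i j, j < M → ∃ x, pos x = (i, j)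
  ord : ∀ x y, (pos x).1 = (pos y).1 → (x < y ↔ (pos x).2 < (pos y).2)

lemma exists_lay (n M : ℕ) : ∃ pos : Fin (n * M) → Fin n × ℕ, Lay pos M := by
  refine ⟨fun x => ((finProdFinEquiv.symm x).1, ((finProdFinEquiv.symm x).2 : ℕ)), ?_, ?_, ?_, ?_⟩
  · intro x y h
    apply finProdFinEquiv.symm.injective
    simp only [Prod.mk.injEq] at h
    exact Prod.ext h.1 (Fin.ext h.2)
  · intro x; exact (finProdFinEquiv.symm x).2.2
  · intro i j hj
    exact ⟨finProdFinEquiv (i, ⟨j, hj⟩), by simp⟩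
  · intro x y h
    obtain ⟨⟨i, j⟩, rfl⟩ := finProdFinEquiv.surjective x
    obtain ⟨⟨i', j'⟩, rfl⟩ := finProdFinEquiv.surjective y
    simp only [Equiv.symm_apply_apply] at h ⊢
    subst h
    rw [Fin.lt_def]
    simp [finProdFinEquiv_apply_val]

/-- restriction to the variables in A -/
noncomputable def rho (A : Finset (Fin N)) : MvPolynomial (Fin N) ℚ →ₐ[ℚ] MvPolynomial (Fin N) ℚ :=
  aeval fun x => if x ∈ A then X x else 0

/-- supported on A -/
def Sup (A : Finset (Fin N)) (f : MvPolynomial (Fin N) ℚ) : Prop := rho A f = f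

lemma Sup.mul {A : Finset (Fin N)} {f g : MvPolynomial (Fin N) ℚ} (hf : Sup A f) (hg : Sup A g) : Sup A (f * g) := by
  rw [Sup, map_mul, hf, hg]

lemma Sup.mono {A B : Finset (Fin N)} (h : A ⊆ B) {f : MvPolynomial (Fin N) ℚ} (hf : Sup A f) : Sup B f := by
  have : (rho B).comp (rho A) = rho A := by
    apply MvPolynomial.algHom_ext
    intro x
    simp only [rho, AlgHom.comp_apply, aeval_X]
    split_ifs with h1
    · simp [h h1]
    · simp
  have h2 := DFunLike.congr_fun this f
  rw [AlgHom.comp_apply, hf] at h2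
  exact h2

lemma Sup_PP {A : Finset (Fin N)} (e : Fin N → Fin N → ℕ) (he : ∀ x y, e x y ≠ 0 → x ∈ A ∧ y ∈ A) : Sup A (PP e) := by
  rw [Sup, rho, aeval_PP, PP]
  refine Finset.prod_congr rfl fun x _ => Finset.prod_congr rfl fun y _ => ?_
  by_cases h : e x y = 0
  · simp [h]
  · simp [he x y h]

lemma Sup_rename {A : Finset (Fin N)} {σ : Perm (Fin N)} (hσ : ∀ x, σ x ∈ A ↔ x ∈ A) {f : MvPolynomial (Fin N) ℚ} (hf : Sup A f) :
    Sup A (rename σ f) := by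
  have : (rho A).comp (rename σ) = (rename σ).comp (rho A) := by
    apply MvPolynomial.algHom_ext
    intro x
    simp only [rho, AlgHom.comp_apply, aeval_X, rename_X, hσ]
    split_ifs <;> simp
  have h2 := DFunLike.congr_fun this f
  rw [AlgHom.comp_apply, AlgHom.comp_apply, hf] at h2
  exact h2

lemma Sup_Alt {A : Finset (Fin N)} {K : Type*} (f : Fin N → K) {h : MvPolynomial (Fin N) ℚ} (hh : Sup A h) : Sup A (Alt (Sd A f) h) := by
  rw [Sup, Alt_apply, map_sum]
  refine Finset.sum_congr rfl fun σ hσ => ?_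
  rw [map_mul, Sup_rename (W_Sd hσ).1 hh]
  rw [sg, map_intCast]

lemma Sup_Van {A : Finset (Fin N)} {K : Type*} (f : Fin N → K) : Sup A (Van (Sd A f)) := by
  apply Sup_PP
  intro x y h
  simp only [ne_eq, ite_eq_right_iff, Classical.not_imp] at h
  rcases h.1.2 with h' | h'
  · exact absurd h' h.1.1.ne
  · exact ⟨h'.1, h'.2.1⟩

lemma hom_eq_of_Sup {A : Finset (Fin N)} {f : MvPolynomial (Fin N) ℚ} (hf : Sup A f) {S : Type*} [CommRing S] [Algebra ℚ S]
    (φ ψ : MvPolynomial (Fin N) ℚ →ₐ[ℚ] S) (h : ∀ x ∈ A, φ (X x) = ψ (X x)) : φ f = ψ f := by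
  have : φ.comp (rho A) = ψ.comp (rho A) := by
    apply MvPolynomial.algHom_ext
    intro x
    simp only [rho, AlgHom.comp_apply, aeval_X]
    split_ifs with h1
    · exact h x h1
    · simp
  have h2 := DFunLike.congr_fun this f
  rw [AlgHom.comp_apply, AlgHom.comp_apply, hf] at h2
  exact h2

lemma Inv_of_Alt {s : Setoid (Fin N)} {c : ℚ} (hc : c ≠ 0) {P h : MvPolynomial (Fin N) ℚ} (hP : C c * Van s * P = Alt s h) : Inv s P := by
  intro σ hσ
  have h1 := rename_Alt hσ h
  rw [← hP, map_mul, map_mul, rename_C, Van_anti s σ hσ] at h1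
  have hs : sg σ ≠ 0 := by rcases sg_eq σ with h | h <;> simp [h]
  have hne : C c * (sg σ * Van s) ≠ 0 := mul_ne_zero (by simpa using hc) (mul_ne_zero hs (Van_ne_zero s))
  apply mul_left_cancel₀ hne
  rw [h1]; ring

lemma Sup_of_Alt {A : Finset (Fin N)} {K : Type*} {f : Fin N → K} {c : ℚ} (hc : c ≠ 0) {P h : MvPolynomial (Fin N) ℚ} (hP : C c * Van (Sd A f) * P = Alt (Sd A f) h)
    (hh : Sup A h) : Sup A P := by
  have h1 := Sup_Alt f hh
  rw [← hP] at h1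
  rw [Sup, map_mul, map_mul, Sup_Van f] at h1
  have hC : rho A (C c) = C c := by simp [rho]
  rw [hC] at h1
  exact mul_left_cancel₀ (mul_ne_zero (by simpa using hc) (Van_ne_zero _)) h1

lemma Inv_of_Sup {A : Finset (Fin N)} {v : Fin N → Fin n} {f : MvPolynomial (Fin N) ℚ} (hf : Sup A f) (hi : Inv (Sd A v) f) (σ : Perm (Fin N))
    (h1 : ∀ x, σ x ∈ A ↔ x ∈ A) (h2 : ∀ x, v (σ x) = v x) : rename σ f = f := by
  let τ : Perm (Fin N) := Equiv.Perm.ofSubtype (σ.subtypePerm h1)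
  have hτ : ∀ x ∈ A, τ x = σ x := by
    intro x hx
    simp only [τ]
    rw [Equiv.Perm.ofSubtype_apply_of_mem _ hx]; rfl
  have hτ' : ∀ x, x ∉ A → τ x = x := by
    intro x hx
    exact Equiv.Perm.ofSubtype_apply_of_not_mem _ hx
  have hm : τ ∈ W (Sd A v) := by
    rw [mem_W]
    intro x
    by_cases hx : x ∈ A
    · rw [hτ x hx]; exact Or.inr ⟨hx, (h1 x).2 hx, (h2 x).symm⟩
    · rw [hτ' x hx]
  have h3 := hom_eq_of_Sup hf (rename σ) (rename τ) (fun x hx => by simp [hτ x hx])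
  rw [h3]
  exact hi τ hm

lemma hom_congr_H {γ : Fin n → ℕ} {f : PolyQ n} (hf : f ∈ Hspace γ) {S : Type*} [CommRing S] [Algebra ℚ S]
    (φ ψ : PolyQ n →ₐ[ℚ] S) (h : ∀ i j, j < γ i → φ (X (i, j)) = ψ (X (i, j))) : φ f = ψ f := by
  have : (φ : PolyQ n →+* S) f = (ψ : PolyQ n →+* S) f := by
    refine hom_congr_vars (by ext; simp) ?_ rfl
    intro q hq _
    exact h q.1 q.2 (hf.1 q hq)
  exact this

lemma symm_T (γ : Fin n → ℕ) (f : PolyQ n) (hf : f ∈ Hspace γ) (T : Fin n → ℕ → ℕ) (hT : ∀ i j, j < γ i → T i j < γ i)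
    (hi : ∀ i j j', j < γ i → j' < γ i → T i j = T i j' → j = j') :
    rename (fun q : Fin n × ℕ => (q.1, T q.1 q.2)) f = f := by
  have hsurj : ∀ i, (Finset.range (γ i)).image (T i) = Finset.range (γ i) := by
    intro i
    apply Finset.eq_of_subset_of_card_le
    · intro j hj
      obtain ⟨k, hk, rfl⟩ := Finset.mem_image.1 hj
      exact Finset.mem_range.2 (hT i k (Finset.mem_range.1 hk))
    · rw [Finset.card_image_of_injOn]
      intro j hj j' hj' h
      exact hi i j j' (by simpa using hj) (by simpa using hj') h
  have hbij : ∀ i, Function.Bijective (fun j => if j < γ i then T i j else j) := by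
    intro i
    constructor
    · intro j j' h
      simp only at h
      split_ifs at h with h1 h2 h2
      · exact hi i j j' h1 h2 h
      · have := hT i j h1; omega
      · have := hT i j' h2; omega
      · exact h
    · intro j
      by_cases hj : j < γ i
      · have : j ∈ (Finset.range (γ i)).image (T i) := by rw [hsurj]; simpa using hj
        obtain ⟨k, hk, rfl⟩ := Finset.mem_image.1 this
        exact ⟨k, by simp [Finset.mem_range.1 hk]⟩
      · exact ⟨j, by simp [hj]⟩
  let τ : Fin n → Perm ℕ := fun i => Equiv.ofBijective _ (hbij i)
  have hτ : ∀ i j, j < γ i → τ i j = T i j := fun i j h => by simp [τ, h]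
  have hτ' : ∀ i j, τ i j ≠ j → j < γ i := fun i j h => by
    by_contra h'
    exact h (by simp [τ, h'])
  have key : ∀ s : Finset (Fin n), rename (fun q : Fin n × ℕ => if q.1 ∈ s then (q.1, τ q.1 q.2) else q) f = f := by
    intro s
    induction s using Finset.induction_on with
    | empty => 
      have h0 : (fun q : Fin n × ℕ => if q.1 ∈ (∅ : Finset (Fin n)) then (q.1, τ q.1 q.2) else q) = id := by
        funext q; simp
      rw [h0, rename_id_apply]
    | insert i s his ih =>
      have : (fun q : Fin n × ℕ => if q.1 ∈ insert i s then (q.1, τ q.1 q.2) else q)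
          = (vertexPerm i (τ i)) ∘ (fun q : Fin n × ℕ => if q.1 ∈ s then (q.1, τ q.1 q.2) else q) := by
        funext q
        obtain ⟨k, j⟩ := q
        simp only [Function.comp, vertexPerm, Finset.mem_insert]
        by_cases h1 : k = i
        · subst h1; simp [his]
        · by_cases h2 : k ∈ s <;> simp [h1, h2]
      rw [this, ← rename_rename, ih]
      exact hf.2 i (τ i) (hτ' i)
  have h1 := key Finset.univ
  conv_rhs => rw [← h1]
  exact hom_congr_H hf (rename _) (rename _) (fun i j hj => by simp [hτ i j hj])

variable (pos : Fin N → Fin n × ℕ)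

/-- variable at a position, pulled back -/
noncomputable def bX (q : Fin n × ℕ) : MvPolynomial (Fin N) ℚ := if h : ∃ x, pos x = q then X h.choose else 0

/-- shifted pull back -/
noncomputable def Fsh (s : Fin n → ℕ) : PolyQ n →ₐ[ℚ] MvPolynomial (Fin N) ℚ :=
  aeval fun q => bX pos (q.1, q.2 + s q.1)

variable {pos}

lemma bX_pos (hL : Lay pos M) (x : Fin N) : bX pos (pos x) = X x := by
  have h : ∃ y, pos y = pos x := ⟨x, rfl⟩
  rw [bX, dif_pos h, hL.inj h.choose_spec]

lemma Fsh_Sup (hL : Lay pos M) {γ s : Fin n → ℕ} (hM : ∀ i, s i + γ i ≤ M) {f : PolyQ n} (hf : f ∈ Hspace γ) (B : Finset (Fin N))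
    (hB : ∀ x, s (pos x).1 ≤ (pos x).2 → (pos x).2 < s (pos x).1 + γ (pos x).1 → x ∈ B) : Sup B (Fsh pos s f) := by
  refine hom_congr_H hf ((rho B).comp (Fsh pos s)) (Fsh pos s) ?_
  intro i j hj
  obtain ⟨x, hx⟩ := hL.surj i (j + s i) (by have := hM i; omega)
  simp only [AlgHom.comp_apply, Fsh, aeval_X]
  rw [← hx, bX_pos hL, rho, aeval_X, if_pos]
  apply hB <;> rw [hx] <;> simp <;> omega

lemma Fsh_inv (hL : Lay pos M) {γ s : Fin n → ℕ} (hM : ∀ i, s i + γ i ≤ M) {f : PolyQ n} (hf : f ∈ Hspace γ) (σ : Perm (Fin N))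
    (h1 : ∀ x, (pos (σ x)).1 = (pos x).1)
    (h2 : ∀ x, s (pos x).1 ≤ (pos x).2 → (pos x).2 < s (pos x).1 + γ (pos x).1 →
      s (pos x).1 ≤ (pos (σ x)).2 ∧ (pos (σ x)).2 < s (pos x).1 + γ (pos x).1) : rename σ (Fsh pos s f) = Fsh pos s f := by
  obtain ⟨T, hT⟩ : ∃ T : Fin n → ℕ → ℕ, ∀ x j, pos x = ((pos x).1, j + s (pos x).1) →
      T (pos x).1 j = (pos (σ x)).2 - s (pos x).1 := by
    refine ⟨fun i j => if h : ∃ x, pos x = (i, j + s i) then (pos (σ h.choose)).2 - s i else 0, ?_⟩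
    intro x j hx
    have h : ∃ y, pos y = ((pos x).1, j + s (pos x).1) := ⟨x, hx⟩
    have h' : h.choose = x := hL.inj (h.choose_spec.trans hx.symm)
    simp only [dif_pos h, h']
  have hx : ∀ i j, j < γ i → ∃ x, pos x = (i, j + s i) ∧ pos (σ x) = (i, T i j + s i) ∧ T i j < γ i := by
    intro i j hj
    obtain ⟨x, hx⟩ := hL.surj i (j + s i) (by have := hM i; omega)
    have e1 : (pos x).1 = i := by rw [hx]
    have e2 : (pos x).2 = j + s i := by rw [hx]
    have h3 := hT x j (by rw [e1]; exact hx)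
    have h4 := h2 x (by rw [e1, e2]; omega) (by rw [e1, e2]; omega)
    rw [e1] at h3 h4
    refine ⟨x, hx, ?_, by omega⟩
    apply Prod.ext
    · simp [h1 x, e1]
    · simp only; omega
  have h3 : rename σ (Fsh pos s f) = Fsh pos s (rename (fun q : Fin n × ℕ => (q.1, T q.1 q.2)) f) := by
    have h5 := hom_congr_H hf ((rename σ).comp (Fsh pos s)) ((Fsh pos s).comp (rename (fun q : Fin n × ℕ => (q.1, T q.1 q.2)))) ?_
    · rw [AlgHom.comp_apply, AlgHom.comp_apply] at h5
      exact h5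
    intro i j hj
    obtain ⟨x, e1, e2, e3⟩ := hx i j hj
    simp only [AlgHom.comp_apply, Fsh, aeval_X, rename_X]
    rw [← e1, ← e2, bX_pos hL, bX_pos hL, rename_X]
  rw [h3, symm_T γ f hf T]
  · intro i j hj
    obtain ⟨x, e1, e2, e3⟩ := hx i j hj
    exact e3
  · intro i j j' hj hj' h
    obtain ⟨x, e1, e2, e3⟩ := hx i j hj
    obtain ⟨x', e1', e2', e3'⟩ := hx i j' hj'
    have : x = x' := σ.injective (hL.inj (by rw [e2, e2', h]))
    subst this
    rw [e1] at e1'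
    simpa using e1'

end PartF1
end MuInj

open MvPolynomial
open scoped Classical TensorProduct

namespace MuInj
open Equiv (Perm)
section PartF2
variable {N n M : ℕ} {pos : Fin N → Fin n × ℕ}

lemma getD_mem (T : Finset ℕ) (k : ℕ) (hk : k < T.card) : (T.sort (· ≤ ·)).getD k 0 ∈ T := by
  have hk' : k < (T.sort (· ≤ ·)).length := by rw [Finset.length_sort]; exact hk
  rw [List.getD_eq_getElem _ _ hk']
  exact (Finset.mem_sort _).1 (List.getElem_mem hk')

lemma getD_inj (T : Finset ℕ) (k k' : ℕ) (hk : k < T.card) (hk' : k' < T.card)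
    (h : (T.sort (· ≤ ·)).getD k 0 = (T.sort (· ≤ ·)).getD k' 0) : k = k' := by
  have hk1 : k < (T.sort (· ≤ ·)).length := by rw [Finset.length_sort]; exact hk
  have hk2 : k' < (T.sort (· ≤ ·)).length := by rw [Finset.length_sort]; exact hk'
  rw [List.getD_eq_getElem _ _ hk1, List.getD_eq_getElem _ _ hk2] at h
  exact ((Finset.sort_nodup _ _).getElem_inj_iff).1 h

lemma reidx (hL : Lay pos M) (T : Finset ℕ) (hT : T ⊆ Finset.range M) (i : Fin n) {S : Type*} [CommMonoid S] (g : Fin n × ℕ → S) :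
    ∏ j ∈ T, g (i, j) = ∏ x, if (pos x).1 = i ∧ (pos x).2 ∈ T then g (pos x) else 1 := by
  rw [← Finset.prod_filter]
  symm
  refine Finset.prod_bij (fun x _ => (pos x).2) ?_ ?_ ?_ ?_
  · intro x hx; exact (Finset.mem_filter.1 hx).2.2
  · intro x hx y hy h
    apply hL.inj
    exact Prod.ext ((Finset.mem_filter.1 hx).2.1.trans (Finset.mem_filter.1 hy).2.1.symm) h
  · intro j hj
    obtain ⟨x, hx⟩ := hL.surj i j (Finset.mem_range.1 (hT hj))
    exact ⟨x, by simp [hx, hj], by simp [hx]⟩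
  · intro x hx
    rw [← (Finset.mem_filter.1 hx).2.1]

lemma num_eq (hL : Lay pos M) (Q : FinQuiver n) (S S' : Fin n → Finset ℕ) (hS : ∀ i, S i ⊆ Finset.range M)
    (hS' : ∀ i, S' i ⊆ Finset.range M) :
    ∏ a : Q.Arr, ∏ j' ∈ S' (Q.hd a), ∏ j ∈ S (Q.tl a), ((X (Q.hd a, j') - X (Q.tl a, j) : PolyQ n)) =
    rename pos (PP (fun x y => if (pos x).2 ∈ S (pos x).1 ∧ (pos y).2 ∈ S' (pos y).1 then am Q (pos x).1 (pos y).1 else 0)) := by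
  have h1 : ∀ a : Q.Arr, ∏ j' ∈ S' (Q.hd a), ∏ j ∈ S (Q.tl a), ((X (Q.hd a, j') - X (Q.tl a, j) : PolyQ n)) =
      ∏ x, ∏ y, if (Q.tl a = (pos x).1 ∧ Q.hd a = (pos y).1) ∧ ((pos x).2 ∈ S (pos x).1 ∧ (pos y).2 ∈ S' (pos y).1) then
        (X (pos y) - X (pos x) : PolyQ n) else 1 := by
    intro a
    rw [reidx hL _ (hS' _) (Q.hd a) (fun q => ∏ j ∈ S (Q.tl a), ((X q - X (Q.tl a, j) : PolyQ n))), Finset.prod_comm]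
    refine Finset.prod_congr rfl fun y _ => ?_
    rw [reidx hL _ (hS _) (Q.tl a) (fun q => ((X (pos y) - X q : PolyQ n)))]
    split_ifs with h
    · refine Finset.prod_congr rfl fun x _ => ?_
      congr 1
      obtain ⟨h1, h2⟩ := h
      simp only [eq_iff_iff]
      constructor
      · rintro ⟨h3, h4⟩
        exact ⟨⟨h3.symm, h1.symm⟩, by rw [h3]; exact h4, by rw [h1]; exact h2⟩
      · rintro ⟨⟨h3, h4⟩, h5, h6⟩
        exact ⟨h3.symm, by rw [h3]; exact h5⟩
    · symm
      apply Finset.prod_eq_one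
      intro x _
      rw [if_neg]
      rintro ⟨⟨h3, h4⟩, h5, h6⟩
      exact h ⟨h4.symm, by rw [h4]; exact h6⟩
  rw [Finset.prod_congr rfl fun a _ => h1 a, PP, map_prod, Finset.prod_comm]
  refine Finset.prod_congr rfl fun x _ => ?_
  rw [map_prod, Finset.prod_comm]
  refine Finset.prod_congr rfl fun y _ => ?_
  rw [map_pow, map_sub, rename_X, rename_X]
  by_cases h : (pos x).2 ∈ S (pos x).1 ∧ (pos y).2 ∈ S' (pos y).1
  · simp only [h, and_true, am, if_true]
    rw [← Finset.prod_filter, Finset.prod_const]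
  · simp [h]

/-- initial segment -/
noncomputable def A2 (pos : Fin N → Fin n × ℕ) (γ : Fin n → ℕ) : Finset (Fin N) :=
  Finset.univ.filter fun x => (pos x).2 < γ (pos x).1

lemma mem_A2 {γ : Fin n → ℕ} {x : Fin N} : x ∈ A2 pos γ ↔ (pos x).2 < γ (pos x).1 := by simp [A2]

/-- two block level function -/
noncomputable def p2 (pos : Fin N → Fin n × ℕ) (γ : Fin n → ℕ) (x : Fin N) : ℕ :=
  if (pos x).2 < γ (pos x).1 then 0 else 1

/-- fiber predicate -/
def Fib (pos : Fin N → Fin n × ℕ) (γ₁ γ₂ : Fin n → ℕ) (S : Fin n → Finset ℕ) (σ : Perm (Fin N)) : Prop :=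
  σ ∈ W (Sd (A2 pos (γ₁ + γ₂)) (fun x => (pos x).1)) ∧
    ∀ x ∈ A2 pos (γ₁ + γ₂), (x ∈ A2 pos γ₁ ↔ (pos (σ x)).2 ∈ S (pos x).1)

lemma mem_shuf {γ₁ γ₂ : Fin n → ℕ} {S : Fin n → Finset ℕ} : S ∈ shuffles γ₁ γ₂ ↔
    ∀ i, S i ⊆ Finset.range (γ₁ i + γ₂ i) ∧ (S i).card = γ₁ i := by
  simp [shuffles, Fintype.mem_piFinset]

lemma card_A2 (hL : Lay pos M) {γ : Fin n → ℕ} (hM : ∀ i, γ i ≤ M) (i : Fin n) :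
    ((A2 pos γ).filter (fun x => (pos x).1 = i)).card = γ i := by
  conv_rhs => rw [← Finset.card_range (γ i)]
  refine Finset.card_bij (fun x _ => (pos x).2) ?_ ?_ ?_
  · intro x hx
    rw [Finset.mem_filter, mem_A2] at hx
    rw [Finset.mem_range, ← hx.2]; exact hx.1
  · intro x hx y hy h
    rw [Finset.mem_filter] at hx hy
    exact hL.inj (Prod.ext (hx.2.trans hy.2.symm) h)
  · intro j hj
    rw [Finset.mem_range] at hj
    obtain ⟨x, hx⟩ := hL.surj i j (by have := hM i; omega)
    exact ⟨x, by simp [mem_A2, hx, hj], by simp [hx]⟩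

lemma Fib_exists (hL : Lay pos M) {γ₁ γ₂ : Fin n → ℕ} (hM : ∀ i, γ₁ i + γ₂ i ≤ M) {S : Fin n → Finset ℕ} (hS : S ∈ shuffles γ₁ γ₂) :
    ∃ w, Fib pos γ₁ γ₂ S w ∧ (∀ x ∈ A2 pos γ₁, pos (w x) = ((pos x).1, ((S (pos x).1).sort (· ≤ ·)).getD (pos x).2 0)) ∧
      (∀ x ∈ A2 pos (γ₁ + γ₂), x ∉ A2 pos γ₁ → pos (w x) = ((pos x).1, ((shuffleCompl γ₁ γ₂ S (pos x).1).sort (· ≤ ·)).getD ((pos x).2 - γ₁ (pos x).1) 0)) := by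
  rw [mem_shuf] at hS
  have hc : ∀ i, (shuffleCompl γ₁ γ₂ S i).card = γ₂ i := by
    intro i
    rw [shuffleCompl, Finset.card_sdiff_of_subset (hS i).1, (hS i).2, Finset.card_range]; omega
  let φ : Fin N → ℕ := fun x => if (pos x).2 < γ₁ (pos x).1 then ((S (pos x).1).sort (· ≤ ·)).getD (pos x).2 0 else
    if (pos x).2 < γ₁ (pos x).1 + γ₂ (pos x).1 then ((shuffleCompl γ₁ γ₂ S (pos x).1).sort (· ≤ ·)).getD ((pos x).2 - γ₁ (pos x).1) 0 else (pos x).2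
  have φ1 : ∀ x, (pos x).2 < γ₁ (pos x).1 → φ x = ((S (pos x).1).sort (· ≤ ·)).getD (pos x).2 0 ∧ φ x ∈ S (pos x).1 := by
    intro x h
    have : φ x = ((S (pos x).1).sort (· ≤ ·)).getD (pos x).2 0 := by simp only [φ, if_pos h]
    exact ⟨this, this ▸ getD_mem _ _ (by rw [(hS _).2]; exact h)⟩
  have φ2 : ∀ x, ¬ (pos x).2 < γ₁ (pos x).1 → (pos x).2 < γ₁ (pos x).1 + γ₂ (pos x).1 →
      φ x = ((shuffleCompl γ₁ γ₂ S (pos x).1).sort (· ≤ ·)).getD ((pos x).2 - γ₁ (pos x).1) 0 ∧ φ x ∈ shuffleCompl γ₁ γ₂ S (pos x).1 := by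
    intro x h h'
    have : φ x = ((shuffleCompl γ₁ γ₂ S (pos x).1).sort (· ≤ ·)).getD ((pos x).2 - γ₁ (pos x).1) 0 := by simp only [φ, if_neg h, if_pos h']
    exact ⟨this, this ▸ getD_mem _ _ (by rw [hc]; omega)⟩
  have φ3 : ∀ x, ¬ (pos x).2 < γ₁ (pos x).1 + γ₂ (pos x).1 → φ x = (pos x).2 := by
    intro x h
    have h' : ¬ (pos x).2 < γ₁ (pos x).1 := by omega
    simp only [φ, if_neg h, if_neg h']
  have hS1 : ∀ i j, j ∈ S i → j < γ₁ i + γ₂ i := fun i j h => Finset.mem_range.1 ((hS i).1 h)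
  have hS2 : ∀ i j, j ∈ shuffleCompl γ₁ γ₂ S i → j < γ₁ i + γ₂ i ∧ j ∉ S i := fun i j h => by
    simpa [shuffleCompl] using h
  clear_value φ
  have hφM : ∀ x, ∃ y, pos y = ((pos x).1, φ x) := by
    intro x
    apply hL.surj
    by_cases h1 : (pos x).2 < γ₁ (pos x).1
    · have := hS1 _ _ (φ1 x h1).2
      have := hM (pos x).1; omega
    · by_cases h2 : (pos x).2 < γ₁ (pos x).1 + γ₂ (pos x).1
      · have := (hS2 _ _ (φ2 x h1 h2).2).1
        have := hM (pos x).1; omega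
      · rw [φ3 x h2]; exact hL.lt x
  choose w hw using hφM
  have hinj : Function.Injective w := by
    intro x y h
    have h' : ((pos x).1, φ x) = ((pos y).1, φ y) := by rw [← hw, ← hw, h]
    rw [Prod.mk.injEq] at h'
    obtain ⟨h1, h2⟩ := h'
    apply hL.inj
    refine Prod.ext h1 ?_
    have X1 := φ1 x
    have X2 := φ2 x
    have X3 := φ3 x
    have Y1 := φ1 y
    have Y2 := φ2 y
    have Y3 := φ3 y
    rw [← h1, ← h2] at Y1 Y2 Y3
    have Z1 := hS1 (pos x).1 (φ x)
    have Z2 := hS2 (pos x).1 (φ x)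
    have C1 := getD_inj (S (pos x).1) (pos x).2 (pos y).2
    have C2 := getD_inj (shuffleCompl γ₁ γ₂ S (pos x).1) ((pos x).2 - γ₁ (pos x).1) ((pos y).2 - γ₁ (pos x).1)
    rw [(hS _).2] at C1
    rw [hc] at C2
    by_cases a1 : (pos x).2 < γ₁ (pos x).1 <;> by_cases b1 : (pos y).2 < γ₁ (pos x).1
    · exact C1 a1 b1 ((X1 a1).1.symm.trans (Y1 b1).1)
    · by_cases b2 : (pos y).2 < γ₁ (pos x).1 + γ₂ (pos x).1
      · exact absurd (X1 a1).2 (Z2 (Y2 b1 b2).2).2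
      · have := Y3 b2; have := Z1 (X1 a1).2; omega
    · by_cases a2 : (pos x).2 < γ₁ (pos x).1 + γ₂ (pos x).1
      · exact absurd (Y1 b1).2 (Z2 (X2 a1 a2).2).2
      · have := X3 a2; have := Z1 (Y1 b1).2; omega
    · by_cases a2 : (pos x).2 < γ₁ (pos x).1 + γ₂ (pos x).1 <;> by_cases b2 : (pos y).2 < γ₁ (pos x).1 + γ₂ (pos x).1
      · have := C2 (by omega) (by omega) ((X2 a1 a2).1.symm.trans (Y2 b1 b2).1)
        omega
      · have := Y3 b2; have := (Z2 (X2 a1 a2).2).1; omega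
      · have := X3 a2; have := (Z2 (Y2 b1 b2).2).1; omega
      · rw [← X3 a2, ← Y3 b2]
  let σ : Perm (Fin N) := Equiv.ofBijective w (Finite.injective_iff_bijective.1 hinj)
  have hσ : ∀ x, pos (σ x) = ((pos x).1, φ x) := hw
  clear_value σ
  refine ⟨σ, ⟨?_, ?_⟩, ?_, ?_⟩
  · rw [mem_W]
    intro x
    by_cases h2 : (pos x).2 < γ₁ (pos x).1 + γ₂ (pos x).1
    · refine Or.inr ⟨mem_A2.2 h2, mem_A2.2 ?_, ?_⟩
      · rw [hσ]
        by_cases h1 : (pos x).2 < γ₁ (pos x).1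
        · exact hS1 _ _ (φ1 x h1).2
        · exact (hS2 _ _ (φ2 x h1 h2).2).1
      · simp [hσ]
    · refine Or.inl (hL.inj ?_)
      rw [hσ, φ3 x h2]
  · intro x hx
    rw [mem_A2] at hx ⊢
    rw [hσ]
    by_cases h1 : (pos x).2 < γ₁ (pos x).1
    · exact iff_of_true h1 (φ1 x h1).2
    · exact iff_of_false h1 (hS2 _ _ (φ2 x h1 hx).2).2
  · intro x hx
    rw [hσ, (φ1 x (mem_A2.1 hx)).1]
  · intro x hx hx'
    rw [hσ, (φ2 x (fun h => hx' (mem_A2.2 h)) (mem_A2.1 hx)).1]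

end PartF2
end MuInj

open MvPolynomial
open scoped Classical TensorProduct

namespace MuInj
open Equiv (Perm)
section PartF3
variable {N n M : ℕ} {pos : Fin N → Fin n × ℕ}

lemma sp_le (γ₁ γ₂ : Fin n → ℕ) : Sd (A2 pos (γ₁ + γ₂)) (fun x => ((pos x).1, p2 pos γ₁ x)) ≤ Sd (A2 pos (γ₁ + γ₂)) (fun x => (pos x).1) :=
  Sd_le (Finset.Subset.refl _) (fun _ _ _ _ h => (Prod.mk.inj h).1)

lemma p2_eq {γ₁ : Fin n → ℕ} {x y : Fin N} : p2 pos γ₁ x = p2 pos γ₁ y ↔ (x ∈ A2 pos γ₁ ↔ y ∈ A2 pos γ₁) := by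
  rw [mem_A2, mem_A2, p2, p2]
  split_ifs with h1 h2 h2 <;> simp [h1, h2]

lemma Fib_div {γ₁ γ₂ : Fin n → ℕ} {S : Fin n → Finset ℕ} {w σ : Perm (Fin N)} (hw : Fib pos γ₁ γ₂ S w) (hσ : Fib pos γ₁ γ₂ S σ) :
    w⁻¹ * σ ∈ W (Sd (A2 pos (γ₁ + γ₂)) (fun x => ((pos x).1, p2 pos γ₁ x))) := by
  have h1 := mul_mem_W (inv_mem_W hw.1) hσ.1
  obtain ⟨a1, a2, a3⟩ := W_Sd h1
  rw [mem_W]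
  intro x
  by_cases hx : x ∈ A2 pos (γ₁ + γ₂)
  · refine Or.inr ⟨hx, (a1 x).2 hx, Prod.ext (a2 x).symm ?_⟩
    apply p2_eq.2
    have e1 := hσ.2 x hx
    have e2 := hw.2 _ ((a1 x).2 hx)
    rw [a2 x, Equiv.Perm.mul_apply, Equiv.Perm.inv_def, Equiv.apply_symm_apply] at e2
    rw [e1, ← e2]; rfl
  · exact Or.inl (a3 x hx).symm

lemma Fib_mul {γ₁ γ₂ : Fin n → ℕ} {S : Fin n → Finset ℕ} {w τ : Perm (Fin N)} (hw : Fib pos γ₁ γ₂ S w)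
    (hτ : τ ∈ W (Sd (A2 pos (γ₁ + γ₂)) (fun x => ((pos x).1, p2 pos γ₁ x)))) : Fib pos γ₁ γ₂ S (w * τ) := by
  refine ⟨mul_mem_W hw.1 (W_mono (sp_le γ₁ γ₂) hτ), fun x hx => ?_⟩
  obtain ⟨a1, a2, a3⟩ := W_Sd hτ
  have e := hw.2 (τ x) ((a1 x).2 hx)
  have h2 := a2 x
  rw [Prod.mk.injEq] at h2
  rw [h2.1] at e
  rw [Equiv.Perm.mul_apply, ← e]
  exact p2_eq.1 h2.2.symm

/-- the shuffle of a permutation -/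
noncomputable def Sof (pos : Fin N → Fin n × ℕ) (γ₁ : Fin n → ℕ) (σ : Perm (Fin N)) (i : Fin n) : Finset ℕ :=
  ((A2 pos γ₁).filter (fun x => (pos x).1 = i)).image (fun x => (pos (σ x)).2)

lemma A2_sub (γ₁ γ₂ : Fin n → ℕ) : A2 pos γ₁ ⊆ A2 pos (γ₁ + γ₂) := by
  intro x hx
  rw [mem_A2] at *
  simp only [Pi.add_apply]; omega

lemma Sof_mem (hL : Lay pos M) {γ₁ γ₂ : Fin n → ℕ} (hM : ∀ i, γ₁ i + γ₂ i ≤ M) {σ : Perm (Fin N)}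
    (hσ : σ ∈ W (Sd (A2 pos (γ₁ + γ₂)) (fun x => (pos x).1))) :
    Sof pos γ₁ σ ∈ shuffles γ₁ γ₂ ∧ Fib pos γ₁ γ₂ (Sof pos γ₁ σ) σ := by
  obtain ⟨a1, a2, a3⟩ := W_Sd hσ
  refine ⟨mem_shuf.2 fun i => ⟨?_, ?_⟩, hσ, ?_⟩
  · intro j hj
    obtain ⟨x, hx, rfl⟩ := Finset.mem_image.1 hj
    rw [Finset.mem_filter] at hx
    have := mem_A2.1 ((a1 x).2 (A2_sub γ₁ γ₂ hx.1))
    rw [a2 x, hx.2] at this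
    exact Finset.mem_range.2 this
  · rw [Sof, Finset.card_image_of_injOn, card_A2 hL (fun i => by have := hM i; omega)]
    intro x hx y hy h
    simp only [Finset.coe_filter, Set.mem_ofPred_eq] at hx hy
    apply σ.injective
    apply hL.inj
    refine Prod.ext ?_ h
    rw [a2 x, a2 y, hx.2, hy.2]
  · intro x hx
    constructor
    · intro h
      exact Finset.mem_image.2 ⟨x, by simp [h], rfl⟩
    · intro h
      obtain ⟨y, hy, h⟩ := Finset.mem_image.1 h
      rw [Finset.mem_filter] at hy
      have : x = y := by
        apply σ.injective
        apply hL.inj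
        refine Prod.ext ?_ h.symm
        rw [a2 x, a2 y, hy.2]
      rw [this]; exact hy.1

lemma Sof_eq (hL : Lay pos M) {γ₁ γ₂ : Fin n → ℕ} (hM : ∀ i, γ₁ i + γ₂ i ≤ M) {S : Fin n → Finset ℕ} (hS : S ∈ shuffles γ₁ γ₂)
    {σ : Perm (Fin N)} (hσ : Fib pos γ₁ γ₂ S σ) : Sof pos γ₁ σ = S := by
  funext i
  apply Finset.eq_of_subset_of_card_le
  · intro j hj
    obtain ⟨x, hx, rfl⟩ := Finset.mem_image.1 hj
    rw [Finset.mem_filter] at hx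
    rw [← hx.2]
    exact (hσ.2 x (A2_sub _ _ hx.1)).1 hx.1
  · rw [(mem_shuf.1 hS i).2, (mem_shuf.1 (Sof_mem hL hM hσ.1).1 i).2]

lemma Fib_card (hL : Lay pos M) {γ₁ γ₂ : Fin n → ℕ} (hM : ∀ i, γ₁ i + γ₂ i ≤ M) {S : Fin n → Finset ℕ} (hS : S ∈ shuffles γ₁ γ₂) :
    ((W (Sd (A2 pos (γ₁ + γ₂)) (fun x => (pos x).1))).filter (fun σ => Sof pos γ₁ σ = S)).card =
      (W (Sd (A2 pos (γ₁ + γ₂)) (fun x => ((pos x).1, p2 pos γ₁ x)))).card := by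
  obtain ⟨w, hw, -⟩ := Fib_exists hL hM hS
  symm
  refine Finset.card_bij (fun τ _ => w * τ) ?_ ?_ ?_
  · intro τ hτ
    have := Fib_mul hw hτ
    exact Finset.mem_filter.2 ⟨this.1, Sof_eq hL hM hS this⟩
  · intro τ _ τ' _ h
    exact mul_left_cancel h
  · intro σ hσ
    rw [Finset.mem_filter] at hσ
    have h := (Sof_mem hL hM hσ.1).2
    rw [hσ.2] at h
    exact ⟨w⁻¹ * σ, Fib_div hw h, by simp⟩

lemma subst1 (hL : Lay pos M) {γ₁ γ₂ : Fin n → ℕ} (hM : ∀ i, γ₁ i + γ₂ i ≤ M) {S : Fin n → Finset ℕ} (hS : S ∈ shuffles γ₁ γ₂)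
    {σ : Perm (Fin N)} (hσ : Fib pos γ₁ γ₂ S σ) {f : MvPolynomial (Fin N) ℚ} (hf : Sup (A2 pos γ₁) f)
    (hi : Inv (Sd (A2 pos γ₁) (fun x => (pos x).1)) f) : rename pos (rename σ f) = substAlong S (rename pos f) := by
  obtain ⟨w, hw, hw1, -⟩ := Fib_exists hL hM hS
  have hd := Fib_div hw hσ
  have e : σ = w * (w⁻¹ * σ) := by simp
  have hdf : rename (w⁻¹ * σ : Perm (Fin N)) f = f := by
    obtain ⟨a1, a2, a3⟩ := W_Sd hd
    refine Inv_of_Sup hf hi _ (fun x => ?_) (fun x => (Prod.mk.inj (a2 x)).1)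
    exact p2_eq.1 (Prod.mk.inj (a2 x)).2
  rw [e, rename_mul_perm, hdf]
  have := hom_eq_of_Sup hf ((rename pos).comp (rename w)) ((substAlong S).comp (rename pos)) ?_
  · rw [AlgHom.comp_apply, AlgHom.comp_apply] at this
    exact this
  · intro x hx
    simp only [AlgHom.comp_apply, rename_X, substAlong, aeval_X, hw1 x hx]

lemma subst2 (hL : Lay pos M) {γ₁ γ₂ : Fin n → ℕ} (hM : ∀ i, γ₁ i + γ₂ i ≤ M) {S : Fin n → Finset ℕ} (hS : S ∈ shuffles γ₁ γ₂)
    {σ : Perm (Fin N)} (hσ : Fib pos γ₁ γ₂ S σ) {f : PolyQ n} (hf : f ∈ Hspace γ₂) :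
    rename pos (rename σ (Fsh pos γ₁ f)) = substAlong (shuffleCompl γ₁ γ₂ S) f := by
  obtain ⟨w, hw, -, hw2⟩ := Fib_exists hL hM hS
  have hd := Fib_div hw hσ
  have e : σ = w * (w⁻¹ * σ) := by simp
  have hdf : rename (w⁻¹ * σ : Perm (Fin N)) (Fsh pos γ₁ f) = Fsh pos γ₁ f := by
    obtain ⟨a1, a2, a3⟩ := W_Sd hd
    refine Fsh_inv hL hM hf _ (fun x => (Prod.mk.inj (a2 x)).1) (fun x hx hx' => ?_)
    have h1 := p2_eq.1 (Prod.mk.inj (a2 x)).2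
    have h2 := a1 x
    rw [mem_A2, mem_A2, (Prod.mk.inj (a2 x)).1] at h1 h2
    simp only [Pi.add_apply] at h2
    omega
  rw [e, rename_mul_perm, hdf]
  have := hom_congr_H hf (((rename pos).comp (rename w)).comp (Fsh pos γ₁)) (substAlong (shuffleCompl γ₁ γ₂ S)) ?_
  · rw [AlgHom.comp_apply, AlgHom.comp_apply] at this
    exact this
  · intro i j hj
    obtain ⟨x, hx⟩ := hL.surj i (j + γ₁ i) (by have := hM i; omega)
    simp only [AlgHom.comp_apply, Fsh, substAlong, aeval_X]
    rw [← hx, bX_pos hL, rename_X, rename_X, hw2 x]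
    · simp [hx]
    · rw [mem_A2, hx]; simp; omega
    · rw [mem_A2, hx]; simp

lemma num_S (hL : Lay pos M) (Q : FinQuiver n) {γ₁ γ₂ : Fin n → ℕ} (hM : ∀ i, γ₁ i + γ₂ i ≤ M) {S : Fin n → Finset ℕ} (hS : S ∈ shuffles γ₁ γ₂)
    {σ : Perm (Fin N)} (hσ : Fib pos γ₁ γ₂ S σ) :
    rename pos (rename σ (Num (am Q) (fun x => (pos x).1) (p2 pos γ₁) (A2 pos (γ₁ + γ₂)))) = interactionNum Q γ₁ γ₂ S := by
  have hsub : ∀ i, Finset.range (γ₁ i + γ₂ i) ⊆ Finset.range M := fun i => Finset.range_subset_range.2 (hM i)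
  rw [mem_shuf] at hS
  have h := num_eq hL Q S (shuffleCompl γ₁ γ₂ S) (fun i => (hS i).1.trans (hsub i)) (fun i => Finset.sdiff_subset.trans (hsub i))
  simp only [interactionNum, arrowFactor]
  rw [h, rename_Num _ _ _ _ hσ.1, Num]
  congr 2
  funext x y
  rw [ne]
  congr 1
  obtain ⟨a1, a2, -⟩ := W_Sd_symm hσ.1
  have key : ∀ x, x ∈ A2 pos (γ₁ + γ₂) → (p2 pos γ₁ (σ.symm x) = 0 ↔ (pos x).2 ∈ S (pos x).1) := by
    intro x hx
    have := hσ.2 _ ((a1 x).2 hx)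
    rw [Equiv.apply_symm_apply, a2 x, mem_A2] at this
    rw [← this, p2]; simp
  have hle : ∀ x, p2 pos γ₁ x ≤ 1 := by intro x; rw [p2]; split_ifs <;> simp
  have e1 : ∀ x, (pos x).2 ∈ S (pos x).1 ↔ x ∈ A2 pos (γ₁ + γ₂) ∧ p2 pos γ₁ (σ.symm x) = 0 := by
    intro x
    by_cases hx : x ∈ A2 pos (γ₁ + γ₂)
    · rw [key x hx]; simp [hx]
    · simp only [hx, false_and, iff_false]
      intro h
      exact hx (mem_A2.2 (Finset.mem_range.1 ((hS _).1 h)))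
  have e2 : ∀ x, (pos x).2 ∈ shuffleCompl γ₁ γ₂ S (pos x).1 ↔ x ∈ A2 pos (γ₁ + γ₂) ∧ ¬ p2 pos γ₁ (σ.symm x) = 0 := by
    intro x
    rw [shuffleCompl, Finset.mem_sdiff, e1 x, Finset.mem_range, mem_A2, Pi.add_apply]
    tauto
  rw [e1, e2]
  have := hle (σ.symm x)
  have := hle (σ.symm y)
  simp only [eq_iff_iff]
  constructor
  · rintro ⟨h1, h2, h3⟩
    exact ⟨⟨h1, by omega⟩, h2, by omega⟩
  · rintro ⟨⟨h1, h2⟩, h3, h4⟩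
    exact ⟨h1, h3, by omega⟩

/-- loop quiver -/
def LQ (n : ℕ) : FinQuiver n := { Arr := Fin n, hd := id, tl := id }

lemma den_S (γ₁ γ₂ : Fin n → ℕ) (S : Fin n → Finset ℕ) : interactionDen γ₁ γ₂ S = interactionNum (LQ n) γ₁ γ₂ S := rfl

lemma am_LQ (i k : Fin n) : am (LQ n) i k = if i = k then 1 else 0 := by
  have e1 : ∀ a : (LQ n).Arr, (LQ n).tl a = a := fun _ => rfl
  have e2 : ∀ a : (LQ n).Arr, (LQ n).hd a = a := fun _ => rfl
  rw [am]
  split_ifs with h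
  · subst h
    rw [Finset.card_eq_one]
    refine ⟨(i : Fin n), ?_⟩
    ext a
    simp only [Finset.mem_filter, Finset.mem_univ, true_and, e1, e2, and_self]
    exact Finset.mem_singleton.symm
  · rw [Finset.card_eq_zero, Finset.filter_eq_empty_iff]
    rintro a - ⟨h1, h2⟩
    exact h (h1.symm.trans h2)

lemma Van_LQ (hL : Lay pos M) (γ₁ γ₂ : Fin n → ℕ) : Van (Sd (A2 pos (γ₁ + γ₂)) (fun x => (pos x).1)) =
    Van (Sd (A2 pos (γ₁ + γ₂)) (fun x => ((pos x).1, p2 pos γ₁ x))) * Num (am (LQ n)) (fun x => (pos x).1) (p2 pos γ₁) (A2 pos (γ₁ + γ₂)) := by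
  rw [Van_le (sp_le γ₁ γ₂), Num]
  congr 2
  funext x y
  rw [ne, am_LQ]
  simp only [Sd_iff, Prod.mk.injEq]
  by_cases hv : (pos x).1 = (pos y).1
  · have h1 := hL.ord x y hv
    have h2 : x = y → (pos x).2 = (pos y).2 := fun h => by rw [h]
    have h2' := fun h => hL.inj (Prod.ext hv h)
    simp only [hv, if_true, mem_A2, p2, true_and, h1] at *
    congr 1
    simp only [eq_iff_iff]
    have h3 : x = y ↔ (pos x).2 = (pos y).2 := ⟨h2, h2'⟩
    rw [h3]
    split_ifs <;> simp <;> omega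
  · have : x ≠ y := fun h => hv (by rw [h])
    simp [hv, this]

theorem binary (hL : Lay pos M) (Q : FinQuiver n) {γ₁ γ₂ : Fin n → ℕ} (hM : ∀ i, γ₁ i + γ₂ i ≤ M) {f₁ : MvPolynomial (Fin N) ℚ} (hf : Sup (A2 pos γ₁) f₁)
    (hi : Inv (Sd (A2 pos γ₁) (fun x => (pos x).1)) f₁) {f₂ : PolyQ n} (hf₂ : f₂ ∈ Hspace γ₂) :
    ∃ P, cohaMul Q γ₁ γ₂ (rename pos f₁) f₂ = rename pos P ∧
      C ((W (Sd (A2 pos (γ₁ + γ₂)) (fun x => ((pos x).1, p2 pos γ₁ x)))).card : ℚ) * Van (Sd (A2 pos (γ₁ + γ₂)) (fun x => (pos x).1)) * P =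
        Alt (Sd (A2 pos (γ₁ + γ₂)) (fun x => (pos x).1))
          (f₁ * Fsh pos γ₁ f₂ * Van (Sd (A2 pos (γ₁ + γ₂)) (fun x => ((pos x).1, p2 pos γ₁ x))) *
            Num (am Q) (fun x => (pos x).1) (p2 pos γ₁) (A2 pos (γ₁ + γ₂))) := by
  set s := Sd (A2 pos (γ₁ + γ₂)) (fun x => (pos x).1) with hs
  set sp := Sd (A2 pos (γ₁ + γ₂)) (fun x => ((pos x).1, p2 pos γ₁ x)) with hsp
  set v : Fin N → Fin n := fun x => (pos x).1
  set A := A2 pos (γ₁ + γ₂)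
  set G := f₁ * Fsh pos γ₁ f₂ * Van sp * Num (am Q) v (p2 pos γ₁) A with hG
  let al := algebraMap (PolyQ n) (FractionRing (PolyQ n))
  have hal : Function.Injective al := IsFractionRing.injective _ _
  have hpos : Function.Injective (rename pos : MvPolynomial (Fin N) ℚ → PolyQ n) := rename_injective _ hL.inj
  let tm : (Fin n → Finset ℕ) → FractionRing (PolyQ n) := fun S =>
    al (substAlong S (rename pos f₁) * substAlong (shuffleCompl γ₁ γ₂ S) f₂ * interactionNum Q γ₁ γ₂ S) / al (interactionDen γ₁ γ₂ S)
  have hV := Van_LQ hL γ₁ γ₂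
  have hterm : ∀ σ ∈ W s, al (rename pos (sg σ * rename σ G)) = al (rename pos (Van s)) * tm (Sof pos γ₁ σ) := by
    intro σ hσ
    obtain ⟨hS, hF⟩ := Sof_mem hL hM hσ
    have hden : al (interactionDen γ₁ γ₂ (Sof pos γ₁ σ)) ≠ 0 := by
      rw [den_S, ← num_S hL (LQ n) hM hS hF]
      intro h
      rw [← map_zero al] at h
      have h := hal h
      rw [← map_zero (rename pos)] at h
      have h := hpos h
      rw [← map_zero (rename σ)] at h
      exact PP_ne_zero _ (fun x => by rw [ne, if_neg]; omega) (rename_injective _ σ.injective h)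
    simp only [tm]
    rw [mul_div_assoc', eq_div_iff hden, ← map_mul, ← map_mul]
    congr 1
    rw [den_S, ← num_S hL (LQ n) hM hS hF, ← num_S hL Q hM hS hF, ← subst1 hL hM hS hF hf hi, ← subst2 hL hM hS hF hf₂]
    simp only [← map_mul]
    congr 1
    have hVa := Van_anti s σ hσ
    have e2 : sg σ * rename σ (Van s) = Van s := by
      rw [hVa, ← mul_assoc, sg_sq, one_mul]
    have e3 : rename σ (Van s) = rename σ (Van sp) * rename σ (Num (am (LQ n)) v (p2 pos γ₁) A) := by
      rw [← map_mul]; congr 1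
    rw [← e2, e3, hG]
    simp only [map_mul]
    ring
  have hsum : al (rename pos (Alt s G)) = al (rename pos (Van s)) * ((W sp).card * cohaMulRat Q γ₁ γ₂ (rename pos f₁) f₂) := by
    rw [Alt_apply, map_sum, map_sum, Finset.sum_congr rfl hterm,
      ← Finset.sum_fiberwise_of_maps_to (t := shuffles γ₁ γ₂) (g := Sof pos γ₁) (fun σ hσ => (Sof_mem hL hM hσ).1),
      cohaMulRat, Finset.mul_sum, Finset.mul_sum]
    refine Finset.sum_congr rfl fun S hS => ?_
    rw [Finset.sum_congr rfl (g := fun _ => al (rename pos (Van s)) * tm S), Finset.sum_const, Fib_card hL hM hS, nsmul_eq_mul]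
    · simp only [tm, al]
      ring
    · intro σ hσ
      rw [(Finset.mem_filter.1 hσ).2]
  obtain ⟨q, hq⟩ := Alt_dvd s G
  have hcard : ((W sp).card : ℚ) ≠ 0 := by
    have := Finset.card_ne_zero_of_mem (one_mem_W sp)
    exact_mod_cast this
  have hVne : al (rename pos (Van s)) ≠ 0 := by
    intro h
    rw [← map_zero al] at h
    have h := hal h
    rw [← map_zero (rename pos)] at h
    exact Van_ne_zero s (hpos h)
  have hP : C ((W sp).card : ℚ) * Van s * (C (((W sp).card : ℚ)⁻¹) * q) = Alt s G := by
    rw [hq]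
    have : C ((W sp).card : ℚ) * C (((W sp).card : ℚ)⁻¹) = (1 : MvPolynomial (Fin N) ℚ) := by
      rw [← C_mul, mul_inv_cancel₀ hcard, C_1]
    linear_combination (Van s * q) * this
  refine ⟨C (((W sp).card : ℚ)⁻¹) * q, ?_, hP⟩
  have hrat : al (rename pos (C (((W sp).card : ℚ)⁻¹) * q)) = cohaMulRat Q γ₁ γ₂ (rename pos f₁) f₂ := by
    rw [← hP, map_mul, map_mul, map_mul, map_mul] at hsum
    have hc : al (rename pos (C ((W sp).card : ℚ))) = ((W sp).card : FractionRing (PolyQ n)) := by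
      simp
    have hcne : ((W sp).card : FractionRing (PolyQ n)) ≠ 0 := by
      rw [← hc]
      intro h
      rw [← map_zero al] at h
      have h := hal h
      rw [rename_C, C_eq_zero] at h
      exact hcard h
    rw [hc] at hsum
    have := mul_ne_zero hcne hVne
    apply mul_left_cancel₀ this
    rw [hsum]; ring
  rw [cohaMul, dif_pos ⟨_, hrat⟩]
  apply hal
  rw [hrat]
  exact (⟨_, hrat⟩ : ∃ P : PolyQ n, al P = cohaMulRat Q γ₁ γ₂ (rename pos f₁) f₂).choose_spec

end PartF3
end MuInj

open MvPolynomial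
open scoped Classical TensorProduct

namespace MuInj
open Equiv (Perm)
section PartF4
variable {N n M : ℕ} {pos : Fin N → Fin n × ℕ}

lemma cohaProd_append (Q : FinQuiver n) (l : List ((Fin n → ℕ) × PolyQ n)) (hl : l ≠ []) (y : (Fin n → ℕ) × PolyQ n) :
    cohaProd Q (l ++ [y]) = ((cohaProd Q l).1 + y.1, cohaMul Q (cohaProd Q l).1 y.1 (cohaProd Q l).2 y.2) := by
  cases l with
  | nil => exact absurd rfl hl
  | cons x xs => simp [cohaProd, List.foldl_append]

lemma rename_fix {B : Finset (Fin N)} {f : MvPolynomial (Fin N) ℚ} (hf : Sup B f) {σ : Perm (Fin N)} (h : ∀ x ∈ B, σ x = x) : rename σ f = f := by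
  have := hom_eq_of_Sup hf (rename σ) (AlgHom.id ℚ _) (fun x hx => by simp [h x hx])
  simpa using this

/-- partial sums -/
noncomputable def Gam (γ : ℕ → Fin n → ℕ) (k : ℕ) : Fin n → ℕ := ∑ u ∈ Finset.range k, γ u

lemma Gam_succ (γ : ℕ → Fin n → ℕ) (k : ℕ) : Gam γ (k + 1) = Gam γ k + γ k := by
  rw [Gam, Finset.sum_range_succ]; rfl

lemma Gam_mono (γ : ℕ → Fin n → ℕ) {k l : ℕ} (h : k ≤ l) (i : Fin n) : Gam γ k i ≤ Gam γ l i := by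
  induction l, h using Nat.le_induction with
  | base => exact le_refl _
  | succ l _ ih => rw [Gam_succ, Pi.add_apply]; omega

/-- level -/
noncomputable def p0 (pos : Fin N → Fin n × ℕ) (γ : ℕ → Fin n → ℕ) (r : ℕ) (x : Fin N) : ℕ :=
  if h : ∃ k, x ∈ A2 pos (Gam γ (k + 1)) then Nat.find h else r

lemma p0_lt (γ : ℕ → Fin n → ℕ) (r k : ℕ) (hk : k ≤ r) (x : Fin N) : p0 pos γ r x < k ↔ x ∈ A2 pos (Gam γ k) := by
  have h0 : Gam γ 0 = 0 := by simp [Gam]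
  rw [p0]
  split_ifs with h
  · rw [Nat.find_lt_iff]
    constructor
    · rintro ⟨l, hl, hx⟩
      rw [mem_A2] at *
      have := Gam_mono γ (show l + 1 ≤ k by omega) (pos x).1
      omega
    · intro hx
      cases k with
      | zero => rw [h0, mem_A2] at hx; simp at hx
      | succ k => exact ⟨k, by omega, hx⟩
  · constructor
    · intro h; omega
    · intro hx
      exfalso
      apply h
      cases k with
      | zero => rw [h0, mem_A2] at hx; simp at hx
      | succ k => exact ⟨k, hx⟩

lemma Sup_Num (a : Fin n → Fin n → ℕ) (v : Fin N → Fin n) (p : Fin N → ℕ) (A : Finset (Fin N)) : Sup A (Num a v p A) := by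
  apply Sup_PP
  intro x y h
  rw [ne] at h
  by_contra h'
  exact h (if_neg (fun h'' => h' ⟨h''.1, h''.2.1⟩))

theorem iter (hL : Lay pos M) (Q : FinQuiver n) (γ : ℕ → Fin n → ℕ) (r : ℕ) (hM : ∀ i, Gam γ r i ≤ M) (k : ℕ) (hk : k + 1 ≤ r) :
    ∃ c : ℚ, c ≠ 0 ∧ ∀ f : ℕ → PolyQ n, (∀ u, f u ∈ Hspace (γ u)) → ∃ P : MvPolynomial (Fin N) ℚ,
      cohaProd Q ((List.range (k + 1)).map (fun u => (γ u, f u))) = (Gam γ (k + 1), rename pos P) ∧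
      Sup (A2 pos (Gam γ (k + 1))) P ∧ Inv (Sd (A2 pos (Gam γ (k + 1))) (fun x => (pos x).1)) P ∧
      C c * Van (Sd (A2 pos (Gam γ (k + 1))) (fun x => (pos x).1)) * P =
        Alt (Sd (A2 pos (Gam γ (k + 1))) (fun x => (pos x).1))
          ((∏ u ∈ Finset.range (k + 1), Fsh pos (Gam γ u) (f u)) *
            Van (Sd (A2 pos (Gam γ (k + 1))) (fun x => ((pos x).1, p0 pos γ r x))) *
            Num (am Q) (fun x => (pos x).1) (p0 pos γ r) (A2 pos (Gam γ (k + 1)))) := by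
  induction k with
  | zero =>
    set s := Sd (A2 pos (Gam γ (0 + 1))) (fun x => (pos x).1) with hs
    have hp : ∀ x ∈ A2 pos (Gam γ (0 + 1)), p0 pos γ r x = 0 := fun x hx => by
      have := (p0_lt γ r (0 + 1) hk x).2 hx; omega
    have hG0 : Gam γ 0 = 0 := by simp [Gam]
    have hG1 : Gam γ (0 + 1) = γ 0 := by rw [Gam_succ, hG0, zero_add]
    have hsp : Sd (A2 pos (Gam γ (0 + 1))) (fun x => ((pos x).1, p0 pos γ r x)) = s := by
      apply le_antisymm
      · exact Sd_le (Finset.Subset.refl _) (fun _ _ _ _ h => (Prod.mk.inj h).1)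
      · exact Sd_le (Finset.Subset.refl _) (fun x hx y hy h => Prod.ext h (by simp only [hp x hx, hp y hy]))
    have hnum : Num (am Q) (fun x => (pos x).1) (p0 pos γ r) (A2 pos (Gam γ (0 + 1))) = 1 := by
      rw [Num, PP]
      apply Finset.prod_eq_one; intro x _
      apply Finset.prod_eq_one; intro y _
      rw [ne, if_neg, pow_zero]
      rintro ⟨h1, h2, h3⟩
      rw [hp x h1, hp y h2] at h3
      omega
    have hM0 : ∀ i, γ 0 i ≤ M := fun i => by
      have := Gam_mono γ hk i
      rw [hG1] at this
      exact this.trans (hM i)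
    refine ⟨((W s).card : ℚ), ?_, ?_⟩
    · have := Finset.card_ne_zero_of_mem (one_mem_W s)
      exact_mod_cast this
    intro f hf
    have hI : Inv s (Fsh pos (Gam γ 0) (f 0)) := by
      intro σ hσ
      obtain ⟨a1, a2, a3⟩ := W_Sd hσ
      refine Fsh_inv hL (γ := γ 0) (s := Gam γ 0) (by simpa [hG0] using hM0) (hf 0) σ a2 ?_
      intro x h1 h2
      have := a1 x
      rw [mem_A2, mem_A2, a2 x, hG1] at this
      simp only [hG0, Pi.zero_apply, zero_add, Nat.zero_le, true_and] at h2 ⊢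
      exact this.2 h2
    refine ⟨Fsh pos (Gam γ 0) (f 0), ?_, ?_, hI, ?_⟩
    · have : rename pos (Fsh pos (Gam γ 0) (f 0)) = f 0 := by
        have := hom_congr_H (hf 0) ((rename pos).comp (Fsh pos (Gam γ 0))) (AlgHom.id ℚ _) ?_
        · simpa using this
        · intro i j hj
          obtain ⟨x, hx⟩ := hL.surj i j (by have := hM0 i; omega)
          simp only [AlgHom.comp_apply, Fsh, aeval_X, hG0, Pi.zero_apply, add_zero]
          rw [← hx, bX_pos hL, rename_X]; rfl
      rw [this, hG1]
      simp [cohaProd]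
    · refine Fsh_Sup hL (γ := γ 0) (s := Gam γ 0) (by simpa [hG0] using hM0) (hf 0) _ ?_
      intro x h1 h2
      rw [mem_A2, hG1]
      simpa [hG0] using h2
    · rw [hnum, mul_one, hsp, Alt_of_anti (s := s)]
      · simp
        ring
      · simpa using hI.anti (Van_anti s)
  | succ k ih =>
    obtain ⟨c, hc, ih⟩ := ih (by omega)
    set γ₁ := Gam γ (k + 1) with hγ₁
    have hG : Gam γ (k + 1 + 1) = γ₁ + γ (k + 1) := Gam_succ γ (k + 1)
    rw [hG]
    have hM' : ∀ i, γ₁ i + γ (k + 1) i ≤ M := fun i => by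
      have := (Gam_mono γ hk i).trans (hM i)
      rw [hG] at this
      exact this
    set v : Fin N → Fin n := fun x => (pos x).1 with hv
    set A := A2 pos γ₁ with hA
    set A' := A2 pos (γ₁ + γ (k + 1)) with hA'
    have hAA : A ⊆ A' := A2_sub _ _
    have hpA : ∀ x, p0 pos γ r x < k + 1 ↔ x ∈ A := fun x => p0_lt γ r (k + 1) (by omega) x
    have hpA' : ∀ x, p0 pos γ r x < k + 1 + 1 ↔ x ∈ A' := fun x => by
      rw [p0_lt γ r (k + 1 + 1) hk x, hG]
    have hp2 : ∀ x, x ∈ A → p2 pos γ₁ x = 0 := fun x hx => by rw [p2, if_pos (mem_A2.1 hx)]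
    have hp2' : ∀ x, x ∉ A → p2 pos γ₁ x = 1 := fun x hx => by rw [p2, if_neg (fun h => hx (mem_A2.2 h))]
    have hpB : ∀ x, x ∈ A' → x ∉ A → p0 pos γ r x = k + 1 := fun x h1 h2 => by
      rw [← hpA] at h2; rw [← hpA'] at h1; omega
    set s := Sd A' v with hs
    set s1 := Sd A v with hs1
    set sp2 := Sd A' (fun x => (v x, p2 pos γ₁ x)) with hsp2
    let VB := Van (Sd (A' \ A) v)
    have h21 : s1 ≤ sp2 := Sd_le hAA (fun x hx y hy h => Prod.ext h (by simp only [hp2 x hx, hp2 y hy]))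
    have hs1s : s1 ≤ s := Sd_le hAA (fun _ _ _ _ h => h)
    have hV2 : Van sp2 = Van s1 * VB := by
      simp only [VB, Van]
      rw [← PP_add]
      congr 1; funext x y
      simp only [Sd_iff, Prod.mk.injEq, Finset.mem_sdiff]
      by_cases hxy : x < y
      · have hne : x ≠ y := hxy.ne
        by_cases h1 : x ∈ A <;> by_cases h2 : y ∈ A
        · simp [hxy, hne, h1, h2, hAA h1, hAA h2, hp2]
        · simp [hxy, hne, h1, h2, hAA h1, hp2 x h1, hp2' y h2]
        · simp [hxy, hne, h1, h2, hAA h2, hp2 y h2, hp2' x h1]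
        · simp [hxy, hne, h1, h2, hp2' y h2, hp2' x h1]
      · simp [hxy]
    have hV0 : Van (Sd A' (fun x => (v x, p0 pos γ r x))) = Van (Sd A (fun x => (v x, p0 pos γ r x))) * VB := by
      simp only [VB, Van]
      rw [← PP_add]
      congr 1; funext x y
      simp only [Sd_iff, Prod.mk.injEq, Finset.mem_sdiff]
      by_cases hxy : x < y
      · have hne : x ≠ y := hxy.ne
        by_cases h3 : x ∈ A' <;> by_cases h4 : y ∈ A'
        · by_cases h1 : x ∈ A <;> by_cases h2 : y ∈ A
          · simp [hxy, hne, h1, h2, h3, h4]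
          · have e1 := hpB y h4 h2
            have e2 := (hpA x).2 h1
            have : p0 pos γ r x ≠ p0 pos γ r y := by omega
            simp [hxy, hne, h1, h2, this]
          · have e1 := hpB x h3 h1
            have e2 := (hpA y).2 h2
            have : p0 pos γ r x ≠ p0 pos γ r y := by omega
            simp [hxy, hne, h1, h2, this]
          · simp [hxy, hne, h1, h2, h3, h4, hpB x h3 h1, hpB y h4 h2]
        · have h2 : y ∉ A := fun h => h4 (hAA h)
          simp [hxy, hne, h2, h4]
        · have h2 : x ∉ A := fun h => h3 (hAA h)
          simp [hxy, hne, h2, h3]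
        · have h2 : x ∉ A := fun h => h3 (hAA h)
          simp [hxy, hne, h2, h3]
      · simp [hxy]
    have hN0 : Num (am Q) v (p0 pos γ r) A' = Num (am Q) v (p0 pos γ r) A * Num (am Q) v (p2 pos γ₁) A' := by
      simp only [Num]
      rw [← PP_add]
      congr 1; funext x y
      simp only [ne]
      by_cases h3 : x ∈ A' <;> by_cases h4 : y ∈ A'
      · by_cases h1 : x ∈ A <;> by_cases h2 : y ∈ A
        · simp [h1, h2, h3, h4, hp2 x h1, hp2 y h2]
        · have e1 := hpB y h4 h2
          have e2 := (hpA x).2 h1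
          have : p0 pos γ r x < p0 pos γ r y := by omega
          simp [h1, h2, h3, h4, this, hp2 x h1, hp2' y h2]
        · have e1 := hpB x h3 h1
          have e2 := (hpA y).2 h2
          have : ¬ p0 pos γ r x < p0 pos γ r y := by omega
          simp [h1, h2, this, hp2 y h2, hp2' x h1]
        · simp [h1, h2, hpB x h3 h1, hpB y h4 h2, hp2' x h1, hp2' y h2]
      · have h2 : y ∉ A := fun h => h4 (hAA h)
        simp [h2, h4]
      · have h2 : x ∉ A := fun h => h3 (hAA h)
        simp [h2, h3]
      · have h2 : x ∉ A := fun h => h3 (hAA h)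
        simp [h2, h3]
    let c2 : ℚ := ((W sp2).card : ℚ)
    have hc2 : c2 ≠ 0 := by
      have := Finset.card_ne_zero_of_mem (one_mem_W sp2)
      simp only [c2]; exact_mod_cast this
    let c1 : ℚ := ((W s1).card : ℚ)
    have hc1 : c1 ≠ 0 := by
      have := Finset.card_ne_zero_of_mem (one_mem_W s1)
      simp only [c1]; exact_mod_cast this
    refine ⟨c * c2 * c1⁻¹, mul_ne_zero (mul_ne_zero hc hc2) (inv_ne_zero hc1), ?_⟩
    intro f hf
    obtain ⟨P, hP1, hP2, hP3, hP4⟩ := ih f hf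
    obtain ⟨P', hP', hP''⟩ := binary hL Q hM' hP2 hP3 (hf (k + 1))
    set F := Fsh pos γ₁ (f (k + 1)) with hF
    have hFB : Sup (A' \ A) F := by
      refine Fsh_Sup hL hM' (hf (k + 1)) _ ?_
      intro x h1 h2
      rw [Finset.mem_sdiff, mem_A2, mem_A2, Pi.add_apply]
      exact ⟨h2, by omega⟩
    have hSup : Sup A' (P * F * Van sp2 * Num (am Q) v (p2 pos γ₁) A') :=
      (((hP2.mono hAA).mul (hFB.mono Finset.sdiff_subset)).mul (Sup_Van _)).mul (Sup_Num _ _ _ _)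
    refine ⟨P', ?_, Sup_of_Alt hc2 hP'' hSup, Inv_of_Alt hc2 hP'', ?_⟩
    · rw [List.range_succ, List.map_append, List.map_cons, List.map_nil, cohaProd_append _ _ (by simp), hP1, hP']
    · have hfix : ∀ σ ∈ W s1, ∀ x ∈ A' \ A, σ x = x := by
        intro σ hσ x hx
        exact (W_Sd hσ).2.2 x (Finset.mem_sdiff.1 hx).2
      have hg : Inv s1 (F * VB * Num (am Q) v (p2 pos γ₁) A') := by
        refine Inv.mul (Inv.mul (fun σ hσ => rename_fix hFB (hfix σ hσ)) (fun σ hσ => rename_fix (Sup_Van _) (hfix σ hσ))) ?_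
        exact fun σ hσ => Num_inv _ _ _ _ σ (W_mono h21 hσ)
      have hAA2 := Alt_Alt hs1s hg ((∏ u ∈ Finset.range (k + 1), Fsh pos (Gam γ u) (f u)) *
            Van (Sd A (fun x => (v x, p0 pos γ r x))) * Num (am Q) v (p0 pos γ r) A)
      rw [← hP4] at hAA2
      have e1 : F * VB * Num (am Q) v (p2 pos γ₁) A' * (C c * Van s1 * P) = c • (P * F * Van sp2 * Num (am Q) v (p2 pos γ₁) A') := by
        rw [hV2, smul_eq_C_mul]; ring
      rw [e1, map_smul, ← hP'', smul_eq_C_mul] at hAA2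
      have e2 : C (c * c2 * c1⁻¹) * Van s * P' = C c1⁻¹ * (C c * (C c2 * Van s * P')) := by
        simp only [C_mul]; ring
      rw [e2, hAA2, ← mul_assoc]
      have e3 : (C c1⁻¹ * ((W s1).card : MvPolynomial (Fin N) ℚ)) = 1 := by
        have : ((W s1).card : MvPolynomial (Fin N) ℚ) = C c1 := by simp [c1]
        rw [this, ← C_mul, inv_mul_cancel₀ hc1, C_1]
      rw [e3, one_mul, Finset.prod_range_succ _ (k + 1), hV0, hN0, ← hγ₁, ← hF]
      refine congrArg (Alt s) ?_
      clear_value VB F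
      ring

end PartF4
end MuInj

open MvPolynomial
open scoped Classical TensorProduct

namespace MuInj
section PartG1

/-- product of block renamings -/
noncomputable def GG (r : ℕ) : (⨂[ℚ] _u : Fin r, MvPolynomial ℕ ℚ) →ₗ[ℚ] MvPolynomial (ℕ × ℕ) ℚ :=
  PiTensorProduct.lift ((MultilinearMap.mkPiAlgebra ℚ (Fin r) (MvPolynomial (ℕ × ℕ) ℚ)).compLinearMap
    (fun u => (rename (fun j : ℕ => ((u : ℕ), j)) : MvPolynomial ℕ ℚ →ₐ[ℚ] MvPolynomial (ℕ × ℕ) ℚ).toLinearMap))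

lemma GG_tprod (r : ℕ) (f : Fin r → MvPolynomial ℕ ℚ) :
    GG r (PiTensorProduct.tprod ℚ f) = ∏ u : Fin r, rename (fun j : ℕ => ((u : ℕ), j)) (f u) := by
  simp [GG, PiTensorProduct.lift.tprod]

lemma inj_u (u : ℕ) : Function.Injective (fun j : ℕ => (u, j)) := fun _ _ h => (Prod.mk.inj h).2

/-- left inverse -/
noncomputable def LL (r : ℕ) : MvPolynomial (ℕ × ℕ) ℚ →ₗ[ℚ] (⨂[ℚ] _u : Fin r, MvPolynomial ℕ ℚ) :=
  (basisMonomials (ℕ × ℕ) ℚ).constr ℚ (fun s => PiTensorProduct.tprod ℚ fun u : Fin r =>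
    monomial (Finsupp.comapDomain (fun j : ℕ => ((u : ℕ), j)) s (inj_u u).injOn) 1)

lemma LL_GG (r : ℕ) : (LL r).comp (GG r) = LinearMap.id := by
  apply PiTensorProduct.ext
  refine Module.Basis.ext_multilinear (fun _ => basisMonomials ℕ ℚ) ?_
  intro s
  simp only [LinearMap.compMultilinearMap_apply, LinearMap.comp_apply, GG_tprod, coe_basisMonomials, LinearMap.id_apply,
    rename_monomial]
  rw [← monomial_sum_one]
  have h := (basisMonomials (ℕ × ℕ) ℚ).constr_basis ℚ (fun s => PiTensorProduct.tprod ℚ fun u : Fin r =>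
    (monomial (Finsupp.comapDomain (fun j : ℕ => ((u : ℕ), j)) s (inj_u u).injOn) (1:ℚ)))
    (∑ i : Fin r, Finsupp.mapDomain (fun j : ℕ => ((i : ℕ), j)) (s i))
  rw [coe_basisMonomials] at h
  rw [LL, h]
  congr 1
  funext u
  refine congrArg (fun t => monomial t (1 : ℚ)) ?_
  ext j
  rw [Finsupp.comapDomain_apply, Finsupp.finsetSum_apply, Finset.sum_eq_single u]
  · exact Finsupp.mapDomain_apply (inj_u u) _ _
  · intro b _ hb
    apply Finsupp.mapDomain_of_notMem_range
    rintro ⟨k, hk⟩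
    exact hb (Fin.ext (Prod.mk.inj hk).1)
  · simp

lemma GG_inj (r : ℕ) : Function.Injective (GG r) := by
  intro x y h
  have := congrArg (LL r) h
  rwa [← LinearMap.comp_apply, ← LinearMap.comp_apply, LL_GG] at this

variable {n r : ℕ} (β : Fin r → Fin n → ℕ) (iv : Fin r → Fin n) (m : Fin r → ℕ)

/-- forget vertex -/
noncomputable def g1 (u : Fin r) : ↥(Aspace (β u) (iv u) (m u)) →ₗ[ℚ] MvPolynomial ℕ ℚ :=
  (rename Prod.snd : PolyQ n →ₐ[ℚ] MvPolynomial ℕ ℚ).toLinearMap ∘ₗ (Aspace (β u) (iv u) (m u)).subtype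

lemma g1_inj (u : Fin r) : Function.Injective (g1 β iv m u) := by
  have key : ∀ f : ↥(Aspace (β u) (iv u) (m u)), rename (fun j : ℕ => (iv u, j)) (g1 β iv m u f) = (f : PolyQ n) := by
    intro f
    have hv : ∀ q ∈ (f : PolyQ n).vars, q.1 = iv u := f.2.2
    simp only [g1, LinearMap.comp_apply, Submodule.subtype_apply, AlgHom.toLinearMap_apply, rename_rename]
    have : ((rename ((fun j : ℕ => (iv u, j)) ∘ Prod.snd) : PolyQ n →ₐ[ℚ] PolyQ n) : PolyQ n →+* PolyQ n) f = (RingHom.id _) (f : PolyQ n) := by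
      refine hom_congr_vars (by ext; simp) ?_ rfl
      intro q hq _
      rw [RingHom.coe_coe, rename_X, RingHom.id_apply]
      congr 1
      exact Prod.ext (hv q hq).symm rfl
    exact this
  intro x y h
  apply Subtype.ext
  rw [← key x, ← key y, h]

/-- evaluation polynomial -/
noncomputable def PiM : (⨂[ℚ] u : Fin r, ↥(Aspace (β u) (iv u) (m u))) →ₗ[ℚ] MvPolynomial (ℕ × ℕ) ℚ :=
  (GG r).comp (PiTensorProduct.map (g1 β iv m))

lemma PiM_tprod (f : (u : Fin r) → ↥(Aspace (β u) (iv u) (m u))) :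
    PiM β iv m (PiTensorProduct.tprod ℚ f) = ∏ u : Fin r, rename (fun q : Fin n × ℕ => ((u : ℕ), q.2)) (f u : PolyQ n) := by
  rw [PiM, LinearMap.comp_apply, PiTensorProduct.map_tprod, GG_tprod]
  refine Finset.prod_congr rfl fun u _ => ?_
  simp only [g1, LinearMap.comp_apply, Submodule.subtype_apply, AlgHom.toLinearMap_apply, rename_rename]
  rfl

lemma PiM_inj : Function.Injective (PiM β iv m) := by
  have h := fun u => LinearMap.exists_leftInverse_of_injective (g1 β iv m u) (LinearMap.ker_eq_bot.2 (g1_inj β iv m u))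
  choose l hl using h
  have h2 : (PiTensorProduct.map l).comp (PiTensorProduct.map (g1 β iv m)) = LinearMap.id := by
    rw [← PiTensorProduct.map_comp]
    simp only [hl]
    exact PiTensorProduct.map_id
  rw [PiM, LinearMap.coe_comp]
  refine (GG_inj r).comp ?_
  intro x y h
  have := congrArg (PiTensorProduct.map l) h
  rwa [← LinearMap.comp_apply, ← LinearMap.comp_apply, h2] at this

/-- Zariski density -/
lemma eq_zero_of_eval (𝒞 : Finset (ℕ × ℕ)) (F : MvPolynomial (ℕ × ℕ) ℚ)
    (h : ∀ z : ℕ × ℕ → ℚ, Set.InjOn z 𝒞 → eval z F = 0) : F = 0 := by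
  set D : MvPolynomial (ℕ × ℕ) ℚ := ∏ c ∈ 𝒞, ∏ d ∈ 𝒞.erase c, (X c - X d) with hD
  have hD0 : D ≠ 0 := by
    rw [hD, Finset.prod_ne_zero_iff]
    intro c _
    rw [Finset.prod_ne_zero_iff]
    intro d hd
    rw [sub_ne_zero]
    intro h
    exact (Finset.mem_erase.1 hd).1 (X_injective h).symm
  have : D * F = 0 := by
    apply MvPolynomial.funext
    intro z
    rw [map_mul, map_zero]
    by_cases hz : Set.InjOn z 𝒞
    · rw [h z hz, mul_zero]
    · rw [Set.InjOn] at hz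
      push Not at hz
      obtain ⟨c, hc, d, hd, h1, h2⟩ := hz
      have : eval z D = 0 := by
        rw [hD, map_prod]
        refine Finset.prod_eq_zero hc ?_
        rw [map_prod]
        refine Finset.prod_eq_zero (Finset.mem_erase.2 ⟨h2.symm, hd⟩) ?_
        simp [h1]
      rw [this, zero_mul]
  exact (mul_eq_zero.1 this).resolve_left hD0

end PartG1
end MuInj

open MvPolynomial
open scoped Classical TensorProduct

namespace MuInj
section PartG2
variable {N n M : ℕ} {pos : Fin N → Fin n × ℕ}

lemma p0_eq (γ : ℕ → Fin n → ℕ) (r u : ℕ) (hu : u < r) (x : Fin N) :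
    p0 pos γ r x = u ↔ Gam γ u (pos x).1 ≤ (pos x).2 ∧ (pos x).2 < Gam γ u (pos x).1 + γ u (pos x).1 := by
  have h1 := p0_lt (pos := pos) γ r u hu.le x
  have h2 := p0_lt (pos := pos) γ r (u + 1) hu x
  rw [mem_A2] at h1 h2
  rw [Gam_succ, Pi.add_apply] at h2
  omega

/-- clusters -/
noncomputable def cl0 (pos : Fin N → Fin n × ℕ) (m : ℕ → ℕ) (β : ℕ → Fin n → ℕ) (r : ℕ) (x : Fin N) : ℕ × ℕ :=
  (p0 pos (fun u v => m u * β u v) r x,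
    ((pos x).2 - Gam (fun u v => m u * β u v) (p0 pos (fun u v => m u * β u v) r x) (pos x).1) /
      β (p0 pos (fun u v => m u * β u v) r x) (pos x).1)

lemma cl0_dm (hL : Lay pos M) (m : ℕ → ℕ) (β : ℕ → Fin n → ℕ) (r : ℕ)
    (hM : ∀ i, Gam (fun u v => m u * β u v) r i ≤ M) (x₀ : Fin N)
    (hx₀ : x₀ ∈ A2 pos (Gam (fun u v => m u * β u v) r)) :
    dm (fun x => (pos x).1) ((A2 pos (Gam (fun u v => m u * β u v) r)).filter (fun x => cl0 pos m β r x = cl0 pos m β r x₀)) =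
      fun i => (β (p0 pos (fun u v => m u * β u v) r x₀) i : ℤ) := by
  set γ : ℕ → Fin n → ℕ := fun u v => m u * β u v with hγ
  obtain ⟨u, hu⟩ : ∃ u, u = p0 pos γ r x₀ := ⟨_, rfl⟩
  obtain ⟨j, hj⟩ : ∃ j, j = ((pos x₀).2 - Gam γ u (pos x₀).1) / β u (pos x₀).1 := ⟨_, rfl⟩
  have hur : u < r := by rw [hu]; exact (p0_lt γ r r le_rfl x₀).2 hx₀
  have hc : cl0 pos m β r x₀ = (u, j) := by rw [cl0, hj, hu]
  have hx0 := (p0_eq γ r u hur x₀).1 hu.symm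
  have hjm : j < m u := by
    have h3 : (pos x₀).2 - Gam γ u (pos x₀).1 < m u * β u (pos x₀).1 := by
      have : γ u (pos x₀).1 = m u * β u (pos x₀).1 := rfl
      omega
    rw [hj]
    refine Nat.div_lt_of_lt_mul ?_
    rwa [mul_comm]
  rw [hc, ← hu]
  funext i
  rw [dm_apply]
  congr 1
  have hsucc := Gam_succ γ u
  have hG : ∀ i, Gam γ u i + m u * β u i ≤ Gam γ r i := by
    intro i
    have := Gam_mono γ (show u + 1 ≤ r from hur) i
    rwa [hsucc, Pi.add_apply] at this
  have hmul : j * β u i + β u i ≤ m u * β u i := by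
    have := Nat.mul_le_mul_right (β u i) (show j + 1 ≤ m u from hjm)
    rwa [Nat.add_mul, one_mul] at this
  have hcard : β u i = (Finset.Ico (Gam γ u i + j * β u i) (Gam γ u i + j * β u i + β u i)).card := by
    rw [Nat.card_Ico]; omega
  rw [hcard]
  refine Finset.card_bij (fun x _ => (pos x).2) ?_ ?_ ?_
  · intro x hx
    simp only [Finset.mem_filter, cl0, Prod.mk.injEq] at hx
    obtain ⟨⟨h1, h2, h3⟩, h4⟩ := hx
    have h2' : p0 pos γ r x = u := h2
    have h5 := (p0_eq γ r u hur x).1 h2'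
    have h3' : ((pos x).2 - Gam γ u i) / β u i = j := by rw [← h3, ← h4, ← h2']
    rw [h4] at h5
    have h6 : γ u i = m u * β u i := rfl
    have hb : 0 < β u i := by
      rcases Nat.eq_zero_or_pos (β u i) with h | h
      · rw [h] at h6; omega
      · exact h
    have h7 := Nat.div_add_mod ((pos x).2 - Gam γ u i) (β u i)
    have h8 := Nat.mod_lt ((pos x).2 - Gam γ u i) hb
    rw [h3', mul_comm] at h7
    rw [Finset.mem_Ico]
    omega
  · intro x hx y hy h
    simp only [Finset.mem_filter] at hx hy
    exact hL.inj (Prod.ext (hx.2.trans hy.2.symm) h)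
  · intro k hk
    rw [Finset.mem_Ico] at hk
    have := hG i
    have := hM i
    obtain ⟨x, hx⟩ := hL.surj i k (by omega)
    have hp : p0 pos γ r x = u := by
      rw [p0_eq γ r u hur, hx]
      have h6 : γ u i = m u * β u i := rfl
      dsimp only
      omega
    refine ⟨x, ?_, by rw [hx]⟩
    simp only [Finset.mem_filter, cl0, Prod.mk.injEq]
    refine ⟨⟨?_, hp, ?_⟩, by rw [hx]⟩
    · rw [mem_A2, hx]; dsimp only; omega
    · rw [show p0 pos (fun u v => m u * β u v) r x = u from hp, hx]
      dsimp only
      have hb : 0 < β u i := by omega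
      refine Nat.div_eq_of_lt_le ?_ ?_
      · change j * β u i ≤ k - Gam γ u i
        omega
      · change k - Gam γ u i < (j + 1) * β u i
        rw [Nat.add_mul]; omega

lemma eval_Fsh (hL : Lay pos M) (m : ℕ → ℕ) (β : ℕ → Fin n → ℕ) (r : ℕ)
    (hM : ∀ i, Gam (fun u v => m u * β u v) r i ≤ M) (u : ℕ) (hu : u < r) (i : Fin n) (hi : β u i = 1)
    (f : PolyQ n) (hf : f ∈ Aspace (β u) i (m u)) (z : ℕ × ℕ → ℚ) :
    eval (fun x => z (cl0 pos m β r x)) (Fsh pos (Gam (fun u v => m u * β u v) u) f) =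
      eval z (rename (fun q : Fin n × ℕ => (u, q.2)) f) := by
  set γ : ℕ → Fin n → ℕ := fun u v => m u * β u v with hγ
  have h1 : ∀ q ∈ f.vars, q.2 < m u * β u q.1 := hf.1.1
  have h2 : ∀ q ∈ f.vars, q.1 = i := hf.2
  have : (((eval (fun x => z (cl0 pos m β r x))).comp (Fsh pos (Gam γ u) : PolyQ n →+* _)) : PolyQ n →+* ℚ) f =
      ((eval z).comp ((rename (fun q : Fin n × ℕ => (u, q.2)) : PolyQ n →ₐ[ℚ] MvPolynomial (ℕ × ℕ) ℚ) : PolyQ n →+* _)) f := by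
    refine hom_congr_vars (RingHom.ext_rat _ _) ?_ rfl
    rintro ⟨i', j⟩ hq _
    have hi' : i' = i := h2 _ hq
    subst hi'
    have hj : j < m u := by have := h1 _ hq; rwa [hi, mul_one] at this
    have hG := Gam_mono γ (show u + 1 ≤ r from hu) i'
    have h6 : γ u i' = m u := by simp [hγ, hi]
    rw [Gam_succ, Pi.add_apply] at hG
    have := hM i'
    obtain ⟨x, hx⟩ := hL.surj i' (j + Gam γ u i') (by omega)
    have hp : p0 pos γ r x = u := by
      rw [p0_eq γ r u hu, hx]
      dsimp only
      omega
    simp only [RingHom.comp_apply, RingHom.coe_coe, rename_X, eval_X, Fsh, aeval_X]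
    rw [← hx, bX_pos hL, eval_X]
    congr 1
    rw [cl0, show p0 pos (fun u v => m u * β u v) r x = u from hp, hx]
    dsimp only
    rw [hi, Nat.div_one]
    congr 1
    exact Nat.add_sub_cancel _ _
  exact this

/-- linear quotient -/
lemma exists_quot (T : MvPolynomial (Fin N) ℚ →ₗ[ℚ] MvPolynomial (Fin N) ℚ) (V : MvPolynomial (Fin N) ℚ) (hV : V ≠ 0)
    (h : ∀ f, ∃ q, T f = V * q) : ∃ L : MvPolynomial (Fin N) ℚ →ₗ[ℚ] MvPolynomial (Fin N) ℚ, ∀ f, T f = V * L f := by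
  choose q hq using h
  refine ⟨⟨⟨q, ?_⟩, ?_⟩, hq⟩
  · intro x y
    apply mul_left_cancel₀ hV
    rw [← hq, map_add, hq, hq, mul_add]
  · intro a x
    apply mul_left_cancel₀ hV
    rw [← hq, map_smul, hq, RingHom.id_apply, mul_smul_comm]

end PartG2
end MuInj

open MvPolynomial
open scoped Classical TensorProduct

namespace MuInj
section PartG3

/-- padding -/
noncomputable def pad {r : ℕ} {S : Type*} [Zero S] (f : Fin r → S) (u : ℕ) : S := if h : u < r then f ⟨u, h⟩ else 0

lemma pad_lt {r : ℕ} {S : Type*} [Zero S] (f : Fin r → S) {u : ℕ} (h : u < r) : pad f u = f ⟨u, h⟩ := dif_pos h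
lemma pad_fin {r : ℕ} {S : Type*} [Zero S] (f : Fin r → S) (u : Fin r) : pad f u = f u := dif_pos u.2

theorem main_pos {n ℓ k : ℕ} (Q : FinQuiver n) (hQ : Q.Acyclic)
    (P : SubqPartition Q ℓ) (hDyn : P.Dynkin)
    (β : Fin (k + 1) → Fin n → ℕ) (blk : Fin (k + 1) → Fin ℓ) (hR : IsReinekeOrder P β blk)
    (iv : Fin (k + 1) → Fin n) (hiv : ∀ u, β u (iv u) = 1) (m : Fin (k + 1) → ℕ) :
    ∃ μ : (⨂[ℚ] u : Fin (k + 1), ↥(Aspace (β u) (iv u) (m u))) →ₗ[ℚ] PolyQ n,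
      (∀ f : (u : Fin (k + 1)) → ↥(Aspace (β u) (iv u) (m u)),
        μ (PiTensorProduct.tprod ℚ f) =
          cohaProdFin Q (fun u v => m u * β u v) (fun u => (f u : PolyQ n))) ∧
      Function.Injective μ := by
  have hdat := exists_dat Q hQ P hDyn β blk hR
  set γ : ℕ → Fin n → ℕ := fun u v => pad m u * pad β u v with hγ
  obtain ⟨M, hM⟩ : ∃ M, ∀ i, Gam γ (k + 1) i ≤ M :=
    ⟨∑ i, Gam γ (k + 1) i, fun i => Finset.single_le_sum (f := Gam γ (k + 1)) (fun _ _ => Nat.zero_le _) (Finset.mem_univ i)⟩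
  obtain ⟨pos, hL⟩ := exists_lay n M
  obtain ⟨c, hc, hit⟩ := iter hL Q γ (k + 1) hM k le_rfl
  set A := A2 pos (Gam γ (k + 1)) with hA
  set v : Fin (n * M) → Fin n := fun x => (pos x).1 with hv
  have hγH : ∀ (u : Fin (k + 1)) (f : ↥(Aspace (β u) (iv u) (m u))), (f : PolyQ n) ∈ Hspace (γ u) := by
    intro u f
    have : γ u = fun v => m u * β u v := by funext v; simp only [hγ, pad_fin]
    rw [this]
    exact f.2.1
  let Ψ : (⨂[ℚ] u : Fin (k + 1), ↥(Aspace (β u) (iv u) (m u))) →ₗ[ℚ] MvPolynomial (Fin (n * M)) ℚ :=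
    PiTensorProduct.lift ((MultilinearMap.mkPiAlgebra ℚ (Fin (k + 1)) (MvPolynomial (Fin (n * M)) ℚ)).compLinearMap
      (fun u => (Fsh pos (Gam γ u)).toLinearMap ∘ₗ (Aspace (β u) (iv u) (m u)).subtype))
  have hΨ : ∀ f : (u : Fin (k + 1)) → ↥(Aspace (β u) (iv u) (m u)),
      Ψ (PiTensorProduct.tprod ℚ f) = ∏ u : Fin (k + 1), Fsh pos (Gam γ u) (f u : PolyQ n) := by
    intro f
    simp [Ψ, PiTensorProduct.lift.tprod]
  have hG : ∀ (u : Fin (k + 1)) i, Gam γ u i + γ u i ≤ M := by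
    intro u i
    have h1 := Gam_mono γ (show (u : ℕ) + 1 ≤ k + 1 from u.2) i
    rw [Gam_succ, Pi.add_apply] at h1
    exact h1.trans (hM i)
  have hΨinv : ∀ t, Inv (Sd A (fun x => (v x, p0 pos γ (k + 1) x))) (Ψ t) := by
    intro t σ hσ
    obtain ⟨w1, w2, w3⟩ := W_Sd hσ
    induction t using PiTensorProduct.induction_on with
    | smul_tprod a f =>
      rw [map_smul, map_smul, hΨ, map_prod]
      congr 1
      refine Finset.prod_congr rfl fun u _ => ?_
      refine Fsh_inv hL (γ := γ u) (s := Gam γ u) (hG u) (hγH u (f u)) σ (fun x => (Prod.mk.inj (w2 x)).1) ?_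
      intro x h1 h2
      have h3 := (p0_eq γ (k + 1) u u.2 x).2 ⟨h1, h2⟩
      have h4 : p0 pos γ (k + 1) (σ x) = p0 pos γ (k + 1) x := congrArg Prod.snd (w2 x)
      have h5 := (p0_eq γ (k + 1) u u.2 (σ x)).1 (h4.trans h3)
      have h6 : (pos (σ x)).1 = (pos x).1 := (Prod.mk.inj (w2 x)).1
      rwa [h6] at h5
    | add x y hx hy => rw [map_add, map_add, hx, hy]
  set V := Van (Sd A v) with hV
  have hV0 : V ≠ 0 := Van_ne_zero _
  obtain ⟨L, hLq⟩ := exists_quot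
    ((Alt (Sd A v)) ∘ₗ (LinearMap.mulRight ℚ (Van (Sd A (fun x => (v x, p0 pos γ (k + 1) x))) * Num (am Q) v (p0 pos γ (k + 1)) A)))
    V hV0 (fun f => Alt_dvd _ _)
  have hLq' : ∀ f, Alt (Sd A v) (f * Van (Sd A (fun x => (v x, p0 pos γ (k + 1) x))) * Num (am Q) v (p0 pos γ (k + 1)) A) = V * L f := by
    intro f
    rw [← hLq f, LinearMap.comp_apply, LinearMap.mulRight_apply, mul_assoc]
  refine ⟨(rename pos : MvPolynomial (Fin (n * M)) ℚ →ₐ[ℚ] PolyQ n).toLinearMap ∘ₗ (c⁻¹ • L) ∘ₗ Ψ, ?_, ?_⟩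
  · intro f
    obtain ⟨R, hR1, -, -, hR4⟩ := hit (pad fun u => (f u : PolyQ n)) (by
      intro u
      by_cases h : u < k + 1
      · rw [pad_lt _ h]; exact hγH ⟨u, h⟩ (f ⟨u, h⟩)
      · rw [pad, dif_neg h]; exact Submodule.zero_mem _)
    have e1 : (List.ofFn fun u : Fin (k + 1) => ((fun v => m u * β u v : Fin n → ℕ), (f u : PolyQ n))) =
        (List.range (k + 1)).map (fun u => (γ u, pad (fun u => (f u : PolyQ n)) u)) := by
      apply List.ext_getElem
      · simp
      · intro i h1 h2
        have h : i < k + 1 := by simpa using h1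
        simp only [List.getElem_ofFn, List.getElem_map, List.getElem_range, hγ, pad_lt _ h]
    rw [cohaProdFin, e1, hR1]
    have e2 : ∏ u ∈ Finset.range (k + 1), Fsh pos (Gam γ u) (pad (fun u => (f u : PolyQ n)) u) = Ψ (PiTensorProduct.tprod ℚ f) := by
      rw [hΨ, Finset.prod_range]
      refine Finset.prod_congr rfl fun u _ => ?_
      rw [pad_fin]
    rw [e2, hLq'] at hR4
    have e3 : L (Ψ (PiTensorProduct.tprod ℚ f)) = C c * R := by
      apply mul_left_cancel₀ hV0
      rw [← hR4]; ring
    simp only [LinearMap.comp_apply, LinearMap.smul_apply, AlgHom.toLinearMap_apply, e3]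
    rw [← C_mul', ← mul_assoc, ← C_mul, inv_mul_cancel₀ hc, C_1, one_mul]
  · intro t₁ t₂ ht
    have h1 : L (Ψ t₁) = L (Ψ t₂) := by
      simp only [LinearMap.comp_apply, LinearMap.smul_apply, AlgHom.toLinearMap_apply] at ht
      have := rename_injective _ hL.inj ht
      exact smul_right_injective _ (inv_ne_zero hc) this
    apply PiM_inj β iv m
    rw [← sub_eq_zero]
    set cl := cl0 pos (pad m) (pad β) (k + 1) with hcl
    refine eq_zero_of_eval (A.image cl) _ ?_
    intro z hz
    have hmem : ∀ x ∈ A, cl x ∈ A.image cl := fun x hx => Finset.mem_image_of_mem _ hx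
    have hH := H_of hdat v A cl (A.image cl) Prod.fst hmem (by
        intro c hc
        obtain ⟨x, hx, rfl⟩ := Finset.mem_image.1 hc
        exact (p0_lt γ (k + 1) (k + 1) le_rfl x).2 hx) (by
        intro c hc
        obtain ⟨x, hx, rfl⟩ := Finset.mem_image.1 hc
        have hlt : p0 pos γ (k + 1) x < k + 1 := (p0_lt γ (k + 1) (k + 1) le_rfl x).2 hx
        have h3 := cl0_dm hL (pad m) (pad β) (k + 1) hM x hx
        have h4 : bh β (cl x).1 = fun i => (pad β (p0 pos γ (k + 1) x) i : ℤ) := by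
          have : (cl x).1 = p0 pos γ (k + 1) x := rfl
          rw [this, bh, dif_pos hlt, pad_lt _ hlt]
        rw [h4]
        exact h3) (fun S _ => eff_all hdat v _ S rfl) (p0 pos γ (k + 1)) (fun x _ => rfl)
    obtain ⟨κ, hκ, hT⟩ := thmT (am Q) v A cl (p0 pos γ (k + 1)) (fun x _ y _ h => congrArg Prod.fst h) hH
      (fun x => z (cl x)) (fun x hx y hy => ⟨fun h => congrArg z h, fun h => hz (hmem x hx) (hmem y hy) h⟩)
    have h5 := hT (Ψ t₁) (hΨinv t₁) _ (hLq' _)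
    have h6 := hT (Ψ t₂) (hΨinv t₂) _ (hLq' _)
    rw [h1, h6] at h5
    have h7 := mul_left_cancel₀ hκ h5
    suffices hs : ∀ t, eval z (PiM β iv m t) = eval (fun x => z (cl x)) (Ψ t) by
      rw [map_sub, hs, hs, h7, sub_self]
    intro t
    clear h7 h5 h6 hT h1 ht
    induction t using PiTensorProduct.induction_on with
    | smul_tprod a f =>
      rw [LinearMap.map_smul, LinearMap.map_smul, smul_eval, smul_eval, hΨ, PiM_tprod, map_prod, map_prod]
      congr 1
      refine Finset.prod_congr rfl fun u _ => ?_
      refine (eval_Fsh hL (pad m) (pad β) (k + 1) hM u u.2 (iv u) (by rw [pad_fin]; exact hiv u) (f u) ?_ z).symm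
      rw [pad_fin, pad_fin]
      exact (f u).2
    | add x y hx hy => rw [map_add, map_add, map_add, map_add, hx, hy]

theorem main_zero {n : ℕ} (Q : FinQuiver n) 
    (β : Fin 0 → Fin n → ℕ) (iv : Fin 0 → Fin n) (m : Fin 0 → ℕ) :
    ∃ μ : (⨂[ℚ] u : Fin 0, ↥(Aspace (β u) (iv u) (m u))) →ₗ[ℚ] PolyQ n,
      (∀ f : (u : Fin 0) → ↥(Aspace (β u) (iv u) (m u)),
        μ (PiTensorProduct.tprod ℚ f) =
          cohaProdFin Q (fun u v => m u * β u v) (fun u => (f u : PolyQ n))) ∧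
      Function.Injective μ := by
  refine ⟨(Algebra.linearMap ℚ (PolyQ n)) ∘ₗ (PiTensorProduct.isEmptyEquiv (Fin 0)).toLinearMap, ?_, ?_⟩
  · intro f
    simp [cohaProdFin, cohaProd, PiTensorProduct.isEmptyEquiv_apply_tprod]
  · rw [LinearMap.coe_comp]
    exact (FaithfulSMul.algebraMap_injective ℚ (PolyQ n)).comp (LinearEquiv.injective _)

end PartG3
end MuInj

/-- With `𝒬•` an admissible, ordered, Dynkin subquiver partition of
the acyclic quiver `Q`, `β` a Reineke order on `Φ₊(𝒬•)` with chosen vertices `iv u`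
where `β u (iv u) = 1`, and `m` a `𝒬•`-partition of the dimension vector `γ`, the
`ℚ`-linear map `μ_m : 𝒜_{β₁,m₁} ⊗ ⋯ ⊗ 𝒜_{β_r,m_r} → ℋ_γ` induced by the
left-to-right CoHA product is injective. -/
theorem mu_m_injective {n ℓ r : ℕ} (Q : FinQuiver n) (hQ : Q.Acyclic)
    (P : SubqPartition Q ℓ) (hord : P.Ordered) (hDyn : P.Dynkin)
    (β : Fin r → Fin n → ℕ) (blk : Fin r → Fin ℓ) (hR : IsReinekeOrder P β blk)
    (iv : Fin r → Fin n) (hiv : ∀ u, β u (iv u) = 1)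
    (γ : Fin n → ℕ) (m : Fin r → ℕ) (hm : (fun v => ∑ u, m u * β u v) = γ) :
    ∃ μ : (⨂[ℚ] u : Fin r, ↥(Aspace (β u) (iv u) (m u))) →ₗ[ℚ] PolyQ n,
      (∀ f : (u : Fin r) → ↥(Aspace (β u) (iv u) (m u)),
        μ (PiTensorProduct.tprod ℚ f) =
          cohaProdFin Q (fun u v => m u * β u v) (fun u => (f u : PolyQ n))) ∧
      Function.Injective μ := by
  cases r with
  | zero => exact MuInj.main_zero Q β iv m
  | succ k => exact MuInj.main_pos Q hQ P hDyn β blk hR iv hiv m
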